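/- There exist ε > 0 and T₀ > 0 such that for every unitary representation (ρ, V) of Γ on a complex Hilbert space V and every s = σ + it with δ − ε ≤ σ ≤ δ and |t| ≥ T₀, the only function F ∈ C¹(I, V) satisfying ℒ_{s,ρ}F = F is F ≡ 0. Here δ is the Hausdorff dimension of the limit set Λ. -/

import Mathlib

open MeasureTheory

/-- `SL(2,ℝ)`. -/
abbrev SL2 : Type := Matrix.SpecialLinearGroup (Fin 2) ℝ

/-- The Möbius transformation of `g ∈ SL(2,ℝ)` acting on `ℂ` (junk at the pole). -/
noncomputable def mobiusC (g : SL2) (z : ℂ) : ℂ :=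
  ((g.1 0 0 : ℂ) * z + (g.1 0 1 : ℂ)) / ((g.1 1 0 : ℂ) * z + (g.1 1 1 : ℂ))

/-- The Möbius transformation of `g ∈ SL(2,ℝ)` acting on `ℝ` (junk at the pole). -/
noncomputable def mobiusR (g : SL2) (x : ℝ) : ℝ :=
  (g.1 0 0 * x + g.1 0 1) / (g.1 1 0 * x + g.1 1 1)

/-- The derivative `γ'(z) = (uz+v)⁻²` of the Möbius transformation of `g`. -/
noncomputable def mobiusDerivC (g : SL2) (z : ℂ) : ℂ :=
  ((g.1 1 0 : ℂ) * z + (g.1 1 1 : ℂ))⁻¹ ^ 2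

/-- The derivative `γ'(x) = (ux+v)⁻²` of the Möbius transformation of `g`, real version. -/
noncomputable def mobiusDerivR (g : SL2) (x : ℝ) : ℝ :=
  (g.1 1 0 * x + g.1 1 1)⁻¹ ^ 2

/-- The Möbius transformation of `g ∈ SL(2,ℝ)` acting on the Riemann sphere `ℂ ∪ {∞}`. -/
noncomputable def mobiusS (g : SL2) (z : OnePoint ℂ) : OnePoint ℂ :=
  Option.elim z
    (if (g.1 1 0 : ℝ) = 0 then OnePoint.infty else (((g.1 0 0 / g.1 1 0 : ℝ) : ℂ) : OnePoint ℂ))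
    (fun w => if ((g.1 1 0 : ℂ) * w + (g.1 1 1 : ℂ)) = 0 then OnePoint.infty
      else ((mobiusC g w : ℂ) : OnePoint ℂ))

/-- The involution `a ↦ ā = a + r mod 2r` on the alphabet `𝒜 = Fin (2r)`. -/
def wordBar {r : ℕ} (a : Fin (2 * r)) : Fin (2 * r) :=
  ⟨(a.1 + r) % (2 * r), Nat.mod_lt _ (Nat.lt_of_le_of_lt (Nat.zero_le _) a.isLt)⟩

/-- A word: a finite sequence of letters with no adjacent letter equal to the bar of the
previous one. -/
def IsWord {r : ℕ} (w : List (Fin (2 * r))) : Prop :=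
  w.Chain' (fun x y => x ≠ wordBar y)

/-- The mirror word `𝐚̄ = (ā_n, …, ā_1)`. -/
def mirror {r : ℕ} (w : List (Fin (2 * r))) : List (Fin (2 * r)) :=
  (w.map wordBar).reverse

/-- `𝐚 → 𝐛` : either word is empty, or the last letter of `𝐚` is not the bar of the first
letter of `𝐛`. -/
def arrow {r : ℕ} (w v : List (Fin (2 * r))) : Prop :=
  ∀ x ∈ w.getLast?, ∀ y ∈ v.head?, x ≠ wordBar y

/-- `𝐚 ⇝ 𝐛` : both words are nonempty and the last letter of `𝐚` equals the first letter
of `𝐛`. -/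
def wiggly {r : ℕ} (w v : List (Fin (2 * r))) : Prop :=
  w ≠ [] ∧ v ≠ [] ∧ w.getLast? = v.head?

/-- Schottky data: pairwise disjoint closed discs centered on the real line, paired by
elements of `SL(2,ℝ)`. -/
structure Schottky where
  r : ℕ
  two_le_r : 2 ≤ r
  center : Fin (2 * r) → ℝ
  radius : Fin (2 * r) → ℝ
  radius_pos : ∀ a, 0 < radius a
  g : Fin (2 * r) → SL2
  disjoint : ∀ a b : Fin (2 * r), a ≠ b →
    Disjoint (closure (Metric.ball ((center a : ℂ)) (radius a)))
             (closure (Metric.ball ((center b : ℂ)) (radius b)))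
  g_bar : ∀ a : Fin (2 * r), g (wordBar a) = (g a)⁻¹
  maps : ∀ a : Fin (2 * r),
    mobiusS (g a) '' (((fun w : ℂ => (w : OnePoint ℂ)) ''
        Metric.ball ((center (wordBar a) : ℂ)) (radius (wordBar a)))ᶜ)
      = (fun w : ℂ => (w : OnePoint ℂ)) '' closure (Metric.ball ((center a : ℂ)) (radius a))

namespace Schottky

variable (S : Schottky)

/-- The open disc `D_a`. -/
def D (a : Fin (2 * S.r)) : Set ℂ := Metric.ball ((S.center a : ℂ)) (S.radius a)

/-- The union `𝐃` of the open discs. -/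
def Dall : Set ℂ := ⋃ a, S.D a

/-- The open interval `I_a = D_a ∩ ℝ`. -/
def Ireal (a : Fin (2 * S.r)) : Set ℝ := {x : ℝ | (x : ℂ) ∈ S.D a}

/-- The union `I` of the intervals `I_a`. -/
def Iall : Set ℝ := ⋃ a, S.Ireal a

/-- The group element `γ_𝐚 = γ_{a₁} ⋯ γ_{a_n}` associated to a word. -/
noncomputable def wprod (w : List (Fin (2 * S.r))) : SL2 := (w.map S.g).prod

/-- The Schottky group `Γ`, generated by the `γ_a`. -/
def SGroup : Subgroup SL2 := Subgroup.closure (Set.range S.g)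

theorem wprod_mem (w : List (Fin (2 * S.r))) : S.wprod w ∈ S.SGroup := by
  apply Subgroup.list_prod_mem
  intro x hx
  obtain ⟨a, -, rfl⟩ := List.mem_map.mp hx
  exact Subgroup.subset_closure ⟨a, rfl⟩

/-- `γ_𝐚` as an element of the Schottky group `Γ`. -/
noncomputable def wprodG (w : List (Fin (2 * S.r))) : S.SGroup := ⟨S.wprod w, S.wprod_mem w⟩

/-- The generator `γ_a` as an element of `Γ`. -/
noncomputable def genG (a : Fin (2 * S.r)) : S.SGroup :=
  ⟨S.g a, Subgroup.subset_closure ⟨a, rfl⟩⟩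

/-- The interval `I_𝐚 = γ_{𝐚'}(I_{a_n})` of a nonempty word. -/
noncomputable def Iset (w : List (Fin (2 * S.r))) : Set ℝ :=
  if h : w = [] then ∅ else mobiusR (S.wprod w.dropLast) '' S.Ireal (w.getLast h)

/-- `Υ_𝐚 = |I_𝐚|`, the length of the interval `I_𝐚`; `Υ_∅ = 1`. -/
noncomputable def ups (w : List (Fin (2 * S.r))) : ℝ :=
  if w = [] then 1 else (volume (S.Iset w)).toReal

/-- The Bourgain–Dyatlov partition `Z(τ)`. -/
def Zset (τ : ℝ) : Set (List (Fin (2 * S.r))) :=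
  {w | IsWord w ∧ w ≠ [] ∧ S.ups w ≤ τ ∧ τ < S.ups w.dropLast}

/-- The mirror set `Z̄(τ) = {𝐚 ∈ 𝒲 : 𝐚̄ ∈ Z(τ)}`. -/
def Zbar (τ : ℝ) : Set (List (Fin (2 * S.r))) :=
  {w | IsWord w ∧ mirror w ∈ S.Zset τ}

open Classical in
/-- The Bowen–Series map on the Riemann sphere (junk value `∞` off `𝐃`). -/
noncomputable def TS (z : OnePoint ℂ) : OnePoint ℂ :=
  if h : ∃ a : Fin (2 * S.r), ∃ w : ℂ, z = (w : OnePoint ℂ) ∧ w ∈ S.D a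
  then mobiusS (S.g h.choose)⁻¹ z
  else OnePoint.infty

/-- The limit set `Λ`: points of `𝐃` all of whose forward iterates under the Bowen–Series
map are defined (finite) and remain in `𝐃`. -/
def limitSet : Set ℂ :=
  {z : ℂ | ∀ n : ℕ, ∃ w : ℂ, (S.TS)^[n] (z : OnePoint ℂ) = (w : OnePoint ℂ) ∧ w ∈ S.Dall}

/-- The limit set, viewed inside `ℝ`. -/
def limitSetR : Set ℝ := {x : ℝ | (x : ℂ) ∈ S.limitSet}

/-- `δ`, the Hausdorff dimension of the limit set. -/
noncomputable def delta : ℝ := (dimH S.limitSet).toReal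

/-- `PowerPairs(τ)`: pairs `(𝐚,𝐛) ∈ Z̄(τ)²` such that `γ_{𝐚'}γ_{𝐛'}⁻¹` is a nontrivial
proper power in `Γ`. -/
def PowerPairs (τ : ℝ) : Set (List (Fin (2 * S.r)) × List (Fin (2 * S.r))) :=
  {p | p.1 ∈ S.Zbar τ ∧ p.2 ∈ S.Zbar τ ∧
    S.wprod p.1.dropLast * (S.wprod p.2.dropLast)⁻¹ ≠ 1 ∧
    ∃ γ₀ ∈ S.SGroup, ∃ q : ℕ, 2 ≤ q ∧
      S.wprod p.1.dropLast * (S.wprod p.2.dropLast)⁻¹ = (γ₀ : SL2) ^ q}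

end Schottky

/-- A finite system of uniformly contracting inverse branches on a space of labelled real points,
modelled on the inverse branches of a Bowen–Series map. -/
structure BranchSystem where
  A : Type
  [fin : Fintype A]
  [dec : DecidableEq A]
  X : Type
  bar : A → A
  lab : X → A
  pos : X → ℝ
  step : A → X → X
  d : A → X → ℝ
  om : X → ℝ
  C : ℝ
  th : ℝ
  one_le_C : 1 ≤ C
  th_pos : 0 < th
  th_lt : th < 1
  inj : ∀ x y, lab x = lab y → pos x = pos y → x = y
  lab_step : ∀ j x, lab x ≠ bar j → lab (step j x) = j
  d_lb : ∀ j x, lab x ≠ bar j → C⁻¹ ≤ d j x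
  d_ub : ∀ j x, lab x ≠ bar j → d j x ≤ C
  om_lb : ∀ x, C⁻¹ ≤ om x
  om_ub : ∀ x, om x ≤ C
  mob : ∀ j x y, lab x ≠ bar j → lab y ≠ bar j →
    |pos (step j x) - pos (step j y)| = √(d j x) * √(d j y) * |pos x - pos y|
  contr : ∀ j x, lab x ≠ bar j → d j x * om (step j x) ≤ th * om x
  dlip : ∀ j x y, lab x = lab y → lab x ≠ bar j →
    |Real.log (d j x) - Real.log (d j y)| ≤ C * |pos x - pos y|
  pos_bdd : ∀ x y, |pos x - pos y| ≤ C
  sep : ∀ x y, lab x ≠ lab y → C⁻¹ ≤ |pos x - pos y|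
  mix : ∀ a b, ∃ l, a ≠ bar l ∧ l ≠ bar b
  two : ∀ j, ∃ a b, a ≠ b ∧ a ≠ bar j ∧ b ≠ bar j
  surj : ∀ a, ∃ x, lab x = a

namespace BranchSystem

attribute [instance] BranchSystem.fin BranchSystem.dec

variable (B : BranchSystem)

/-- Apply the letters of a word one after the other, starting from the head. -/
def act : List B.A → B.X → B.X
  | [], x => x
  | j :: u, x => act u (B.step j x)

/-- Admissibility of a word at a point with label `a`. -/
def Adm : B.A → List B.A → Prop
  | _, [] => True
  | a, j :: u => a ≠ B.bar j ∧ Adm j u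

/-- Logarithm of the derivative of the composition along a word. -/
noncomputable def tau : List B.A → B.X → ℝ
  | [], _ => 0
  | j :: u, x => Real.log (B.d j x) + tau u (B.step j x)

/-- A quantity comparable to the distance, contracted by every branch. -/
noncomputable def dst (x y : B.X) : ℝ := √(B.om x) * √(B.om y) * |B.pos x - B.pos y|

variable {B}

theorem C_pos : 0 < B.C := lt_of_lt_of_le one_pos B.one_le_C

theorem om_pos (x : B.X) : 0 < B.om x := lt_of_lt_of_le (inv_pos.2 C_pos) (B.om_lb x)

theorem d_pos {j : B.A} {x : B.X} (h : B.lab x ≠ B.bar j) : 0 < B.d j x :=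
  lt_of_lt_of_le (inv_pos.2 C_pos) (B.d_lb j x h)

theorem dst_nonneg (x y : B.X) : 0 ≤ B.dst x y := by unfold dst; positivity

theorem dst_step {j : B.A} {x y : B.X} (hx : B.lab x ≠ B.bar j) (hy : B.lab y ≠ B.bar j) :
    B.dst (B.step j x) (B.step j y) ≤ B.th * B.dst x y := by
  unfold dst
  rw [B.mob j x y hx hy]
  have key : ∀ z, B.lab z ≠ B.bar j →
      √(B.om (B.step j z)) * √(B.d j z) ≤ √B.th * √(B.om z) := by
    intro z hz
    rw [← Real.sqrt_mul (om_pos _).le, ← Real.sqrt_mul B.th_pos.le, mul_comm (B.om _)]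
    exact Real.sqrt_le_sqrt (B.contr j z hz)
  have h1 := mul_le_mul (key x hx) (key y hy) (by positivity) (by positivity)
  have h2 := mul_le_mul_of_nonneg_right h1 (abs_nonneg (B.pos x - B.pos y))
  have h3 : √B.th * √B.th = B.th := Real.mul_self_sqrt B.th_pos.le
  calc _ = √(B.om (B.step j x)) * √(B.d j x) * (√(B.om (B.step j y)) * √(B.d j y)) *
        |B.pos x - B.pos y| := by ring
    _ ≤ _ := h2
    _ = (√B.th * √B.th) * (√(B.om x) * √(B.om y) * |B.pos x - B.pos y|) := by ring
    _ = _ := by rw [h3]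

theorem abs_le_dst (x y : B.X) : |B.pos x - B.pos y| ≤ B.C * B.dst x y := by
  unfold dst
  have hC := C_pos (B := B)
  have key : ∀ z : B.X, √(B.C⁻¹) ≤ √(B.om z) := fun z => Real.sqrt_le_sqrt (B.om_lb z)
  have h1 := mul_le_mul (key x) (key y) (by positivity) (by positivity)
  rw [Real.mul_self_sqrt (by positivity)] at h1
  have h2 := mul_le_mul_of_nonneg_right h1 (abs_nonneg (B.pos x - B.pos y))
  calc |B.pos x - B.pos y| = B.C * (B.C⁻¹ * |B.pos x - B.pos y|) := by field_simp
    _ ≤ _ := mul_le_mul_of_nonneg_left h2 hC.le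

theorem dst_le_abs (x y : B.X) : B.dst x y ≤ B.C * |B.pos x - B.pos y| := by
  unfold dst
  have hC := C_pos (B := B)
  have key : ∀ z : B.X, √(B.om z) ≤ √(B.C) := fun z => Real.sqrt_le_sqrt (B.om_ub z)
  have h1 := mul_le_mul (key x) (key y) (by positivity) (by positivity)
  rw [Real.mul_self_sqrt (by positivity)] at h1
  exact mul_le_mul_of_nonneg_right h1 (abs_nonneg _)

theorem dst_le (x y : B.X) : B.dst x y ≤ B.C ^ 2 := by
  have := dst_le_abs x y
  have h2 := mul_le_mul_of_nonneg_left (B.pos_bdd x y) (C_pos (B := B)).le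
  nlinarith

theorem dlip_dst {j : B.A} {x y : B.X} (hl : B.lab x = B.lab y) (hx : B.lab x ≠ B.bar j) :
    |Real.log (B.d j x) - Real.log (B.d j y)| ≤ B.C ^ 2 * B.dst x y := by
  have h1 := B.dlip j x y hl hx
  have h2 := mul_le_mul_of_nonneg_left (abs_le_dst x y) (C_pos (B := B)).le
  nlinarith

theorem lab_step_eq {j : B.A} {x y : B.X} (hx : B.lab x ≠ B.bar j) (hy : B.lab y ≠ B.bar j) :
    B.lab (B.step j x) = B.lab (B.step j y) := by
  rw [B.lab_step j x hx, B.lab_step j y hy]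

/-- The Lipschitz constant of `tau` with respect to `dst`. -/
noncomputable def Ktau (B : BranchSystem) : ℝ := B.C ^ 2 / (1 - B.th)

theorem Ktau_pos : 0 < B.Ktau :=
  div_pos (pow_pos C_pos 2) (sub_pos.2 B.th_lt)

theorem Ktau_eq : B.C ^ 2 + B.Ktau * B.th = B.Ktau := by
  have : (1 - B.th) ≠ 0 := (sub_pos.2 B.th_lt).ne'
  unfold Ktau; field_simp; ring

theorem Adm.step {u : List B.A} {j : B.A} {x : B.X} (h : B.Adm (B.lab x) (j :: u)) :
    B.Adm (B.lab (B.step j x)) u := by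
  rw [B.lab_step j x h.1]; exact h.2

theorem tau_lip (u : List B.A) : ∀ x y : B.X, B.lab x = B.lab y → B.Adm (B.lab x) u →
    |B.tau u x - B.tau u y| ≤ B.Ktau * B.dst x y := by
  induction u with
  | nil => intro x y _ _; simpa [tau] using mul_nonneg Ktau_pos.le (dst_nonneg x y)
  | cons j u ih =>
    intro x y hl h
    have hy : B.lab y ≠ B.bar j := hl ▸ h.1
    have h1 := dlip_dst hl h.1
    have h2 := ih _ _ (lab_step_eq h.1 hy) h.step
    have h3 := mul_le_mul_of_nonneg_left (dst_step h.1 hy) (Ktau_pos (B := B)).le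
    have h4 : B.Ktau * B.dst x y = B.C ^ 2 * B.dst x y + B.Ktau * (B.th * B.dst x y) := by
      conv_lhs => rw [← Ktau_eq]
      ring
    simp only [tau]
    rw [h4, show ∀ a b c e : ℝ, a + b - (c + e) = (a - c) + (b - e) by intros; ring]
    exact (abs_add_le _ _).trans (add_le_add h1 (h2.trans h3))

theorem dst_act (u : List B.A) : ∀ x y : B.X, B.lab x = B.lab y → B.Adm (B.lab x) u →
    B.dst (B.act u x) (B.act u y) ≤ B.th ^ u.length * B.dst x y := by
  induction u with
  | nil => intro x y _ _; simp [act]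
  | cons j u ih =>
    intro x y hl h
    have hy : B.lab y ≠ B.bar j := hl ▸ h.1
    refine (ih _ _ (lab_step_eq h.1 hy) h.step).trans ?_
    have := mul_le_mul_of_nonneg_left (dst_step h.1 hy) (pow_nonneg B.th_pos.le u.length)
    rw [List.length_cons, pow_succ, mul_assoc]; exact this

theorem lab_act_eq (u : List B.A) : ∀ x y : B.X, B.lab x = B.lab y → B.Adm (B.lab x) u →
    B.lab (B.act u x) = B.lab (B.act u y) := by
  induction u with
  | nil => intro x y h _; simpa [act]
  | cons j u ih =>
    intro x y hl h
    exact ih _ _ (lab_step_eq h.1 (hl ▸ h.1)) h.step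

theorem exp_tau_om (u : List B.A) : ∀ x : B.X, B.Adm (B.lab x) u →
    Real.exp (B.tau u x) * B.om (B.act u x) ≤ B.th ^ u.length * B.om x := by
  induction u with
  | nil => intro x _; simp [act, tau]
  | cons j u ih =>
    intro x h
    simp only [tau, act, List.length_cons]
    rw [Real.exp_add, Real.exp_log (d_pos h.1)]
    have h1 := mul_le_mul_of_nonneg_left (ih _ h.step) (d_pos h.1).le
    have h2 := mul_le_mul_of_nonneg_left (B.contr j x h.1) (pow_nonneg B.th_pos.le u.length)
    calc _ = B.d j x * (Real.exp (B.tau u (B.step j x)) * B.om (B.act u (B.step j x))) := by ring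
      _ ≤ _ := h1
      _ = B.th ^ u.length * (B.d j x * B.om (B.step j x)) := by ring
      _ ≤ _ := h2
      _ = _ := by ring

theorem exp_tau_le {u : List B.A} {x : B.X} (h : B.Adm (B.lab x) u) :
    Real.exp (B.tau u x) ≤ B.C ^ 2 * B.th ^ u.length := by
  have hC := C_pos (B := B)
  have h1 := exp_tau_om u x h
  have h2 : Real.exp (B.tau u x) * B.C⁻¹ ≤ Real.exp (B.tau u x) * B.om (B.act u x) :=
    mul_le_mul_of_nonneg_left (B.om_lb _) (Real.exp_pos _).le
  have h3 : B.th ^ u.length * B.om x ≤ B.th ^ u.length * B.C :=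
    mul_le_mul_of_nonneg_left (B.om_ub x) (pow_nonneg B.th_pos.le _)
  have h4 := mul_le_mul_of_nonneg_right (h2.trans (h1.trans h3)) hC.le
  rw [mul_assoc, inv_mul_cancel₀ hC.ne', mul_one] at h4
  linarith [h4, show B.th ^ u.length * B.C * B.C = B.C ^ 2 * B.th ^ u.length by ring]

theorem pow_le_exp_tau (u : List B.A) : ∀ x : B.X, B.Adm (B.lab x) u →
    B.C⁻¹ ^ u.length ≤ Real.exp (B.tau u x) := by
  induction u with
  | nil => intro x _; simp [tau]
  | cons j u ih =>
    intro x h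
    simp only [tau, List.length_cons]
    rw [Real.exp_add, Real.exp_log (d_pos h.1), pow_succ']
    exact mul_le_mul (B.d_lb j x h.1) (ih _ h.step)
      (pow_nonneg (inv_nonneg.2 C_pos.le) _) (d_pos h.1).le

theorem abs_act (u : List B.A) : ∀ x y : B.X, B.Adm (B.lab x) u → B.Adm (B.lab y) u →
    |B.pos (B.act u x) - B.pos (B.act u y)| =
      √(Real.exp (B.tau u x)) * √(Real.exp (B.tau u y)) * |B.pos x - B.pos y| := by
  induction u with
  | nil => intro x y _ _; simp [act, tau]
  | cons j u ih =>
    intro x y hx hy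
    simp only [tau, act]
    rw [ih _ _ hx.step hy.step, B.mob j x y hx.1 hy.1, Real.exp_add, Real.exp_add,
      Real.exp_log (d_pos hx.1), Real.exp_log (d_pos hy.1), Real.sqrt_mul (d_pos hx.1).le,
      Real.sqrt_mul (d_pos hy.1).le]
    ring

/-- Distortion of the derivative of a nonempty word, across labels. -/
theorem tau_dist {u : List B.A} (hu : u ≠ []) {x y : B.X} (hx : B.Adm (B.lab x) u)
    (hy : B.Adm (B.lab y) u) :
    |B.tau u x - B.tau u y| ≤ 2 * Real.log B.C + B.Ktau * B.C ^ 2 := by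
  cases u with
  | nil => exact absurd rfl hu
  | cons j u =>
    have hC := C_pos (B := B)
    have key : ∀ z, B.lab z ≠ B.bar j → |Real.log (B.d j z)| ≤ Real.log B.C := by
      intro z hz
      rw [abs_le]
      refine ⟨?_, Real.log_le_log (d_pos hz) (B.d_ub j z hz)⟩
      rw [← Real.log_inv]
      exact Real.log_le_log (inv_pos.2 hC) (B.d_lb j z hz)
    have h2 := tau_lip u _ _ (lab_step_eq hx.1 hy.1) hx.step
    have h3 := mul_le_mul_of_nonneg_left (dst_le (B.step j x) (B.step j y))
      (Ktau_pos (B := B)).le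
    simp only [tau]
    have h4 := key x hx.1
    have h5 := key y hy.1
    rw [abs_le] at *
    constructor <;> linarith [h2.1, h2.2, h4.1, h4.2, h5.1, h5.2]

theorem act_append (u v : List B.A) (x : B.X) : B.act (u ++ v) x = B.act v (B.act u x) := by
  induction u generalizing x with
  | nil => rfl
  | cons j u ih => exact ih _

theorem tau_append (u v : List B.A) (x : B.X) :
    B.tau (u ++ v) x = B.tau u x + B.tau v (B.act u x) := by
  induction u generalizing x with
  | nil => simp [tau, act]
  | cons j u ih => simp [tau, act, ih, add_assoc]

theorem adm_append {u v : List B.A} {x : B.X} (hu : B.Adm (B.lab x) u)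
    (hv : B.Adm (B.lab (B.act u x)) v) : B.Adm (B.lab x) (u ++ v) := by
  induction u generalizing x with
  | nil => exact hv
  | cons j u ih =>
    refine ⟨hu.1, ?_⟩
    have h := ih (x := B.step j x) hu.step hv
    rwa [B.lab_step j x hu.1] at h

end BranchSystem

namespace BranchSystem

variable {B : BranchSystem}

/-- The contribution of a single branch to a weighted transfer operator. -/
noncomputable def opA (q : B.A → B.X → ℝ) (j : B.A) (φ : B.X → ℝ) (x : B.X) : ℝ :=
  if B.lab x ≠ B.bar j then q j x * φ (B.step j x) else 0

/-- The transfer operator with weights `q`. -/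
noncomputable def opL (q : B.A → B.X → ℝ) (φ : B.X → ℝ) (x : B.X) : ℝ :=
  ∑ j, opA q j φ x

theorem opA_of {q : B.A → B.X → ℝ} {j : B.A} {φ : B.X → ℝ} {x : B.X} (h : B.lab x ≠ B.bar j) :
    opA q j φ x = q j x * φ (B.step j x) := if_pos h

theorem opA_nonneg {q : B.A → B.X → ℝ} (hq : ∀ j x, B.lab x ≠ B.bar j → 0 ≤ q j x) {j : B.A}
    {φ : B.X → ℝ} (hφ : ∀ x, 0 ≤ φ x) (x : B.X) : 0 ≤ opA q j φ x := by
  unfold opA; split_ifs with h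
  · exact mul_nonneg (hq j x h) (hφ _)
  · exact le_rfl

theorem opA_mono {q : B.A → B.X → ℝ} (hq : ∀ j x, B.lab x ≠ B.bar j → 0 ≤ q j x) {j : B.A}
    {φ ψ : B.X → ℝ} (h : ∀ x, φ x ≤ ψ x) (x : B.X) : opA q j φ x ≤ opA q j ψ x := by
  unfold opA; split_ifs with hx
  · exact mul_le_mul_of_nonneg_left (h _) (hq j x hx)
  · exact le_rfl

theorem opL_mono {q : B.A → B.X → ℝ} (hq : ∀ j x, B.lab x ≠ B.bar j → 0 ≤ q j x)
    {φ ψ : B.X → ℝ} (h : ∀ x, φ x ≤ ψ x) (x : B.X) : opL q φ x ≤ opL q ψ x :=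
  Finset.sum_le_sum fun _ _ => opA_mono hq h x

theorem opL_nonneg {q : B.A → B.X → ℝ} (hq : ∀ j x, B.lab x ≠ B.bar j → 0 ≤ q j x)
    {φ : B.X → ℝ} (hφ : ∀ x, 0 ≤ φ x) (x : B.X) : 0 ≤ opL q φ x :=
  Finset.sum_nonneg fun _ _ => opA_nonneg hq hφ x

theorem opA_le_opL {q : B.A → B.X → ℝ} (hq : ∀ j x, B.lab x ≠ B.bar j → 0 ≤ q j x)
    {φ : B.X → ℝ} (hφ : ∀ x, 0 ≤ φ x) (j : B.A) (x : B.X) : opA q j φ x ≤ opL q φ x :=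
  Finset.single_le_sum (f := fun j => opA q j φ x) (fun _ _ => opA_nonneg hq hφ x)
    (Finset.mem_univ j)

theorem le_opL {q : B.A → B.X → ℝ} (hq : ∀ j x, B.lab x ≠ B.bar j → 0 ≤ q j x)
    {φ : B.X → ℝ} (hφ : ∀ x, 0 ≤ φ x) {j : B.A} {x : B.X} (h : B.lab x ≠ B.bar j) :
    q j x * φ (B.step j x) ≤ opL q φ x := by
  rw [← opA_of (φ := φ) h]; exact opA_le_opL hq hφ j x

theorem opA_add (q : B.A → B.X → ℝ) (j : B.A) (φ ψ : B.X → ℝ) (x : B.X) :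
    opA q j (fun y => φ y + ψ y) x = opA q j φ x + opA q j ψ x := by
  unfold opA; split_ifs <;> ring

theorem opA_smul (q : B.A → B.X → ℝ) (j : B.A) (c : ℝ) (φ : B.X → ℝ) (x : B.X) :
    opA q j (fun y => c * φ y) x = c * opA q j φ x := by
  unfold opA; split_ifs <;> ring

theorem opL_add (q : B.A → B.X → ℝ) (φ ψ : B.X → ℝ) (x : B.X) :
    opL q (fun y => φ y + ψ y) x = opL q φ x + opL q ψ x := by
  simp only [opL, opA_add, Finset.sum_add_distrib]

theorem opL_smul (q : B.A → B.X → ℝ) (c : ℝ) (φ : B.X → ℝ) (x : B.X) :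
    opL q (fun y => c * φ y) x = c * opL q φ x := by
  simp only [opL, opA_smul, Finset.mul_sum]

/-- The geometric weights `|γ'|^s`. -/
noncomputable def dpow (B : BranchSystem) (s : ℝ) (j : B.A) (x : B.X) : ℝ := B.d j x ^ s

theorem dpow_nonneg (s : ℝ) (j : B.A) (x : B.X) (h : B.lab x ≠ B.bar j) : 0 ≤ dpow B s j x :=
  Real.rpow_nonneg (d_pos h).le s

theorem rpow_dist {a b s K : ℝ} (ha : 0 < a) (hb : 0 < b) (hs : 0 ≤ s)
    (h : |Real.log a - Real.log b| ≤ K) : a ^ s ≤ Real.exp (s * K) * b ^ s := by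
  rw [Real.rpow_def_of_pos ha, Real.rpow_def_of_pos hb, ← Real.exp_add, Real.exp_le_exp]
  nlinarith [(abs_le.1 h).2]

theorem iterate_dist {s : ℝ} (hs : 0 ≤ s) (k : ℕ) : ∀ x y : B.X, B.lab x = B.lab y →
    (opL (dpow B s))^[k] (fun _ => 1) x ≤
      Real.exp (s * B.Ktau * B.dst x y) * (opL (dpow B s))^[k] (fun _ => 1) y := by
  have hpos : ∀ k : ℕ, ∀ x : B.X, 0 ≤ (opL (dpow B s))^[k] (fun _ => 1) x := by
    intro k
    induction k with
    | zero => intro x; simp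
    | succ k ih => rw [Function.iterate_succ_apply']; exact opL_nonneg (dpow_nonneg s) ih
  induction k with
  | zero =>
    intro x y _
    simp only [Function.iterate_zero, id, mul_one]
    exact Real.one_le_exp (mul_nonneg (mul_nonneg hs Ktau_pos.le) (dst_nonneg x y))
  | succ k ih =>
    intro x y hl
    simp only [Function.iterate_succ_apply']
    generalize hφ : (opL (dpow B s))^[k] (fun _ => 1) = φ at ih
    have hφ0 : ∀ z, 0 ≤ φ z := hφ ▸ hpos k
    unfold opL
    rw [Finset.mul_sum]
    refine Finset.sum_le_sum fun j _ => ?_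
    unfold opA
    rw [← hl]
    split_ifs with h
    · have hy : B.lab y ≠ B.bar j := hl ▸ h
      have h1 : dpow B s j x ≤ Real.exp (s * (B.C ^ 2 * B.dst x y)) * dpow B s j y :=
        rpow_dist (d_pos h) (d_pos hy) hs (dlip_dst hl h)
      have h2 := ih _ _ (lab_step_eq h hy)
      have h3 := mul_le_mul h1 h2 (hφ0 _)
        (mul_nonneg (Real.exp_pos _).le (dpow_nonneg s j y hy))
      have h4 := mul_le_mul_of_nonneg_left (dst_step h hy) (mul_nonneg hs (Ktau_pos (B := B)).le)
      have h5 : s * B.Ktau * B.dst x y =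
          s * (B.C ^ 2 * B.dst x y) + s * B.Ktau * (B.th * B.dst x y) := by
        conv_lhs => rw [← Ktau_eq]
        ring
      have h6 : Real.exp (s * (B.C ^ 2 * B.dst x y)) *
          Real.exp (s * B.Ktau * B.dst (B.step j x) (B.step j y)) ≤
          Real.exp (s * B.Ktau * B.dst x y) := by
        rw [← Real.exp_add, Real.exp_le_exp]; linarith
      have h7 := mul_le_mul_of_nonneg_right h6
        (mul_nonneg (dpow_nonneg s j y hy) (hφ0 (B.step j y)))
      refine h3.trans (le_trans (le_of_eq ?_) h7)
      ring
    · simp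

/-- Existence of a regular superharmonic function for the transfer operator, when the growth of
the operator is subexponential. -/
theorem exists_superharmonic (B : BranchSystem) {s : ℝ} (hs : 0 ≤ s)
    (hgrow : ∀ Λ : ℝ, 1 < Λ → ∀ x : B.X,
      Summable fun k : ℕ => (opL (dpow B s))^[k] (fun _ => 1) x / Λ ^ k) :
    ∃ Ch : ℝ, 1 ≤ Ch ∧ ∀ Λ : ℝ, 1 < Λ → Λ ≤ 2 → ∃ h : B.X → ℝ, (∀ x, 1 ≤ h x) ∧
      (∀ x y, B.lab x = B.lab y → h x ≤ Real.exp (Ch * |B.pos x - B.pos y|) * h y) ∧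
      (∀ x y, h x ≤ Ch * h y) ∧ ∀ x, opL (dpow B s) h x ≤ Λ * h x := by
  have hC := C_pos (B := B)
  have hK := Ktau_pos (B := B)
  have hpos : ∀ k : ℕ, ∀ x : B.X, 0 ≤ (opL (dpow B s))^[k] (fun _ => 1) x := by
    intro k
    induction k with
    | zero => intro x; simp
    | succ k ih => rw [Function.iterate_succ_apply']; exact opL_nonneg (dpow_nonneg s) ih
  set Q : ℝ := Real.exp (s * B.Ktau * B.C ^ 2) * (B.C ^ s * 2) ^ 2 with hQ
  refine ⟨max 1 (max (s * B.Ktau * B.C) Q), le_max_left _ _, fun Λ h1 h2 => ?_⟩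
  have hΛ : 0 < Λ := by linarith
  set u : ℕ → B.X → ℝ := fun k x => (opL (dpow B s))^[k] (fun _ => 1) x / Λ ^ k with hu
  have hu0 : ∀ k x, 0 ≤ u k x := fun k x => div_nonneg (hpos k x) (pow_nonneg hΛ.le k)
  set h : B.X → ℝ := fun x => ∑' k, u k x with hh
  have hone : ∀ x, 1 ≤ h x := by
    intro x
    have := (hgrow Λ h1 x).le_tsum 0 (fun k _ => hu0 k x)
    simpa [u] using this
  have hdist : ∀ x y, B.lab x = B.lab y → h x ≤ Real.exp (s * B.Ktau * B.dst x y) * h y := by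
    intro x y hl
    rw [hh]
    simp only
    rw [← tsum_mul_left]
    refine (hgrow Λ h1 x).tsum_le_tsum (fun k => ?_) ((hgrow Λ h1 y).mul_left _)
    simp only [u]
    rw [← mul_div_assoc]
    exact div_le_div_of_nonneg_right (iterate_dist hs k x y hl) (pow_nonneg hΛ.le k)
  have hL : ∀ x, opL (dpow B s) h x = Λ * (h x - 1) := by
    intro x
    have e1 : opL (dpow B s) h x = ∑' k, opL (dpow B s) (u k) x := by
      unfold opL
      rw [Summable.tsum_finsetSum]
      · refine Finset.sum_congr rfl fun j _ => ?_
        unfold opA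
        split_ifs with hj
        · rw [hh]; simp only; rw [tsum_mul_left]
        · simp
      · intro j _
        unfold opA
        split_ifs with hj
        · exact (hgrow Λ h1 _).mul_left _
        · exact summable_zero
    have e2 : ∀ k, opL (dpow B s) (u k) x = Λ * u (k + 1) x := by
      intro k
      simp only [u]
      have : (fun x => (opL (dpow B s))^[k] (fun _ => 1) x / Λ ^ k) =
          fun x => (Λ ^ k)⁻¹ * (opL (dpow B s))^[k] (fun _ => 1) x := by
        funext z; rw [div_eq_inv_mul]
      rw [this, opL_smul, Function.iterate_succ_apply', pow_succ]
      field_simp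
    rw [e1]
    simp only [e2]
    rw [tsum_mul_left]
    congr 1
    have e3 := (hgrow Λ h1 x).tsum_eq_zero_add
    have e4 : u 0 x = 1 := by simp [u]
    have e5 : h x = 1 + ∑' k, u (k + 1) x := by rw [← e4]; exact e3
    rw [e5]; ring
  have hL' : ∀ x, opL (dpow B s) h x ≤ Λ * h x := by
    intro x; rw [hL]; nlinarith
  have hstep : ∀ j x, B.lab x ≠ B.bar j → h (B.step j x) ≤ B.C ^ s * 2 * h x := by
    intro j x hj
    have e1 := (le_opL (dpow_nonneg s) (fun x => zero_le_one.trans (hone x)) hj).trans (hL' x)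
    have e2 : B.C⁻¹ ^ s ≤ dpow B s j x :=
      Real.rpow_le_rpow (inv_nonneg.2 hC.le) (B.d_lb j x hj) hs
    have e3 : B.C⁻¹ ^ s * h (B.step j x) ≤ 2 * h x :=
      (mul_le_mul_of_nonneg_right e2 (zero_le_one.trans (hone _))).trans
        (e1.trans (mul_le_mul_of_nonneg_right h2 (zero_le_one.trans (hone _))))
    have e4 : B.C ^ s * B.C⁻¹ ^ s = 1 := by
      rw [← Real.mul_rpow hC.le (inv_nonneg.2 hC.le), mul_inv_cancel₀ hC.ne', Real.one_rpow]
    have e5 := mul_le_mul_of_nonneg_left e3 (Real.rpow_nonneg hC.le s)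
    rw [← mul_assoc, e4, one_mul] at e5
    linarith
  refine ⟨h, hone, fun x y hl => (hdist x y hl).trans ?_, fun x y => ?_, hL'⟩
  · refine mul_le_mul_of_nonneg_right (Real.exp_le_exp.2 ?_) (zero_le_one.trans (hone y))
    have e1 := mul_le_mul_of_nonneg_left (dst_le_abs x y) (mul_nonneg hs hK.le)
    have e2 : s * B.Ktau * B.C ≤ max 1 (max (s * B.Ktau * B.C) Q) :=
      (le_max_left _ _).trans (le_max_right _ _)
    have e3 := mul_le_mul_of_nonneg_right e2 (abs_nonneg (B.pos x - B.pos y))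
    linarith
  · obtain ⟨l, hl1, hl2⟩ := B.mix (B.lab y) (B.lab x)
    have hl3 : B.lab (B.step l y) ≠ B.bar (B.lab x) := by rwa [B.lab_step l y hl1]
    set z := B.step (B.lab x) (B.step l y)
    have e0 : B.lab x = B.lab z := (B.lab_step _ _ hl3).symm
    have hb : 0 ≤ B.C ^ s * 2 := by positivity
    have e1 : h z ≤ (B.C ^ s * 2) ^ 2 * h y := by
      have := mul_le_mul_of_nonneg_left (hstep l y hl1) hb
      have := (hstep _ _ hl3).trans this
      rw [sq, mul_assoc]; exact this
    have e2 : Real.exp (s * B.Ktau * B.dst x z) ≤ Real.exp (s * B.Ktau * B.C ^ 2) :=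
      Real.exp_le_exp.2 (mul_le_mul_of_nonneg_left (dst_le x z) (mul_nonneg hs hK.le))
    have e3 : h x ≤ Q * h y := by
      rw [hQ, mul_assoc]
      exact (hdist x z e0).trans (mul_le_mul e2 e1 (zero_le_one.trans (hone z)) (Real.exp_pos _).le)
    exact e3.trans (mul_le_mul_of_nonneg_right ((le_max_right _ _).trans (le_max_right _ _))
      (zero_le_one.trans (hone y)))

end BranchSystem

namespace BranchSystem

variable {B : BranchSystem}

/-- Regular subprobability weights on the branches. -/
structure IsWeight (p : B.A → B.X → ℝ) (c K : ℝ) : Prop where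
  c_pos : 0 < c
  K_nonneg : 0 ≤ K
  lb : ∀ j x, B.lab x ≠ B.bar j → c ≤ p j x
  sub : ∀ x, opL p (fun _ => 1) x ≤ 1
  lip : ∀ j x y, B.lab x = B.lab y → B.lab x ≠ B.bar j →
    p j x ≤ Real.exp (K * |B.pos x - B.pos y|) * p j y

/-- The product of the weights along a word. -/
noncomputable def wt (p : B.A → B.X → ℝ) : List B.A → B.X → ℝ
  | [], _ => 1
  | j :: u, x => p j x * wt p u (B.step j x)

/-- The contribution of a single word to the iterates of a weighted transfer operator. -/
noncomputable def opW (p : B.A → B.X → ℝ) : List B.A → (B.X → ℝ) → B.X → ℝ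
  | [], ψ => ψ
  | j :: u, ψ => opA p j (opW p u ψ)

/-- Bounded functions. -/
def Bd (φ : B.X → ℝ) : Prop := ∃ K, ∀ x, |φ x| ≤ K

theorem Bd.add {φ ψ : B.X → ℝ} (h : Bd φ) (h' : Bd ψ) : Bd (fun x => φ x + ψ x) := by
  obtain ⟨K, hK⟩ := h
  obtain ⟨K', hK'⟩ := h'
  exact ⟨K + K', fun x => (abs_add_le _ _).trans (add_le_add (hK x) (hK' x))⟩

theorem Bd.smul {φ : B.X → ℝ} (c : ℝ) (h : Bd φ) : Bd (fun x => c * φ x) := by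
  obtain ⟨K, hK⟩ := h
  exact ⟨|c| * K, fun x => by rw [abs_mul]; exact mul_le_mul_of_nonneg_left (hK x) (abs_nonneg c)⟩

theorem Bd.const (c : ℝ) : Bd (B := B) (fun _ => c) := ⟨|c|, fun _ => le_rfl⟩

theorem Bd.of_le {φ ψ : B.X → ℝ} (h : Bd ψ) (h0 : ∀ x, 0 ≤ φ x) (h1 : ∀ x, φ x ≤ ψ x) :
    Bd φ := by
  obtain ⟨K, hK⟩ := h
  exact ⟨K, fun x => by rw [abs_of_nonneg (h0 x)]; exact (h1 x).trans ((le_abs_self _).trans (hK x))⟩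

namespace IsWeight

variable {p : B.A → B.X → ℝ} {c K : ℝ} (hp : IsWeight p c K)
include hp

theorem pos {j : B.A} {x : B.X} (h : B.lab x ≠ B.bar j) : 0 < p j x :=
  hp.c_pos.trans_le (hp.lb j x h)

theorem nonneg (j : B.A) (x : B.X) (h : B.lab x ≠ B.bar j) : 0 ≤ p j x := (hp.pos h).le

theorem le_one {j : B.A} {x : B.X} (h : B.lab x ≠ B.bar j) : p j x ≤ 1 := by
  have := le_opL hp.nonneg (fun _ => zero_le_one) h (φ := fun _ => 1)
  simpa using this.trans (hp.sub x)

theorem c_le_one (x : B.X) : c ≤ 1 := by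
  obtain ⟨l, hl, -⟩ := B.mix (B.lab x) (B.lab x)
  exact (hp.lb l x hl).trans (hp.le_one hl)

theorem opL_le {φ : B.X → ℝ} {M : ℝ} (hM : 0 ≤ M) (h : ∀ x, φ x ≤ M) (x : B.X) :
    opL p φ x ≤ M := by
  have h1 := opL_mono hp.nonneg (ψ := fun _ => M * 1) (fun x => by simpa using h x) x
  rw [opL_smul] at h1
  nlinarith [hp.sub x]

theorem abs_opL_le {φ : B.X → ℝ} {M : ℝ} (h : ∀ x, |φ x| ≤ M) (x : B.X) :
    |opL p φ x| ≤ M := by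
  have hM : 0 ≤ M := (abs_nonneg _).trans (h x)
  rw [abs_le]
  have h1 := hp.opL_le hM (φ := fun x => (-1) * φ x) (fun x => by linarith [(abs_le.1 (h x)).1]) x
  rw [opL_smul] at h1
  exact ⟨by linarith, hp.opL_le hM (fun x => (abs_le.1 (h x)).2) x⟩

theorem bd_opL {φ : B.X → ℝ} (h : Bd φ) : Bd (opL p φ) := by
  obtain ⟨M, hM⟩ := h
  exact ⟨M, hp.abs_opL_le hM⟩

theorem abs_iterate_le {φ : B.X → ℝ} {M : ℝ} (h : ∀ x, |φ x| ≤ M) (n : ℕ) (x : B.X) :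
    |(opL p)^[n] φ x| ≤ M := by
  induction n generalizing φ with
  | zero => exact h x
  | succ n ih => exact ih (hp.abs_opL_le h)

theorem bd_iterate {φ : B.X → ℝ} (h : Bd φ) (n : ℕ) : Bd ((opL p)^[n] φ) := by
  obtain ⟨M, hM⟩ := h
  exact ⟨M, hp.abs_iterate_le hM n⟩

theorem iterate_mono {φ ψ : B.X → ℝ} (h : ∀ x, φ x ≤ ψ x) (n : ℕ) (x : B.X) :
    (opL p)^[n] φ x ≤ (opL p)^[n] ψ x := by
  induction n generalizing φ ψ with
  | zero => exact h x
  | succ n ih => exact ih (opL_mono hp.nonneg h)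

theorem iterate_nonneg {φ : B.X → ℝ} (h : ∀ x, 0 ≤ φ x) (n : ℕ) (x : B.X) :
    0 ≤ (opL p)^[n] φ x := by
  induction n generalizing φ with
  | zero => exact h x
  | succ n ih => exact ih (opL_nonneg hp.nonneg h)

/-- Jensen's inequality for the square. -/
theorem opL_sq_le (φ : B.X → ℝ) (x : B.X) :
    opL p φ x ^ 2 ≤ opL p (fun y => φ y ^ 2) x := by
  set m := opL p φ x with hm
  have h1 : 0 ≤ opL p (fun y => (φ y ^ 2 + (-2 * m) * φ y) + m ^ 2 * 1) x :=
    opL_nonneg hp.nonneg (fun y => by nlinarith [sq_nonneg (φ y - m)]) x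
  rw [opL_add, opL_add, opL_smul, opL_smul, ← hm] at h1
  nlinarith [mul_le_mul_of_nonneg_left (hp.sub x) (sq_nonneg m)]

theorem wt_pos (u : List B.A) : ∀ x : B.X, B.Adm (B.lab x) u → 0 < wt p u x := by
  induction u with
  | nil => intro x _; exact one_pos
  | cons j u ih => intro x h; exact mul_pos (hp.pos h.1) (ih _ h.step)

omit hp in
theorem opW_of {u : List B.A} {ψ : B.X → ℝ} {x : B.X} (h : B.Adm (B.lab x) u) :
    opW p u ψ x = wt p u x * ψ (B.act u x) := by
  induction u generalizing x with
  | nil => simp [opW, wt, act]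
  | cons j u ih =>
    simp only [opW, wt, act]
    rw [opA_of h.1, ih h.step, mul_assoc]

omit hp in
theorem opW_of_not {u : List B.A} {ψ : B.X → ℝ} {x : B.X} (h : ¬ B.Adm (B.lab x) u) :
    opW p u ψ x = 0 := by
  induction u generalizing x with
  | nil => exact absurd trivial h
  | cons j u ih =>
    simp only [opW, opA]
    split_ifs with hj
    · rw [ih, mul_zero]
      intro h'
      rw [B.lab_step j x hj] at h'
      exact h ⟨hj, h'⟩
    · rfl

theorem opW_nonneg {ψ : B.X → ℝ} (h : ∀ x, 0 ≤ ψ x) (u : List B.A) (x : B.X) :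
    0 ≤ opW p u ψ x := by
  induction u generalizing x with
  | nil => exact h x
  | cons j u ih => exact opA_nonneg hp.nonneg ih x

theorem opW_le_iterate {ψ : B.X → ℝ} (h : ∀ x, 0 ≤ ψ x) (u : List B.A) (x : B.X) :
    opW p u ψ x ≤ (opL p)^[u.length] ψ x := by
  induction u generalizing x with
  | nil => exact le_rfl
  | cons j u ih =>
    rw [List.length_cons, Function.iterate_succ_apply']
    exact (opA_mono hp.nonneg ih x).trans
      (opA_le_opL hp.nonneg (hp.iterate_nonneg h _) j x)

theorem wt_mul_le_iterate {ψ : B.X → ℝ} (h : ∀ x, 0 ≤ ψ x) {u : List B.A} {x : B.X}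
    (hx : B.Adm (B.lab x) u) : wt p u x * ψ (B.act u x) ≤ (opL p)^[u.length] ψ x := by
  rw [← opW_of hx]; exact hp.opW_le_iterate h u x

theorem bd_opW {ψ : B.X → ℝ} (h : Bd ψ) (u : List B.A) : Bd (opW p u ψ) := by
  obtain ⟨M, hM⟩ := h
  refine ⟨M, fun x => ?_⟩
  by_cases hx : B.Adm (B.lab x) u
  · have h1 := (hp.wt_mul_le_iterate (fun _ => zero_le_one) hx (ψ := fun _ => 1)).trans
      (le_trans (le_abs_self _) (hp.abs_iterate_le (M := 1) (fun x => by simp) _ x))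
    rw [mul_one] at h1
    rw [opW_of hx, abs_mul, abs_of_pos (hp.wt_pos u x hx)]
    nlinarith [hM (B.act u x), abs_nonneg (ψ (B.act u x)), hp.wt_pos u x hx]
  · rw [opW_of_not hx, abs_zero]
    exact (abs_nonneg _).trans (hM x)

theorem wt_lip (u : List B.A) : ∀ x y : B.X, B.lab x = B.lab y → B.Adm (B.lab x) u →
    wt p u x ≤ Real.exp (K * B.C / (1 - B.th) * B.dst x y) * wt p u y := by
  have h1 : 0 < 1 - B.th := sub_pos.2 B.th_lt
  have hK : 0 ≤ K * B.C / (1 - B.th) := div_nonneg (mul_nonneg hp.K_nonneg C_pos.le) h1.le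
  have hKe : K * B.C / (1 - B.th) = K * B.C + K * B.C / (1 - B.th) * B.th := by
    field_simp; ring
  induction u with
  | nil =>
    intro x y _ _
    simpa [wt] using mul_nonneg hK (dst_nonneg x y)
  | cons j u ih =>
    intro x y hl h
    have hy : B.lab y ≠ B.bar j := hl ▸ h.1
    have h2 := hp.lip j x y hl h.1
    have h3 := ih _ _ (lab_step_eq h.1 hy) h.step
    have h4 := mul_le_mul h2 h3 (hp.wt_pos u _ h.step).le
      (mul_nonneg (Real.exp_pos _).le (hp.nonneg j y hy))
    simp only [wt]
    have h5 := mul_le_mul_of_nonneg_left (abs_le_dst x y) hp.K_nonneg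
    have h6 := mul_le_mul_of_nonneg_left (dst_step h.1 hy) hK
    have h7 : Real.exp (K * |B.pos x - B.pos y|) *
        Real.exp (K * B.C / (1 - B.th) * B.dst (B.step j x) (B.step j y)) ≤
        Real.exp (K * B.C / (1 - B.th) * B.dst x y) := by
      rw [← Real.exp_add, Real.exp_le_exp]
      have : K * B.C / (1 - B.th) * B.dst x y =
          K * B.C * B.dst x y + K * B.C / (1 - B.th) * (B.th * B.dst x y) := by
        conv_lhs => rw [hKe]
        ring
      linarith
    have hy' : B.Adm (B.lab (B.step j y)) u := by
      rw [← lab_step_eq h.1 hy]; exact h.step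
    have h8 := mul_le_mul_of_nonneg_right h7
      (mul_nonneg (hp.nonneg j y hy) (hp.wt_pos u _ hy').le)
    refine h4.trans (le_trans (le_of_eq ?_) h8)
    ring

/-- Distortion of the weights of a nonempty word, across labels. -/
theorem wt_dist {u : List B.A} (hu : u ≠ []) {x y : B.X} (hx : B.Adm (B.lab x) u)
    (hy : B.Adm (B.lab y) u) :
    c * Real.exp (-(K * B.C / (1 - B.th) * B.C ^ 2)) * wt p u x ≤ wt p u y := by
  have h1 : 0 < 1 - B.th := sub_pos.2 B.th_lt
  have hK : 0 ≤ K * B.C / (1 - B.th) := div_nonneg (mul_nonneg hp.K_nonneg C_pos.le) h1.le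
  cases u with
  | nil => exact absurd rfl hu
  | cons j u =>
    have h2 := hp.wt_lip u _ _ (lab_step_eq hx.1 hy.1) hx.step
    have h3 := mul_le_mul_of_nonneg_left (dst_le (B.step j x) (B.step j y)) hK
    have h4 : wt p u (B.step j x) ≤
        Real.exp (K * B.C / (1 - B.th) * B.C ^ 2) * wt p u (B.step j y) :=
      h2.trans (mul_le_mul_of_nonneg_right (Real.exp_le_exp.2 h3) (hp.wt_pos u _ hy.step).le)
    simp only [wt]
    have h5 : p j x * wt p u (B.step j x) ≤
        1 * (Real.exp (K * B.C / (1 - B.th) * B.C ^ 2) * wt p u (B.step j y)) :=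
      mul_le_mul (hp.le_one hx.1) h4 (hp.wt_pos u _ hx.step).le zero_le_one
    have h6 := mul_le_mul_of_nonneg_left h5
      (mul_nonneg hp.c_pos.le (Real.exp_pos (-(K * B.C / (1 - B.th) * B.C ^ 2))).le)
    refine h6.trans ?_
    have h7 : Real.exp (-(K * B.C / (1 - B.th) * B.C ^ 2)) *
        Real.exp (K * B.C / (1 - B.th) * B.C ^ 2) = 1 := by
      rw [← Real.exp_add, neg_add_cancel, Real.exp_zero]
    calc _ = c * (Real.exp (-(K * B.C / (1 - B.th) * B.C ^ 2)) *
        Real.exp (K * B.C / (1 - B.th) * B.C ^ 2)) * wt p u (B.step j y) := by ring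
      _ = c * wt p u (B.step j y) := by rw [h7, mul_one]
      _ ≤ _ := mul_le_mul_of_nonneg_right (hp.lb j y hy.1) (hp.wt_pos u _ hy.step).le

end IsWeight

/-- Positive functionals, compatible with the decomposition of a point into its preimages. -/
structure IsFunctional (p : B.A → B.X → ℝ) (r : ℝ) (D : ℕ) (N : ℕ → (B.X → ℝ) → ℝ) : Prop where
  add : ∀ k φ ψ, Bd φ → Bd ψ → N k (fun x => φ x + ψ x) = N k φ + N k ψ
  smul : ∀ k a φ, N k (fun x => a * φ x) = a * N k φ
  mono : ∀ k φ ψ, Bd φ → Bd ψ → (∀ x, φ x ≤ ψ x) → N k φ ≤ N k ψ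
  step : ∀ k φ, k < D → N k φ = N (k + 1) (opL p φ)
  shift : ∀ φ, Bd φ → (∀ x, 0 ≤ φ x) → N 0 (opL p φ) ≤ r⁻¹ * N 0 φ

theorem iterate_smul (p : B.A → B.X → ℝ) (a : ℝ) (φ : B.X → ℝ) (n : ℕ) :
    (opL p)^[n] (fun x => a * φ x) = fun x => a * (opL p)^[n] φ x := by
  induction n generalizing φ with
  | zero => rfl
  | succ n ih =>
    simp only [Function.iterate_succ_apply]
    rw [← ih]; congr 1; funext x; exact opL_smul p a φ x

theorem iterate_add (p : B.A → B.X → ℝ) (φ ψ : B.X → ℝ) (n : ℕ) :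
    (opL p)^[n] (fun x => φ x + ψ x) = fun x => (opL p)^[n] φ x + (opL p)^[n] ψ x := by
  induction n generalizing φ ψ with
  | zero => rfl
  | succ n ih =>
    simp only [Function.iterate_succ_apply]
    rw [← ih]; congr 1; funext x; exact opL_add p φ ψ x

theorem IsWeight.exists_functional {p : B.A → B.X → ℝ} {c K : ℝ} (hp : IsWeight p c K) {r : ℝ}
    (hr0 : 0 < r) (hr1 : r < 1) (D : ℕ) (x₀ : B.X) :
    ∃ N : ℕ → (B.X → ℝ) → ℝ, IsFunctional p r D N ∧
      ∀ φ, Bd φ → (∀ x, 0 ≤ φ x) → (opL p)^[D] φ x₀ ≤ N 0 φ := by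
  have hs : ∀ k φ, Bd φ → Summable fun m : ℕ => r ^ m * (opL p)^[m + (D - k)] φ x₀ := by
    rintro k φ ⟨M, hM⟩
    refine Summable.of_norm_bounded ((summable_geometric_of_lt_one hr0.le hr1).mul_right M) ?_
    intro m
    rw [Real.norm_eq_abs, abs_mul, abs_of_nonneg (pow_nonneg hr0.le m)]
    exact mul_le_mul_of_nonneg_left (hp.abs_iterate_le hM _ _) (pow_nonneg hr0.le m)
  refine ⟨fun k φ => ∑' m : ℕ, r ^ m * (opL p)^[m + (D - k)] φ x₀, ⟨?_, ?_, ?_, ?_, ?_⟩, ?_⟩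
  · intro k φ ψ hφ hψ
    rw [← (hs k φ hφ).tsum_add (hs k ψ hψ)]
    simp only [iterate_add, mul_add]
  · intro k a φ
    rw [← tsum_mul_left]
    simp only [iterate_smul]
    congr 1; funext m; ring
  · intro k φ ψ hφ hψ h
    exact (hs k φ hφ).tsum_le_tsum (fun m => mul_le_mul_of_nonneg_left
      (hp.iterate_mono h _ _) (pow_nonneg hr0.le m)) (hs k ψ hψ)
  · intro k φ hk
    congr 1; funext m
    rw [← Function.iterate_succ_apply, show m + (D - k) = (m + (D - (k + 1))).succ by omega]
  · intro φ hφ h0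
    have e := (hs 0 φ hφ).tsum_eq_zero_add
    have h1 : ∀ m : ℕ, r ^ (m + 1) * (opL p)^[m + 1 + (D - 0)] φ x₀ =
        r * (r ^ m * (opL p)^[m + (D - 0)] (opL p φ) x₀) := by
      intro m
      rw [← Function.iterate_succ_apply, pow_succ,
        show m + 1 + (D - 0) = (m + (D - 0)).succ by omega]
      ring
    simp only [h1] at e
    rw [tsum_mul_left] at e
    rw [e]
    have h2 : 0 ≤ r ^ 0 * (opL p)^[0 + (D - 0)] φ x₀ := by
      simpa using hp.iterate_nonneg h0 D x₀
    rw [mul_add, inv_mul_cancel_left₀ hr0.ne']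
    have := mul_nonneg (inv_nonneg.2 hr0.le) h2
    linarith
  · intro φ hφ h0
    have := (hs 0 φ hφ).le_tsum 0 (fun m _ => mul_nonneg (pow_nonneg hr0.le m)
      (hp.iterate_nonneg h0 _ _))
    simpa using this

end BranchSystem

namespace BranchSystem

variable {B : BranchSystem} {V : Type*} [NormedAddCommGroup V] [InnerProductSpace ℂ V]

/-- The unit complex number `exp (i a)`. -/
noncomputable def cis (a : ℝ) : ℂ := Complex.exp ((a : ℂ) * Complex.I)

theorem norm_cis (a : ℝ) : ‖cis a‖ = 1 := Complex.norm_exp_ofReal_mul_I a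

theorem cis_add (a b : ℝ) : cis (a + b) = cis a * cis b := by
  unfold cis; rw [← Complex.exp_add]; push_cast; ring_nf

theorem cis_zero : cis 0 = 1 := by simp [cis]

theorem norm_cis_sub_le (a b : ℝ) : ‖cis a - cis b‖ ≤ |a - b| := by
  have h1 : cis a - cis b = cis b * (cis (a - b) - 1) := by
    rw [mul_sub, ← cis_add, mul_one]; congr 2; ring
  rw [h1, norm_mul, norm_cis, one_mul]
  have := Real.norm_exp_I_mul_ofReal_sub_one_le (x := a - b)
  rw [mul_comm] at this
  exact this

theorem norm_cis_sub_ge (a b : ℝ) (h : |a - b| ≤ 1) : |a - b| / 2 ≤ ‖cis a - cis b‖ := by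
  have h1 : cis a - cis b = cis b * (cis (a - b) - 1) := by
    rw [mul_sub, ← cis_add, mul_one]; congr 2; ring
  rw [h1, norm_mul, norm_cis, one_mul]
  set x := a - b
  have h2 : |x| / 2 ≤ |Real.sin x| := by
    rcases le_total 0 x with h0 | h0
    · rw [abs_of_nonneg h0] at *
      have := Real.mul_le_sin h0 (by linarith [Real.pi_gt_three])
      have h4 : 1 / 2 ≤ 2 / Real.pi := by
        rw [div_le_div_iff₀ two_pos Real.pi_pos]; linarith [Real.pi_lt_four]
      rw [abs_of_nonneg (this.trans' (by positivity))]
      nlinarith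
    · rw [abs_of_nonpos h0] at *
      have := Real.mul_le_sin (x := -x) (by linarith) (by linarith [Real.pi_gt_three])
      have h4 : 1 / 2 ≤ 2 / Real.pi := by
        rw [div_le_div_iff₀ two_pos Real.pi_pos]; linarith [Real.pi_lt_four]
      rw [Real.sin_neg] at this
      have h5 : 1 / 2 * (-x) ≤ 2 / Real.pi * (-x) := mul_le_mul_of_nonneg_right h4 (by linarith)
      rw [← abs_neg]
      exact le_trans (by linarith) (le_abs_self _)
  refine h2.trans ?_
  have h3 := Complex.abs_im_le_norm (cis x - 1)
  have h4 : (cis x - 1).im = Real.sin x := by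
    simp [cis, Complex.exp_ofReal_mul_I_im]
  rwa [h4] at h3

/-- The composition of the unitaries along a word. -/
noncomputable def wrot (R : B.A → V ≃ₗᵢ[ℂ] V) : List B.A → V → V
  | [], v => v
  | j :: u, v => R j (wrot R u v)

theorem norm_wrot_sub (R : B.A → V ≃ₗᵢ[ℂ] V) (u : List B.A) (v w : V) :
    ‖wrot R u v - wrot R u w‖ = ‖v - w‖ := by
  induction u with
  | nil => rfl
  | cons j u ih => simp only [wrot]; rw [← map_sub, LinearIsometryEquiv.norm_map, ih]

/-- One branch of a twisted transfer operator. -/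
noncomputable def br (t : ℝ) (R : B.A → V ≃ₗᵢ[ℂ] V) (f : B.X → V) (j : B.A) (x : B.X) : V :=
  cis (t * Real.log (B.d j x)) • R j (f (B.step j x))

theorem norm_br (t : ℝ) (R : B.A → V ≃ₗᵢ[ℂ] V) (f : B.X → V) (j : B.A) (x : B.X) :
    ‖br t R f j x‖ = ‖f (B.step j x)‖ := by
  unfold br; rw [norm_smul, norm_cis, one_mul, LinearIsometryEquiv.norm_map]

/-- Eigenfunctions, with eigenvalue `Λ⁻¹`, of a twisted transfer operator with weights `p`. -/
def IsTwisted (p : B.A → B.X → ℝ) (Λ t : ℝ) (R : B.A → V ≃ₗᵢ[ℂ] V) (f : B.X → V) : Prop :=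
  ∀ x, ((Λ⁻¹ : ℝ) : ℂ) • f x =
    ∑ j, if B.lab x ≠ B.bar j then ((p j x : ℝ) : ℂ) • br t R f j x else 0

/-- The defect of equality in the triangle inequality. -/
noncomputable def defect (p : B.A → B.X → ℝ) (Λ : ℝ) (f : B.X → V) (x : B.X) : ℝ :=
  opL p (fun y => ‖f y‖ ^ 2) x - Λ⁻¹ ^ 2 * ‖f x‖ ^ 2

/-- The accumulated defect. -/
noncomputable def accum (p : B.A → B.X → ℝ) (e : B.X → ℝ) : ℕ → B.X → ℝ
  | 0, _ => 0
  | n + 1, x => e x + opL p (accum p e n) x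

/-- The local Lipschitz constant at scale `ρ`. -/
noncomputable def lipAt (ρ : ℝ) (f : B.X → V) (x : B.X) : ℝ :=
  sInf {K | 0 ≤ K ∧ ∀ y, B.lab x = B.lab y → B.dst x y ≤ ρ → ‖f x - f y‖ ≤ K * B.dst x y}

omit [InnerProductSpace ℂ V] in
theorem lipAt_nonneg (ρ : ℝ) (f : B.X → V) (x : B.X) : 0 ≤ lipAt ρ f x :=
  Real.sInf_nonneg fun _ h => h.1

omit [InnerProductSpace ℂ V] in
theorem lipAt_le {ρ : ℝ} {f : B.X → V} {x : B.X} {K : ℝ} (hK : 0 ≤ K)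
    (h : ∀ y, B.lab x = B.lab y → B.dst x y ≤ ρ → ‖f x - f y‖ ≤ K * B.dst x y) :
    lipAt ρ f x ≤ K :=
  csInf_le ⟨0, fun _ h => h.1⟩ ⟨hK, h⟩

omit [InnerProductSpace ℂ V] in
theorem lipAt_spec {ρ M : ℝ} {f : B.X → V} (hM : 0 ≤ M)
    (hf : ∀ x y, B.lab x = B.lab y → ‖f x - f y‖ ≤ M * B.dst x y) {x y : B.X}
    (hl : B.lab x = B.lab y) (h : B.dst x y ≤ ρ) :
    ‖f x - f y‖ ≤ lipAt ρ f x * B.dst x y := by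
  rcases (dst_nonneg x y).eq_or_lt with h0 | h0
  · have := hf x y hl
    rw [← h0, mul_zero] at *
    exact this
  · rw [← div_le_iff₀ h0]
    refine le_csInf ⟨M, hM, fun y hy _ => hf x y hy⟩ ?_
    rintro K ⟨-, hK⟩
    rw [div_le_iff₀ h0]
    exact hK y hl h

namespace IsWeight

variable {p : B.A → B.X → ℝ} {c K : ℝ} (hp : IsWeight p c K) {Λ t : ℝ}
  {R : B.A → V ≃ₗᵢ[ℂ] V} {f : B.X → V}
include hp

theorem norm_le_opL (hΛ : 0 < Λ) (hf : IsTwisted p Λ t R f) (x : B.X) :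
    Λ⁻¹ * ‖f x‖ ≤ opL p (fun y => ‖f y‖) x := by
  have h1 := congrArg norm (hf x)
  rw [norm_smul, Complex.norm_real, Real.norm_of_nonneg (inv_nonneg.2 hΛ.le)] at h1
  rw [h1]
  refine (norm_sum_le _ _).trans (Finset.sum_le_sum fun j _ => ?_)
  unfold opA
  split_ifs with hj
  · rw [norm_smul, norm_br, Complex.norm_real, Real.norm_of_nonneg (hp.nonneg j x hj)]
  · simp

theorem sq_le_opL (hΛ : 0 < Λ) (hf : IsTwisted p Λ t R f) (x : B.X) :
    Λ⁻¹ ^ 2 * ‖f x‖ ^ 2 ≤ opL p (fun y => ‖f y‖ ^ 2) x := by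
  rw [← mul_pow]
  exact (pow_le_pow_left₀ (by positivity) (hp.norm_le_opL hΛ hf x) 2).trans (hp.opL_sq_le _ x)

theorem defect_nonneg (hΛ : 0 < Λ) (hf : IsTwisted p Λ t R f) (x : B.X) :
    0 ≤ defect p Λ f x := sub_nonneg.2 (hp.sq_le_opL hΛ hf x)

/-- Each branch is almost aligned with the mean, up to the defect. -/
theorem align (hΛ : 0 < Λ) (hf : IsTwisted p Λ t R f) {j : B.A} {x : B.X}
    (hj : B.lab x ≠ B.bar j) :
    p j x * ‖((Λ⁻¹ : ℝ) : ℂ) • f x - br t R f j x‖ ^ 2 ≤ defect p Λ f x := by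
  have hm := hf x
  have hn : ‖((Λ⁻¹ : ℝ) : ℂ) • f x‖ = Λ⁻¹ * ‖f x‖ := by
    rw [norm_smul, Complex.norm_real, Real.norm_of_nonneg (inv_nonneg.2 hΛ.le)]
  set m := ((Λ⁻¹ : ℝ) : ℂ) • f x with hmdef
  set W : B.A → ℝ := fun i => if B.lab x ≠ B.bar i then p i x else 0 with hW
  have hW0 : ∀ i, 0 ≤ W i := by
    intro i; simp only [hW]; split_ifs with h
    · exact hp.nonneg i x h
    · exact le_rfl
  have hm2 : m = ∑ i, ((W i : ℝ) : ℂ) • br t R f i x := by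
    rw [hm]; refine Finset.sum_congr rfl fun i _ => ?_
    simp only [hW]; split_ifs <;> simp
  have hs1 : ∑ i, W i ≤ 1 := by
    refine le_trans (le_of_eq ?_) (hp.sub x)
    refine Finset.sum_congr rfl fun i _ => ?_
    simp only [hW, opA]; split_ifs <;> simp
  have hs2 : opL p (fun y => ‖f y‖ ^ 2) x = ∑ i, W i * ‖br t R f i x‖ ^ 2 := by
    refine Finset.sum_congr rfl fun i _ => ?_
    simp only [hW, opA, norm_br]; split_ifs <;> simp
  have h1 : ∑ i, W i * ‖m - br t R f i x‖ ^ 2 =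
      ‖m‖ ^ 2 * ∑ i, W i - 2 * ‖m‖ ^ 2 + ∑ i, W i * ‖br t R f i x‖ ^ 2 := by
    have e1 : ∀ i, W i * ‖m - br t R f i x‖ ^ 2 = ‖m‖ ^ 2 * W i -
        2 * (W i * RCLike.re (inner ℂ m (br t R f i x))) + W i * ‖br t R f i x‖ ^ 2 := by
      intro i; rw [@norm_sub_sq ℂ]; ring
    have e2 : ∑ i, W i * RCLike.re (inner ℂ m (br t R f i x)) = ‖m‖ ^ 2 := by
      rw [← @inner_self_eq_norm_sq ℂ]
      conv_rhs => rw [hm2, inner_sum, map_sum, ← hm2]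
      refine Finset.sum_congr rfl fun i _ => ?_
      rw [inner_smul_right]
      simp
    simp only [e1]
    rw [Finset.sum_add_distrib, Finset.sum_sub_distrib, ← Finset.mul_sum, ← Finset.mul_sum, e2]
  have h2 : W j * ‖m - br t R f j x‖ ^ 2 ≤ ∑ i, W i * ‖m - br t R f i x‖ ^ 2 :=
    Finset.single_le_sum (f := fun i => W i * ‖m - br t R f i x‖ ^ 2)
      (fun i _ => mul_nonneg (hW0 i) (sq_nonneg _)) (Finset.mem_univ j)
  have h3 : W j = p j x := if_pos hj
  rw [h3] at h2
  unfold defect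
  rw [hs2, ← mul_pow, ← hn]
  nlinarith [sq_nonneg ‖m‖]

theorem accum_nonneg {e : B.X → ℝ} (he : ∀ x, 0 ≤ e x) (n : ℕ) (x : B.X) :
    0 ≤ accum p e n x := by
  induction n generalizing x with
  | zero => exact le_rfl
  | succ n ih => exact add_nonneg (he x) (opL_nonneg hp.nonneg ih x)

theorem bd_accum {e : B.X → ℝ} (he : Bd e) (n : ℕ) : Bd (accum p e n) := by
  induction n with
  | zero => exact Bd.const 0
  | succ n ih => exact he.add (hp.bd_opL ih)

/-- Alignment along a word. -/
theorem align_word (hΛ : 1 ≤ Λ) (hf : IsTwisted p Λ t R f) (w : List B.A) :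
    ∀ x, B.Adm (B.lab x) w →
    ‖((Λ⁻¹ ^ w.length : ℝ) : ℂ) • f x - cis (t * B.tau w x) • wrot R w (f (B.act w x))‖ ≤
      w.length * √(c⁻¹ ^ w.length * accum p (defect p Λ f) w.length x) := by
  have hΛ0 : 0 < Λ := by linarith
  have hc := hp.c_pos
  have hd := hp.defect_nonneg hΛ0 hf
  induction w with
  | nil => intro x _; simp [tau, act, wrot, cis_zero]
  | cons j u ih =>
    intro x h
    have hc1 : 1 ≤ c⁻¹ := (one_le_inv₀ hc).2 (hp.c_le_one x)
    set n := u.length with hn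
    have hxj := ih _ h.step
    set y := B.step j x with hy
    have e1 : cis (t * B.tau (j :: u) x) • wrot R (j :: u) (f (B.act (j :: u) x)) =
        cis (t * Real.log (B.d j x)) • R j (cis (t * B.tau u y) • wrot R u (f (B.act u y))) := by
      simp only [tau, act, wrot]
      rw [map_smul, smul_smul, ← cis_add, mul_add]
    have e2 : ((Λ⁻¹ ^ (j :: u).length : ℝ) : ℂ) • f x -
        cis (t * B.tau (j :: u) x) • wrot R (j :: u) (f (B.act (j :: u) x)) =
        ((Λ⁻¹ ^ n : ℝ) : ℂ) • (((Λ⁻¹ : ℝ) : ℂ) • f x - br t R f j x) +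
        cis (t * Real.log (B.d j x)) • R j (((Λ⁻¹ ^ n : ℝ) : ℂ) • f y -
          cis (t * B.tau u y) • wrot R u (f (B.act u y))) := by
      rw [e1, List.length_cons, ← hn, pow_succ]
      unfold br
      rw [← hy]
      simp only [map_sub, map_smul, smul_sub, Complex.ofReal_mul]
      module
    set S := √(c⁻¹ ^ (n + 1) * accum p (defect p Λ f) (n + 1) x) with hS
    have hp0 := hp.pos h.1
    have hacc : ∀ k z, 0 ≤ accum p (defect p Λ f) k z := hp.accum_nonneg hd
    have hLn := opL_nonneg hp.nonneg (hacc n) x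
    have b1 : ‖((Λ⁻¹ : ℝ) : ℂ) • f x - br t R f j x‖ ≤ S := by
      apply Real.le_sqrt_of_sq_le
      have a1 := hp.align hΛ0 hf h.1
      have a2 := (mul_le_mul_of_nonneg_right (hp.lb j x h.1)
        (sq_nonneg ‖((Λ⁻¹ : ℝ) : ℂ) • f x - br t R f j x‖)).trans a1
      have a3 : defect p Λ f x ≤ accum p (defect p Λ f) (n + 1) x := by
        simp only [accum]; linarith
      have a4 : ‖((Λ⁻¹ : ℝ) : ℂ) • f x - br t R f j x‖ ^ 2 ≤
          c⁻¹ * accum p (defect p Λ f) (n + 1) x := by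
        rw [inv_mul_eq_div, le_div_iff₀ hc, mul_comm]; exact a2.trans a3
      refine a4.trans (mul_le_mul_of_nonneg_right ?_ (hacc _ _))
      exact le_self_pow₀ hc1 (Nat.succ_ne_zero n)
    have b2 : √(c⁻¹ ^ n * accum p (defect p Λ f) n y) ≤ S := by
      apply Real.sqrt_le_sqrt
      rw [pow_succ, mul_assoc]
      refine mul_le_mul_of_nonneg_left ?_ (by positivity)
      have a1 := (mul_le_mul_of_nonneg_right (hp.lb j x h.1) (hacc n y)).trans
        (le_opL hp.nonneg (hacc n) h.1)
      rw [inv_mul_eq_div, le_div_iff₀ hc, mul_comm]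
      simp only [accum]
      linarith [hd x]
    have b3 : ‖((Λ⁻¹ ^ n : ℝ) : ℂ)‖ ≤ 1 := by
      rw [Complex.norm_real, Real.norm_of_nonneg (by positivity)]
      exact pow_le_one₀ (by positivity) (inv_le_one_of_one_le₀ hΛ)
    rw [e2]
    refine (norm_add_le _ _).trans ?_
    rw [norm_smul, norm_smul, norm_cis, one_mul, LinearIsometryEquiv.norm_map]
    have b4 := mul_le_mul b3 b1 (norm_nonneg _) zero_le_one
    have b5 := hxj.trans (mul_le_mul_of_nonneg_left b2 (Nat.cast_nonneg n))
    rw [List.length_cons, ← hn, Nat.cast_add_one]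
    linarith

/-- The Lasota–Yorke inequality for local Lipschitz constants. -/
theorem lipAt_step (hΛ : 0 < Λ) (hf : IsTwisted p Λ t R f) {ρ M q : ℝ} (hM : 0 ≤ M)
    (hfM : ∀ x y, B.lab x = B.lab y → ‖f x - f y‖ ≤ M * B.dst x y) (hρ : 0 ≤ ρ)
    (hq : Real.exp (K * B.C * ρ) ≤ q) (x : B.X) :
    lipAt ρ f x ≤ Λ * (q * (K * B.C + |t| * B.C ^ 2)) * opL p (fun y => ‖f y‖) x +
      Λ * (q * B.th) * opL p (lipAt ρ f) x := by
  have hK := hp.K_nonneg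
  have hC := C_pos (B := B)
  have hth := B.th_pos
  have hq0 : 0 < q := (Real.exp_pos _).trans_le hq
  have hL1 := opL_nonneg hp.nonneg (φ := fun y => ‖f y‖) (fun _ => norm_nonneg _) x
  have hL2 := opL_nonneg hp.nonneg (lipAt_nonneg ρ f) x
  refine lipAt_le (by positivity) fun y hl hy => ?_
  set δ := B.dst x y with hδ
  have hδ0 : 0 ≤ δ := dst_nonneg x y
  set z := K * |B.pos x - B.pos y| with hz
  have hzδ : z ≤ K * B.C * δ := by
    rw [mul_assoc]; exact mul_le_mul_of_nonneg_left (abs_le_dst x y) hK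
  have hz0 : 0 ≤ z := mul_nonneg hK (abs_nonneg _)
  have hzq : Real.exp z ≤ q := (Real.exp_le_exp.2 (hzδ.trans
    (mul_le_mul_of_nonneg_left hy (by positivity)))).trans hq
  have hz1 : Real.exp z - 1 ≤ q * (K * B.C * δ) := by
    have a1 : 1 - z ≤ Real.exp (-z) := by linarith [Real.add_one_le_exp (-z)]
    have a2 : Real.exp z * Real.exp (-z) = 1 := by rw [← Real.exp_add, add_neg_cancel, Real.exp_zero]
    have a3 : Real.exp z - 1 ≤ Real.exp z * z := by nlinarith [Real.exp_pos z]
    exact a3.trans (mul_le_mul hzq hzδ hz0 hq0.le)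
  have hterm : ∀ j, B.lab x ≠ B.bar j →
      ‖((p j x : ℝ) : ℂ) • br t R f j x - ((p j y : ℝ) : ℂ) • br t R f j y‖ ≤
      p j x * (q * (K * B.C + |t| * B.C ^ 2) * ‖f (B.step j x)‖ +
        q * B.th * lipAt ρ f (B.step j x)) * δ := by
    intro j hj
    have hj' : B.lab y ≠ B.bar j := hl ▸ hj
    have hpx := hp.pos hj
    have c1 : p j y ≤ Real.exp z * p j x := by
      have := hp.lip j y x hl.symm hj'
      rwa [abs_sub_comm] at this
    have c2 : p j x ≤ Real.exp z * p j y := hp.lip j x y hl hj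
    have c3 : |p j x - p j y| ≤ q * (K * B.C * δ) * p j x := by
      have a2 : Real.exp z * Real.exp (-z) = 1 := by
        rw [← Real.exp_add, add_neg_cancel, Real.exp_zero]
      have a1 : 1 ≤ Real.exp z := Real.one_le_exp hz0
      have a4 := mul_le_mul_of_nonneg_right hz1 hpx.le
      have a5 := hp.pos hj'
      rw [abs_le]; constructor
      · nlinarith
      · rcases le_total (p j x) (p j y) with h | h
        · linarith [mul_nonneg (mul_nonneg hq0.le (mul_nonneg (mul_nonneg hK hC.le) hδ0)) hpx.le]
        · nlinarith [mul_le_mul_of_nonneg_left h (sub_nonneg.2 a1)]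
    have c4 : p j y ≤ q * p j x := c1.trans (mul_le_mul_of_nonneg_right hzq hpx.le)
    have d1 : B.dst (B.step j x) (B.step j y) ≤ B.th * δ := dst_step hj hj'
    have d2 : B.dst (B.step j x) (B.step j y) ≤ ρ :=
      d1.trans (by nlinarith [B.th_lt])
    have d3 := lipAt_spec hM hfM (lab_step_eq hj hj') d2
    have d4 := d3.trans (mul_le_mul_of_nonneg_left d1 (lipAt_nonneg ρ f _))
    have d5 : ‖br t R f j x - br t R f j y‖ ≤
        |t| * (B.C ^ 2 * δ) * ‖f (B.step j x)‖ + lipAt ρ f (B.step j x) * (B.th * δ) := by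
      have e1 : br t R f j x - br t R f j y =
          (cis (t * Real.log (B.d j x)) - cis (t * Real.log (B.d j y))) • R j (f (B.step j x)) +
          cis (t * Real.log (B.d j y)) • R j (f (B.step j x) - f (B.step j y)) := by
        unfold br; rw [map_sub, smul_sub, sub_smul]; abel
      rw [e1]
      refine (norm_add_le _ _).trans (add_le_add ?_ ?_)
      · rw [norm_smul, LinearIsometryEquiv.norm_map]
        refine mul_le_mul_of_nonneg_right ((norm_cis_sub_le _ _).trans ?_) (norm_nonneg _)
        rw [← mul_sub, abs_mul]
        exact mul_le_mul_of_nonneg_left (dlip_dst hl hj) (abs_nonneg t)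
      · rw [norm_smul, norm_cis, one_mul, LinearIsometryEquiv.norm_map]
        exact d4
    have e2 : ((p j x : ℝ) : ℂ) • br t R f j x - ((p j y : ℝ) : ℂ) • br t R f j y =
        ((p j x - p j y : ℝ) : ℂ) • br t R f j x +
        ((p j y : ℝ) : ℂ) • (br t R f j x - br t R f j y) := by
      rw [Complex.ofReal_sub, sub_smul, smul_sub]; abel
    rw [e2]
    refine (norm_add_le _ _).trans ?_
    rw [norm_smul, norm_smul, norm_br, Complex.norm_real, Complex.norm_real, Real.norm_eq_abs,
      Real.norm_of_nonneg (hp.nonneg j y hj')]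
    have f1 := mul_le_mul_of_nonneg_right c3 (norm_nonneg (f (B.step j x)))
    have f2 := mul_le_mul c4 d5 (norm_nonneg _) (mul_nonneg hq0.le hpx.le)
    linarith
  have hsum : ‖((Λ⁻¹ : ℝ) : ℂ) • (f x - f y)‖ ≤
      (q * (K * B.C + |t| * B.C ^ 2) * opL p (fun y => ‖f y‖) x +
        q * B.th * opL p (lipAt ρ f) x) * δ := by
    rw [smul_sub, hf x, hf y, ← Finset.sum_sub_distrib, ← opL_smul, ← opL_smul, ← opL_add]
    unfold opL
    rw [Finset.sum_mul]
    refine (norm_sum_le _ _).trans (Finset.sum_le_sum fun j _ => ?_)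
    rw [← hl]
    unfold opA
    split_ifs with hj
    · exact hterm j hj
    · simp
  rw [norm_smul, Complex.norm_real, Real.norm_of_nonneg (inv_nonneg.2 hΛ.le),
    inv_mul_eq_div, div_le_iff₀ hΛ] at hsum
  refine hsum.trans (le_of_eq ?_)
  ring

end IsWeight

end BranchSystem

namespace BranchSystem

variable {B : BranchSystem}

theorem Bd.finset_sum {ι : Type*} (s : Finset ι) {g : ι → B.X → ℝ} (h : ∀ i, Bd (g i)) :
    Bd (fun x => ∑ i ∈ s, g i x) := by
  classical
  induction s using Finset.induction_on with
  | empty => simpa using Bd.const 0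
  | insert i s hi ih => simp only [Finset.sum_insert hi]; exact (h i).add ih

namespace IsFunctional

variable {p : B.A → B.X → ℝ} {c K r : ℝ} {D : ℕ} {N : ℕ → (B.X → ℝ) → ℝ}
  (hN : IsFunctional p r D N)
include hN

theorem zero (k : ℕ) : N k (fun _ => 0) = 0 := by
  have := hN.smul k 0 (fun _ => 0)
  simpa using this

theorem nonneg {φ : B.X → ℝ} (k : ℕ) (hφ : Bd φ) (h : ∀ x, 0 ≤ φ x) : 0 ≤ N k φ := by
  rw [← hN.zero k]; exact hN.mono k _ _ (Bd.const 0) hφ h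

theorem finset_sum {ι : Type*} (k : ℕ) (s : Finset ι) {g : ι → B.X → ℝ} (h : ∀ i, Bd (g i)) :
    N k (fun x => ∑ i ∈ s, g i x) = ∑ i ∈ s, N k (g i) := by
  classical
  induction s using Finset.induction_on with
  | empty => simpa using hN.zero k
  | insert i s hi ih =>
    simp only [Finset.sum_insert hi]
    rw [hN.add k _ _ (h i) (Bd.finset_sum s h), ih]

theorem split (hp : IsWeight p c K) {k : ℕ} (hk : k < D) {φ : B.X → ℝ} (hφ : Bd φ) :
    N k φ = ∑ j, N (k + 1) (opA p j φ) := by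
  rw [hN.step k φ hk]
  exact hN.finset_sum (k + 1) Finset.univ fun j => hp.bd_opW hφ [j]

theorem iterate_le (hp : IsWeight p c K) (hr : 0 < r) {φ : B.X → ℝ} (hφ : Bd φ)
    (h : ∀ x, 0 ≤ φ x) (n : ℕ) : N 0 ((opL p)^[n] φ) ≤ r⁻¹ ^ n * N 0 φ := by
  induction n with
  | zero => simp
  | succ n ih =>
    rw [Function.iterate_succ_apply', pow_succ', mul_assoc]
    exact (hN.shift _ (hp.bd_iterate hφ n) (hp.iterate_nonneg h n)).trans
      (mul_le_mul_of_nonneg_left ih (inv_nonneg.2 hr.le))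

theorem accum_le (hp : IsWeight p c K) (hr : 0 < r) (hr1 : r ≤ 1) {e : B.X → ℝ} (he : Bd e)
    (h : ∀ x, 0 ≤ e x) (n : ℕ) : N 0 (accum p e n) ≤ n * r⁻¹ ^ n * N 0 e := by
  have h1 : 1 ≤ r⁻¹ := (one_le_inv₀ hr).2 hr1
  have h0 : 0 ≤ N 0 e := hN.nonneg 0 he h
  induction n with
  | zero => have := hN.zero 0; simp only [accum]; simp [this]
  | succ n ih =>
    have e1 : accum p e (n + 1) = fun x => e x + opL p (accum p e n) x := rfl
    rw [e1, hN.add 0 _ _ he (hp.bd_opL (hp.bd_accum he n))]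
    have h2 := (hN.shift _ (hp.bd_accum he n) (hp.accum_nonneg h n)).trans
      (mul_le_mul_of_nonneg_left ih (inv_nonneg.2 hr.le))
    have h3 : N 0 e ≤ r⁻¹ ^ (n + 1) * N 0 e := le_mul_of_one_le_left h0 (one_le_pow₀ h1)
    rw [Nat.cast_add_one, pow_succ] at *
    linarith

theorem label_le (hp : IsWeight p c K) {k : ℕ} (hk : k + 2 ≤ D) (b : B.A) :
    c ^ 2 * N k (fun _ => 1) ≤ N k (fun x => if B.lab x = b then 1 else 0) := by
  set g : B.X → ℝ := fun x => if B.lab x = b then 1 else 0 with hg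
  have hg0 : ∀ x, 0 ≤ g x := fun x => by simp only [hg]; split_ifs <;> norm_num
  have hg1 : ∀ x, g x ≤ 1 := fun x => by simp only [hg]; split_ifs <;> norm_num
  have hgB : Bd g := (Bd.const 1).of_le hg0 hg1
  have h1 : ∀ φ : B.X → ℝ, N k φ = N (k + 2) (opL p (opL p φ)) := fun φ => by
    rw [hN.step k φ (by omega), hN.step (k + 1) _ (by omega)]
  rw [h1, h1 g, ← hN.smul]
  refine hN.mono _ _ _ ((hp.bd_opL (hp.bd_opL (Bd.const 1))).smul _)
    (hp.bd_opL (hp.bd_opL hgB)) fun x => ?_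
  have h2 : opL p (opL p fun _ => 1) x ≤ 1 := hp.opL_le zero_le_one (fun y => hp.sub y) x
  obtain ⟨l, hl1, hl2⟩ := B.mix (B.lab x) b
  have hl3 : B.lab (B.step l x) ≠ B.bar b := by rwa [B.lab_step l x hl1]
  have h3 := le_opL hp.nonneg hg0 hl3
  have h4 : g (B.step b (B.step l x)) = 1 := if_pos (B.lab_step b _ hl3)
  rw [h4, mul_one] at h3
  have h5 := le_opL hp.nonneg (opL_nonneg hp.nonneg hg0) hl1
  have hc := hp.c_pos
  have h6 : c * c ≤ opL p (opL p g) x :=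
    (mul_le_mul (hp.lb l x hl1) ((hp.lb b _ hl3).trans h3) hc.le (hp.nonneg l x hl1)).trans h5
  nlinarith

/-- Descent to a cylinder of prescribed scale on which one functional dominates another. -/
theorem descent (hp : IsWeight p c K) {φ ψ : B.X → ℝ} (hφ : Bd φ) (hψ : Bd ψ)
    (hφ0 : ∀ x, 0 ≤ φ x) (hψ0 : ∀ x, 0 ≤ ψ x) (h0 : 0 < N 0 φ) (h1 : N 0 ψ ≤ N 0 φ)
    {s : ℝ} (hs : s < 1) {D₀ : ℕ} (hD : D₀ ≤ D) (hD₀ : B.C ^ 2 * B.th ^ D₀ ≤ s) (x₀ : B.X) :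
    ∃ j v, (v.length + 1 ≤ D₀) ∧
      0 < N (v.length + 1) (opW p (j :: v) φ) ∧
      N (v.length + 1) (opW p (j :: v) ψ) ≤ N (v.length + 1) (opW p (j :: v) φ) ∧
      (∀ y, B.Adm (B.lab y) (j :: v) → Real.exp (B.tau (j :: v) y) ≤ s) ∧
      ∃ y, B.Adm (B.lab y) v ∧ s < Real.exp (B.tau v y) := by
  by_contra hcon
  have key : ∀ k ≤ D₀, ∃ v : List B.A, v.length = k ∧ 0 < N k (opW p v φ) ∧
      N k (opW p v ψ) ≤ N k (opW p v φ) ∧ ∃ y, B.Adm (B.lab y) v ∧ s < Real.exp (B.tau v y) := by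
    intro k
    induction k with
    | zero =>
      intro _
      exact ⟨[], rfl, h0, h1, x₀, trivial, by simpa [tau] using hs⟩
    | succ k ih =>
      intro hk
      obtain ⟨v, hv, a1, a2, a3⟩ := ih (by omega)
      rw [hN.split hp (by omega) (hp.bd_opW hφ v)] at a1 a2
      rw [hN.split hp (by omega) (hp.bd_opW hψ v)] at a2
      have hnn : ∀ (χ : B.X → ℝ), Bd χ → (∀ x, 0 ≤ χ x) → ∀ j,
          0 ≤ N (k + 1) (opA p j (opW p v χ)) := fun χ hχ hχ0 j =>
        hN.nonneg _ (hp.bd_opW hχ (j :: v)) (hp.opW_nonneg hχ0 (j :: v))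
      obtain ⟨j, hj0, hj⟩ : ∃ j, 0 < N (k + 1) (opA p j (opW p v φ)) ∧
          N (k + 1) (opA p j (opW p v ψ)) ≤ N (k + 1) (opA p j (opW p v φ)) := by
        by_contra hno
        push Not at hno
        obtain ⟨i, hi, hi0⟩ : ∃ i ∈ Finset.univ, 0 < N (k + 1) (opA p i (opW p v φ)) := by
          by_contra hz
          push Not at hz
          exact absurd (Finset.sum_nonpos hz) (not_le.2 a1)
        refine absurd a2 (not_le.2 (Finset.sum_lt_sum (fun j _ => ?_) ⟨i, hi, hno i hi0⟩))
        rcases (hnn φ hφ hφ0 j).eq_or_lt with h | h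
        · rw [← h]; exact hnn ψ hψ hψ0 j
        · exact (hno j h).le
      refine ⟨j :: v, by simp [hv], hj0, hj, ?_⟩
      by_contra hsm
      push Not at hsm
      exact hcon ⟨j, v, by omega, by rw [hv]; exact hj0, by rw [hv]; exact hj, hsm, a3⟩
  obtain ⟨v, hv, -, -, y, hy, hy1⟩ := key D₀ le_rfl
  have := exp_tau_le hy
  rw [hv] at this
  linarith

end IsFunctional

theorem exp_tau_le_of_label (u : List B.A) {x y : B.X} (hx : B.Adm (B.lab x) u)
    (hy : B.Adm (B.lab y) u) :
    Real.exp (-(2 * Real.log B.C + B.Ktau * B.C ^ 2)) * Real.exp (B.tau u y) ≤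
      Real.exp (B.tau u x) := by
  rw [← Real.exp_add, Real.exp_le_exp]
  cases u with
  | nil =>
    have := Real.log_nonneg B.one_le_C
    have := mul_nonneg (Ktau_pos (B := B)).le (sq_nonneg B.C)
    simp only [tau]; linarith
  | cons j u =>
    have := (abs_le.1 (tau_dist (List.cons_ne_nil j u) hx hy)).1
    linarith

end BranchSystem

namespace BranchSystem

variable {B : BranchSystem} {V : Type*} [NormedAddCommGroup V] [InnerProductSpace ℂ V]

theorem IsWeight.lipAt_functional_le {p : B.A → B.X → ℝ} {c K : ℝ} (hp : IsWeight p c K)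
    {Λ t : ℝ} {R : B.A → V ≃ₗᵢ[ℂ] V} {f : B.X → V} (hΛ : 1 ≤ Λ) (hf : IsTwisted p Λ t R f)
    {ρ M q : ℝ} (hM : 0 ≤ M) (hfM : ∀ x y, B.lab x = B.lab y → ‖f x - f y‖ ≤ M * B.dst x y)
    (hfB : Bd fun x => ‖f x‖ ^ 2) (hρ : 0 ≤ ρ) (hq : Real.exp (K * B.C * ρ) ≤ q) (hΛq : Λ ≤ q)
    (hq2 : q ≤ 2) (ht : 1 ≤ |t|) {θ₁ θ₂ : ℝ} (h1 : q * q * B.th ≤ θ₁) (h2 : θ₁ * q ≤ θ₂)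
    (h3 : θ₂ < 1) (h4 : θ₁ < 1) {D : ℕ} {N : ℕ → (B.X → ℝ) → ℝ} (hN : IsFunctional p Λ⁻¹ D N) :
    N 0 (fun x => lipAt ρ f x ^ 2) ≤
      2 * (4 * (K * B.C + B.C ^ 2)) ^ 2 / ((1 - θ₁) * (1 - θ₂)) * t ^ 2 *
        N 0 (fun x => ‖f x‖ ^ 2) := by
  have hK := hp.K_nonneg
  have hC := C_pos (B := B)
  have hth := B.th_pos
  have hΛ0 : 0 < Λ := by linarith
  have hq0 : 0 < q := by linarith
  have hθ1 : 0 < θ₁ := lt_of_lt_of_le (by positivity) h1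
  set A := 4 * (K * B.C + B.C ^ 2) with hA
  have hA0 : 0 ≤ A := by positivity
  set G : B.X → ℝ := lipAt ρ f with hG
  have hG0 : ∀ x, 0 ≤ G x := lipAt_nonneg ρ f
  have hGM : ∀ x, G x ≤ M := fun x => lipAt_le hM fun y hy _ => hfM x y hy
  have hG2B : Bd fun x => G x ^ 2 :=
    (Bd.const (M ^ 2)).of_le (fun x => sq_nonneg _) fun x => pow_le_pow_left₀ (hG0 x) (hGM x) 2
  have ht2 : |t| ^ 2 = t ^ 2 := sq_abs t
  have hpt : ∀ x, G x ^ 2 ≤ (A ^ 2 * t ^ 2 / (1 - θ₁)) * opL p (fun y => ‖f y‖ ^ 2) x +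
      θ₁ * opL p (fun y => G y ^ 2) x := by
    intro x
    have e1 := hp.lipAt_step hΛ0 hf hM hfM hρ hq x
    have L1 := opL_nonneg hp.nonneg (φ := fun y => ‖f y‖) (fun _ => norm_nonneg _) x
    have L2 := opL_nonneg hp.nonneg hG0 x
    have e2 := hp.opL_sq_le (fun y => ‖f y‖) x
    have e3 := hp.opL_sq_le G x
    have e4 : Λ * (q * (K * B.C + |t| * B.C ^ 2)) ≤ A * |t| := by
      have a1 : Λ * q ≤ 4 := by nlinarith
      have a2 : K * B.C + |t| * B.C ^ 2 ≤ (K * B.C + B.C ^ 2) * |t| := by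
        nlinarith [mul_nonneg hK hC.le]
      calc _ = (Λ * q) * (K * B.C + |t| * B.C ^ 2) := by ring
        _ ≤ 4 * ((K * B.C + B.C ^ 2) * |t|) := mul_le_mul a1 a2 (by positivity) (by norm_num)
        _ = _ := by rw [hA]; ring
    have e5 : Λ * (q * B.th) ≤ θ₁ := by
      refine le_trans ?_ h1
      rw [← mul_assoc]
      exact mul_le_mul_of_nonneg_right (mul_le_mul_of_nonneg_right hΛq hq0.le) hth.le
    have e6 : G x ≤ A * |t| * opL p (fun y => ‖f y‖) x + θ₁ * opL p G x :=
      e1.trans (add_le_add (mul_le_mul_of_nonneg_right e4 L1) (mul_le_mul_of_nonneg_right e5 L2))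
    set a := A * |t| * opL p (fun y => ‖f y‖) x with ha
    set b := opL p G x with hb
    have e7 : G x ^ 2 ≤ (a + θ₁ * b) ^ 2 := pow_le_pow_left₀ (hG0 x) e6 2
    have e8 : (a + θ₁ * b) ^ 2 ≤ a ^ 2 / (1 - θ₁) + θ₁ * b ^ 2 := by
      have h5 : 0 < 1 - θ₁ := by linarith
      have h6 : a ^ 2 / (1 - θ₁) + θ₁ * b ^ 2 - (a + θ₁ * b) ^ 2 =
          θ₁ / (1 - θ₁) * (a - (1 - θ₁) * b) ^ 2 := by field_simp; ring
      have h7 : 0 ≤ θ₁ / (1 - θ₁) * (a - (1 - θ₁) * b) ^ 2 := by positivity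
      linarith
    have e9 : a ^ 2 / (1 - θ₁) ≤ A ^ 2 * t ^ 2 / (1 - θ₁) * opL p (fun y => ‖f y‖ ^ 2) x := by
      rw [ha, mul_pow, mul_pow, ht2, mul_div_right_comm]
      exact mul_le_mul_of_nonneg_left e2 (by
        have : 0 ≤ 1 - θ₁ := by linarith
        positivity)
    have e10 := mul_le_mul_of_nonneg_left e3 hθ1.le
    linarith
  have B1 := hp.bd_opL hfB
  have B2 := hp.bd_opL hG2B
  have n1 := hN.mono 0 _ _ hG2B ((B1.smul _).add (B2.smul _)) hpt
  rw [hN.add 0 _ _ (B1.smul _) (B2.smul _), hN.smul, hN.smul] at n1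
  have n2 := hN.shift _ hfB fun x => sq_nonneg _
  have n3 := hN.shift _ hG2B fun x => sq_nonneg _
  rw [inv_inv] at n2 n3
  have m1 := hN.nonneg 0 hfB fun x => sq_nonneg _
  have m2 := hN.nonneg 0 hG2B fun x => sq_nonneg _
  set X := N 0 fun x => G x ^ 2
  set Y := N 0 fun x => ‖f x‖ ^ 2
  have h5 : 0 < 1 - θ₁ := by linarith
  have h6 : 0 < 1 - θ₂ := by linarith
  have k1 : A ^ 2 * t ^ 2 / (1 - θ₁) * N 0 (opL p fun y => ‖f y‖ ^ 2) ≤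
      A ^ 2 * t ^ 2 / (1 - θ₁) * (2 * Y) :=
    mul_le_mul_of_nonneg_left (n2.trans (mul_le_mul_of_nonneg_right (hΛq.trans hq2) m1))
      (by positivity)
  have k2 : θ₁ * N 0 (opL p fun y => G y ^ 2) ≤ θ₂ * X := by
    refine (mul_le_mul_of_nonneg_left n3 hθ1.le).trans ?_
    rw [← mul_assoc]
    exact mul_le_mul_of_nonneg_right
      ((mul_le_mul_of_nonneg_left hΛq hθ1.le).trans h2) m2
  have k3 : X * (1 - θ₂) ≤ A ^ 2 * t ^ 2 / (1 - θ₁) * (2 * Y) := by linarith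
  rw [← le_div_iff₀ h6] at k3
  refine k3.trans (le_of_eq ?_)
  field_simp

/-- The values at nearby points differ by the phase of a word, up to small errors. -/
theorem IsWeight.word_close {p : B.A → B.X → ℝ} {c K : ℝ} (hp : IsWeight p c K)
    {Λ t : ℝ} {R : B.A → V ≃ₗᵢ[ℂ] V} {f : B.X → V} (hΛ : 1 ≤ Λ) (hf : IsTwisted p Λ t R f)
    {ρ M K₉ C₆ a η : ℝ} (hM : 0 ≤ M)
    (hfM : ∀ x y, B.lab x = B.lab y → ‖f x - f y‖ ≤ M * B.dst x y)
    {w : List B.A} {n : ℕ} (hw : w.length = n) (hΛn : Λ ^ n ≤ 2) (hK₉ : 0 < K₉) (hC₆ : 0 < C₆)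
    {x y : B.X} (hl : B.lab x = B.lab y) (hx : B.Adm (B.lab x) w) (ha : 0 ≤ a)
    (hwt : Real.exp (B.tau w x) ^ 2 ≤ K₉ * Λ ^ n * B.th ^ n * wt p w x)
    (hxy : B.dst x y ≤ ρ)
    (hEx : n * √(c⁻¹ ^ n * accum p (defect p Λ f) n x) ≤ η * a)
    (hEy : n * √(c⁻¹ ^ n * accum p (defect p Λ f) n y) ≤ η * a)
    (hGx : (opL p)^[n] (fun z => lipAt ρ f z ^ 2) x ≤ C₆ * t ^ 2 * a ^ 2) :
    ‖((Λ⁻¹ ^ n : ℝ) : ℂ) • f y -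
        cis (t * (B.tau w y - B.tau w x)) • (((Λ⁻¹ ^ n : ℝ) : ℂ) • f x)‖ ≤
      (2 * η + B.C ^ 2 * Real.exp (B.Ktau * B.C ^ 2) * √(2 * K₉ * C₆) *
        (ρ * |t|) * √(B.th ^ n)) * a := by
  have hC := C_pos (B := B)
  have hth := B.th_pos
  have hy : B.Adm (B.lab y) w := hl ▸ hx
  subst hw
  set n := w.length with hn
  have ax := (hp.align_word hΛ hf w x hx).trans hEx
  have ay := (hp.align_word hΛ hf w y hy).trans hEy
  set X := B.act w x with hX
  set Y := B.act w y with hY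
  set G := lipAt ρ f X with hG
  have hG0 : 0 ≤ G := lipAt_nonneg ρ f X
  have hρ : 0 ≤ ρ := (dst_nonneg x y).trans hxy
  have d1 : B.dst X Y ≤ ρ := by
    refine (dst_act w x y hl hx).trans (le_trans ?_ hxy)
    exact mul_le_of_le_one_left (dst_nonneg x y) (pow_le_one₀ hth.le B.th_lt.le)
  have d2 : ‖f X - f Y‖ ≤ G * B.dst X Y := lipAt_spec hM hfM (lab_act_eq w x y hl hx) d1
  set m := Real.exp (B.Ktau * B.C ^ 2) with hm
  have hm1 : 1 ≤ m := Real.one_le_exp (mul_nonneg Ktau_pos.le (sq_nonneg _))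
  have d3 : Real.exp (B.tau w y) ≤ m * Real.exp (B.tau w x) := by
    rw [hm, ← Real.exp_add, Real.exp_le_exp]
    have h1 := (abs_le.1 (tau_lip w x y hl hx)).1
    have h2 := mul_le_mul_of_nonneg_left (dst_le x y) (Ktau_pos (B := B)).le
    linarith
  have d4 : √(Real.exp (B.tau w x)) * √(Real.exp (B.tau w y)) ≤ m * Real.exp (B.tau w x) := by
    rw [← Real.sqrt_mul (Real.exp_pos _).le]
    apply Real.sqrt_le_iff.2
    have h0 := Real.exp_pos (B.tau w x)
    refine ⟨by positivity, ?_⟩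
    calc _ ≤ Real.exp (B.tau w x) * (m * Real.exp (B.tau w x)) :=
          mul_le_mul_of_nonneg_left d3 h0.le
      _ ≤ (m * Real.exp (B.tau w x)) * (m * Real.exp (B.tau w x)) := by
          refine mul_le_mul_of_nonneg_right ?_ (by positivity)
          exact le_mul_of_one_le_left h0.le hm1
      _ = _ := by ring
  have d5 : B.dst X Y ≤ B.C ^ 2 * m * Real.exp (B.tau w x) * ρ := by
    have h1 := dst_le_abs X Y
    rw [abs_act w x y hx hy] at h1
    have h2 : |B.pos x - B.pos y| ≤ B.C * ρ :=
      (abs_le_dst x y).trans (mul_le_mul_of_nonneg_left hxy hC.le)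
    have h3 := mul_le_mul d4 h2 (abs_nonneg _) (by positivity)
    have h4 := h1.trans (mul_le_mul_of_nonneg_left h3 hC.le)
    refine h4.trans (le_of_eq (by ring))
  have d6 : G * Real.exp (B.tau w x) ≤ √(2 * K₉ * C₆) * √(B.th ^ n) * |t| * a := by
    refine (sq_le_sq₀ (by positivity) (by positivity)).1 ?_
    rw [mul_pow, mul_pow, mul_pow, mul_pow, Real.sq_sqrt (by positivity),
      Real.sq_sqrt (by positivity), sq_abs]
    have h1 := (hp.wt_mul_le_iterate (ψ := fun z => lipAt ρ f z ^ 2)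
      (fun z => sq_nonneg _) hx).trans hGx
    have h2 := mul_le_mul_of_nonneg_left hwt (sq_nonneg G)
    have hw0 := hp.wt_pos w x hx
    have h3 : K₉ * Λ ^ n * B.th ^ n ≤ K₉ * 2 * B.th ^ n := by gcongr
    calc G ^ 2 * Real.exp (B.tau w x) ^ 2
        ≤ G ^ 2 * (K₉ * Λ ^ n * B.th ^ n * wt p w x) := h2
      _ = K₉ * Λ ^ n * B.th ^ n * (wt p w x * G ^ 2) := by ring
      _ ≤ K₉ * 2 * B.th ^ n * (C₆ * t ^ 2 * a ^ 2) :=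
          mul_le_mul h3 h1 (by positivity) (by positivity)
      _ = _ := by ring
  have d7 : ‖f X - f Y‖ ≤ B.C ^ 2 * m * √(2 * K₉ * C₆) * (ρ * |t|) * √(B.th ^ n) * a := by
    refine d2.trans ((mul_le_mul_of_nonneg_left d5 hG0).trans ?_)
    calc _ = (G * Real.exp (B.tau w x)) * (B.C ^ 2 * m * ρ) := by ring
      _ ≤ (√(2 * K₉ * C₆) * √(B.th ^ n) * |t| * a) * (B.C ^ 2 * m * ρ) :=
          mul_le_mul_of_nonneg_right d6 (by positivity)
      _ = _ := by ring
  have key : ((Λ⁻¹ ^ n : ℝ) : ℂ) • f y -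
      cis (t * (B.tau w y - B.tau w x)) • (((Λ⁻¹ ^ n : ℝ) : ℂ) • f x) =
      (((Λ⁻¹ ^ n : ℝ) : ℂ) • f y - cis (t * B.tau w y) • wrot R w (f Y)) +
      cis (t * B.tau w y) • (wrot R w (f Y) - wrot R w (f X)) -
      cis (t * (B.tau w y - B.tau w x)) •
        (((Λ⁻¹ ^ n : ℝ) : ℂ) • f x - cis (t * B.tau w x) • wrot R w (f X)) := by
    have h1 : cis (t * B.tau w y) =
        cis (t * (B.tau w y - B.tau w x)) * cis (t * B.tau w x) := by
      rw [← cis_add]; congr 1; ring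
    rw [h1]
    module
  rw [key]
  refine (norm_sub_le _ _).trans ?_
  have h1 := norm_add_le (((Λ⁻¹ ^ n : ℝ) : ℂ) • f y - cis (t * B.tau w y) • wrot R w (f Y))
    (cis (t * B.tau w y) • (wrot R w (f Y) - wrot R w (f X)))
  rw [norm_smul, norm_cis, one_mul, norm_wrot_sub, norm_sub_rev (f Y)] at h1
  rw [norm_smul, norm_cis, one_mul]
  linarith

end BranchSystem

namespace BranchSystem

variable {B : BranchSystem} {V : Type*} [NormedAddCommGroup V] [InnerProductSpace ℂ V]

/-- The distortion constant of the weights. -/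
noncomputable def wdist (B : BranchSystem) (c K : ℝ) : ℝ :=
  c * Real.exp (-(K * B.C / (1 - B.th) * B.C ^ 2))

/-- The distortion constant of the derivatives. -/
noncomputable def tdist (B : BranchSystem) : ℝ :=
  Real.exp (-(2 * Real.log B.C + B.Ktau * B.C ^ 2))

theorem le_sqrt_mul_sqrt {m a b : ℝ} (hm : 0 ≤ m) (ha : m ≤ a) (hb : m ≤ b) :
    m ≤ √a * √b := by
  have := mul_le_mul (Real.sqrt_le_sqrt ha) (Real.sqrt_le_sqrt hb) (Real.sqrt_nonneg _)
    (Real.sqrt_nonneg _)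
  rwa [Real.mul_self_sqrt hm] at this

theorem sqrt_mul_sqrt_le {m a b : ℝ} (hm : 0 ≤ m) (ha : a ≤ m) (hb : b ≤ m) :
    √a * √b ≤ m := by
  have := mul_le_mul (Real.sqrt_le_sqrt ha) (Real.sqrt_le_sqrt hb) (Real.sqrt_nonneg _)
    (Real.sqrt_nonneg _)
  rwa [Real.mul_self_sqrt hm] at this

omit [InnerProductSpace ℂ V] in
/-- There are two points, at distance comparable to the scale, at which `f` is large compared
with the error function `ψ`. -/
theorem IsWeight.exists_pair {p : B.A → B.X → ℝ} {c K : ℝ} (hp : IsWeight p c K)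
    {t : ℝ} {f : B.X → V} {ρ M : ℝ} (hM : 0 ≤ M)
    (hfM : ∀ x y, B.lab x = B.lab y → ‖f x - f y‖ ≤ M * B.dst x y)
    (hfB : Bd fun x => ‖f x‖ ^ 2) {r : ℝ} {D₀ : ℕ} {N : ℕ → (B.X → ℝ) → ℝ}
    (hN : IsFunctional p r (D₀ + 2) N) {ψ : B.X → ℝ} (hψ : Bd ψ) (hψ0 : ∀ x, 0 ≤ ψ x)
    (h0 : 0 < N 0 fun x => ‖f x‖ ^ 2) (h1 : N 0 ψ ≤ N 0 fun x => ‖f x‖ ^ 2)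
    {C₅ C₇ s : ℝ} (hC₇ : 4 < C₇ * (B.wdist c K ^ 2 * c ^ 2)) (hC₅ : 0 ≤ C₅)
    (hG : ∀ x, lipAt ρ f x ^ 2 ≤ C₅ * t ^ 2 * ψ x) (hρ : 8 * C₅ * (ρ * |t|) ^ 2 ≤ 1)
    (hs0 : 0 < s) (hs1 : s < 1) (hsρ : B.C ^ 2 * s ≤ ρ) (hD₀ : B.C ^ 2 * B.th ^ D₀ ≤ s)
    (x₀ : B.X) :
    ∃ x y a, 0 < a ∧ B.lab x = B.lab y ∧ B.dst x y ≤ ρ ∧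
      B.C⁻¹ * B.tdist * s * B.C⁻¹ ≤ |B.pos x - B.pos y| ∧ ψ x ≤ C₇ * a ^ 2 ∧
      ψ y ≤ C₇ * a ^ 2 ∧ a / 2 ≤ ‖f x‖ := by
  have hC := C_pos (B := B)
  have hc := hp.c_pos
  have hρ0 : 0 ≤ ρ := le_trans (by positivity) hsρ
  obtain ⟨j, v, hk, n1, n2, hsm, y₁, hy₁, hy₁s⟩ :=
    hN.descent hp hfB hψ (fun _ => sq_nonneg _) hψ0 h0 h1 hs1 (by omega) hD₀ x₀
  set u := j :: v with hu
  set k := v.length + 1 with hkdef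
  have hune : u ≠ [] := List.cons_ne_nil j v
  set φ : B.X → ℝ := fun x => ‖f x‖ ^ 2 with hφ
  obtain ⟨y₀, hy₀, hlt⟩ : ∃ y, B.Adm (B.lab y) u ∧ ψ (B.act u y) < 2 * φ (B.act u y) := by
    by_contra hno
    push Not at hno
    have : N k (fun x => 2 * opW p u φ x) ≤ N k (opW p u ψ) := by
      refine hN.mono _ _ _ ((hp.bd_opW hfB u).smul 2) (hp.bd_opW hψ u) fun x => ?_
      by_cases hx : B.Adm (B.lab x) u
      · rw [opW_of hx, opW_of hx]
        nlinarith [mul_le_mul_of_nonneg_left (hno x hx) (hp.wt_pos u x hx).le]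
      · rw [opW_of_not hx, opW_of_not hx]; simp
    rw [hN.smul] at this
    linarith
  set z₀ := B.act u y₀ with hz₀
  set a := ‖f z₀‖ with ha
  have ha0 : 0 < a := by
    refine lt_of_le_of_ne (norm_nonneg _) fun h => ?_
    have h2 := hψ0 z₀
    simp only [hφ] at hlt
    rw [← ha, ← h] at hlt
    norm_num at hlt
    linarith
  have hadm : ∀ y, B.lab y ≠ B.bar j → B.Adm (B.lab y) u := fun y hy => ⟨hy, hy₀.2⟩
  have hG0 : lipAt ρ f z₀ * ρ ≤ a / 2 := by
    refine (sq_le_sq₀ (mul_nonneg (lipAt_nonneg ρ f _) hρ0) (by positivity)).1 ?_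
    have h2 : lipAt ρ f z₀ ^ 2 ≤ C₅ * t ^ 2 * (2 * a ^ 2) :=
      (hG z₀).trans (mul_le_mul_of_nonneg_left hlt.le (by positivity))
    have h3 := mul_le_mul_of_nonneg_right h2 (sq_nonneg ρ)
    have h4 := mul_le_mul_of_nonneg_right hρ (sq_nonneg a)
    rw [mul_pow ρ, sq_abs] at h4
    rw [mul_pow]
    nlinarith
  have hdst : ∀ y y', B.Adm (B.lab y) u → B.Adm (B.lab y') u →
      B.dst (B.act u y) (B.act u y') ≤ ρ := by
    intro y y' hy hy'
    refine (dst_le_abs _ _).trans (le_trans ?_ hsρ)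
    rw [abs_act u y y' hy hy']
    have h2 := mul_le_mul (sqrt_mul_sqrt_le hs0.le (hsm y hy) (hsm y' hy')) (B.pos_bdd y y')
      (abs_nonneg _) hs0.le
    have h3 := mul_le_mul_of_nonneg_left h2 hC.le
    linarith
  have hlab : ∀ y y', B.Adm (B.lab y) u → B.Adm (B.lab y') u →
      B.lab (B.act u y) = B.lab (B.act u y') := fun y y' hy hy' =>
    lab_act_eq v _ _ (lab_step_eq hy.1 hy'.1) hy.step
  have hnear : ∀ y, B.Adm (B.lab y) u → ‖f z₀ - f (B.act u y)‖ ≤ a / 2 := by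
    intro y hy
    have h2 := hdst y₀ y hy₀ hy
    exact (lipAt_spec hM hfM (hlab y₀ y hy₀ hy) h2).trans
      ((mul_le_mul_of_nonneg_left h2 (lipAt_nonneg ρ f _)).trans hG0)
  have hbig : ∀ y, B.Adm (B.lab y) u → ‖f (B.act u y)‖ ≤ 2 * a := by
    intro y hy
    have h2 := hnear y hy
    rw [norm_sub_rev] at h2
    have h3 := norm_le_norm_add_norm_sub' (f (B.act u y)) (f z₀)
    linarith
  have hsmall : ∀ y, B.Adm (B.lab y) u → a / 2 ≤ ‖f (B.act u y)‖ := by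
    intro y hy
    have h2 := hnear y hy
    have h3 := norm_le_norm_add_norm_sub' (f z₀) (f (B.act u y))
    linarith
  set d := B.wdist c K with hd
  have hd0 : 0 < d := mul_pos hc (Real.exp_pos _)
  set W := wt p u y₀ with hW
  have hW0 : 0 < W := hp.wt_pos u y₀ hy₀
  have hupper : N k (opW p u φ) ≤ 4 * a ^ 2 * (d⁻¹ * W) * N k (fun _ => 1) := by
    rw [← hN.smul]
    refine hN.mono _ _ _ (hp.bd_opW hfB u) ((Bd.const 1).smul _) fun x => ?_
    rw [mul_one]
    by_cases hx : B.Adm (B.lab x) u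
    · rw [opW_of hx]
      have h2 : wt p u x ≤ d⁻¹ * W := by
        rw [inv_mul_eq_div, le_div_iff₀ hd0, mul_comm]
        exact hp.wt_dist hune hx hy₀
      have h3 : φ (B.act u x) ≤ 4 * a ^ 2 :=
        (pow_le_pow_left₀ (norm_nonneg _) (hbig x hx) 2).trans (le_of_eq (by ring))
      rw [mul_comm]
      exact mul_le_mul h3 h2 (hp.wt_pos u x hx).le (by positivity)
    · rw [opW_of_not hx]; positivity
  have hN1 : 0 < N k (fun _ => 1) := by
    by_contra h
    push Not at h
    have : 4 * a ^ 2 * (d⁻¹ * W) * N k (fun _ => 1) ≤ 0 :=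
      mul_nonpos_of_nonneg_of_nonpos (by positivity) h
    linarith
  have hgood : ∀ b, b ≠ B.bar j → ∃ y, B.lab y = b ∧ ψ (B.act u y) ≤ C₇ * a ^ 2 := by
    intro b hb
    by_contra hno
    push Not at hno
    have hC₇0 : 0 < C₇ := by
      by_contra h
      push Not at h
      have : C₇ * (d ^ 2 * c ^ 2) ≤ 0 := mul_nonpos_of_nonpos_of_nonneg h (by positivity)
      linarith
    have hlower : C₇ * a ^ 2 * (d * W) * N k (fun x => if B.lab x = b then 1 else 0) ≤
        N k (opW p u ψ) := by
      rw [← hN.smul]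
      have hB1 : Bd (fun x : B.X => if B.lab x = b then (1 : ℝ) else 0) :=
        (Bd.const 1).of_le (fun x => by split_ifs <;> norm_num)
          (fun x => by split_ifs <;> norm_num)
      refine hN.mono _ _ _ (hB1.smul _) (hp.bd_opW hψ u) fun x => ?_
      split_ifs with hx
      · have hx' : B.Adm (B.lab x) u := hadm x (hx ▸ hb)
        rw [opW_of hx', mul_one, mul_comm]
        exact mul_le_mul (hp.wt_dist hune hy₀ hx') (hno x hx).le (by positivity)
          (hp.wt_pos u x hx').le
      · rw [mul_zero]; exact hp.opW_nonneg hψ0 u x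
    have hl2 := mul_le_mul_of_nonneg_left (hN.label_le hp (by omega : k + 2 ≤ D₀ + 2) b)
      (by positivity : 0 ≤ C₇ * a ^ 2 * (d * W))
    have h2 := (hl2.trans hlower).trans (n2.trans hupper)
    have h3 : C₇ * (d ^ 2 * c ^ 2) * (a ^ 2 * d⁻¹ * W * N k fun _ => 1) ≤
        4 * (a ^ 2 * d⁻¹ * W * N k fun _ => 1) := by
      refine le_trans (le_of_eq ?_) (h2.trans (le_of_eq (by ring)))
      field_simp
    have h4 : 0 < a ^ 2 * d⁻¹ * W * N k fun _ => 1 := by positivity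
    exact absurd (le_of_mul_le_mul_right h3 h4) (not_le.2 hC₇)
  obtain ⟨b₁, b₂, hb, hb₁, hb₂⟩ := B.two j
  obtain ⟨p₁, rfl, hp₁⟩ := hgood b₁ hb₁
  obtain ⟨p₂, rfl, hp₂⟩ := hgood b₂ hb₂
  have ha₁ := hadm p₁ hb₁
  have ha₂ := hadm p₂ hb₂
  refine ⟨B.act u p₁, B.act u p₂, a, ha0, hlab _ _ ha₁ ha₂, hdst _ _ ha₁ ha₂, ?_, hp₁, hp₂,
    hsmall _ ha₁⟩
  have hlow : ∀ y, B.Adm (B.lab y) u → B.C⁻¹ * B.tdist * s ≤ Real.exp (B.tau u y) := by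
    intro y hy
    simp only [hu, tau]
    rw [Real.exp_add, Real.exp_log (d_pos hy.1), mul_assoc]
    have h2 : B.tdist * s ≤ Real.exp (B.tau v (B.step j y)) :=
      (mul_le_mul_of_nonneg_left hy₁s.le (Real.exp_pos _).le).trans
        (exp_tau_le_of_label v hy.step hy₁)
    exact mul_le_mul (B.d_lb j y hy.1) h2 (mul_nonneg (Real.exp_pos _).le hs0.le)
      (d_pos hy.1).le
  rw [abs_act u _ _ ha₁ ha₂]
  have ht0 : 0 < B.tdist := Real.exp_pos _
  exact mul_le_mul (le_sqrt_mul_sqrt (by positivity) (hlow _ ha₁) (hlow _ ha₂)) (B.sep _ _ hb)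
    (by positivity) (by positivity)

end BranchSystem

namespace BranchSystem

variable {B : BranchSystem} {V : Type*} [NormedAddCommGroup V] [InnerProductSpace ℂ V]

/-- Two words whose phases differ cannot both be almost aligned at a pair of points. -/
theorem IsWeight.no_pair {p : B.A → B.X → ℝ} {c K : ℝ} (hp : IsWeight p c K)
    {Λ t : ℝ} {R : B.A → V ≃ₗᵢ[ℂ] V} {f : B.X → V} (hΛ : 1 ≤ Λ) (hf : IsTwisted p Λ t R f)
    {ρ M K₉ C₆ a η : ℝ} (hM : 0 ≤ M)
    (hfM : ∀ x y, B.lab x = B.lab y → ‖f x - f y‖ ≤ M * B.dst x y)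
    {w w' : List B.A} {n : ℕ} (hw : w.length = n) (hw' : w'.length = n) (hΛn : Λ ^ n ≤ 2)
    (hK₉ : 0 < K₉) (hC₆ : 0 < C₆) {x y : B.X} (hl : B.lab x = B.lab y)
    (hx : B.Adm (B.lab x) w) (hx' : B.Adm (B.lab x) w') (ha : 0 < a)
    (hwt : ∀ w x, B.Adm (B.lab x) w → Real.exp (B.tau w x) ^ 2 ≤
      K₉ * Λ ^ w.length * B.th ^ w.length * wt p w x)
    (hxy : B.dst x y ≤ ρ)
    (hEx : n * √(c⁻¹ ^ n * accum p (defect p Λ f) n x) ≤ η * a)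
    (hEy : n * √(c⁻¹ ^ n * accum p (defect p Λ f) n y) ≤ η * a)
    (hGx : (opL p)^[n] (fun z => lipAt ρ f z ^ 2) x ≤ C₆ * t ^ 2 * a ^ 2)
    (hfx : a / 2 ≤ ‖f x‖) {σ : ℝ}
    (hσ : σ ≤ |t| * |(B.tau w x - B.tau w y) - (B.tau w' x - B.tau w' y)|)
    (hsmall : 2 * B.Ktau * (ρ * |t|) ≤ 1)
    (hbig : 8 * (2 * η + B.C ^ 2 * Real.exp (B.Ktau * B.C ^ 2) * √(2 * K₉ * C₆) *
        (ρ * |t|) * √(B.th ^ n)) < σ / 2) : False := by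
  have e1 := hp.word_close hΛ hf hM hfM hw hΛn hK₉ hC₆ hl hx ha.le
    (by simpa [hw] using hwt w x hx) hxy hEx hEy hGx
  have e2 := hp.word_close hΛ hf hM hfM hw' hΛn hK₉ hC₆ hl hx' ha.le
    (by simpa [hw'] using hwt w' x hx') hxy hEx hEy hGx
  set E := 2 * η + B.C ^ 2 * Real.exp (B.Ktau * B.C ^ 2) * √(2 * K₉ * C₆) *
        (ρ * |t|) * √(B.th ^ n) with hE
  set v := ((Λ⁻¹ ^ n : ℝ) : ℂ) • f x with hv
  set α := t * (B.tau w y - B.tau w x) with hα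
  set β := t * (B.tau w' y - B.tau w' x) with hβ
  have hΛ0 : 0 < Λ := by linarith
  have h1 : ‖(cis α - cis β) • v‖ ≤ 2 * (E * a) := by
    have : (cis α - cis β) • v = (((Λ⁻¹ ^ n : ℝ) : ℂ) • f y - cis β • v) -
        (((Λ⁻¹ ^ n : ℝ) : ℂ) • f y - cis α • v) := by rw [sub_smul]; abel
    rw [this]
    exact (norm_sub_le _ _).trans (by linarith)
  have hv1 : a / 4 ≤ ‖v‖ := by
    rw [hv, norm_smul, Complex.norm_real, Real.norm_of_nonneg (by positivity)]
    have : (1 : ℝ) / 2 ≤ Λ⁻¹ ^ n := by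
      rw [inv_pow, one_div]; exact inv_anti₀ (by positivity) hΛn
    nlinarith
  have hab : |α - β| = |t| * |(B.tau w x - B.tau w y) - (B.tau w' x - B.tau w' y)| := by
    rw [← abs_mul, ← abs_neg]; congr 1; rw [hα, hβ]; ring
  have hle1 : |α - β| ≤ 1 := by
    rw [hab]
    have t1 := tau_lip w x y hl hx
    have t2 := tau_lip w' x y hl hx'
    have t3 := abs_sub (B.tau w x - B.tau w y) (B.tau w' x - B.tau w' y)
    have hK := Ktau_pos (B := B)
    calc _ ≤ |t| * (2 * (B.Ktau * ρ)) := by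
          refine mul_le_mul_of_nonneg_left ?_ (abs_nonneg t)
          nlinarith
      _ = 2 * B.Ktau * (ρ * |t|) := by ring
      _ ≤ 1 := hsmall
  have h2 := norm_cis_sub_ge α β hle1
  rw [norm_smul] at h1
  have h3 : |α - β| / 2 * (a / 4) ≤ 2 * (E * a) :=
    (mul_le_mul h2 hv1 (by positivity) (norm_nonneg _)).trans h1
  rw [hab] at h3
  have h4 : σ / 2 * (a / 4) ≤ 2 * (E * a) := le_trans (by nlinarith) h3
  have h5 : σ / 2 * (a / 4) - 2 * (E * a) = (σ / 2 - 8 * E) * (a / 4) := by ring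
  nlinarith [mul_pos (sub_pos.2 hbig) ha]

/-- The auxiliary function controlling defects and local Lipschitz constants has small mean. -/
theorem IsWeight.functional_aux_le {p : B.A → B.X → ℝ} {c K : ℝ} (hp : IsWeight p c K)
    {Λ t : ℝ} {R : B.A → V ≃ₗᵢ[ℂ] V} {f : B.X → V} (hΛ : 1 ≤ Λ) (hf : IsTwisted p Λ t R f)
    (hfB : Bd fun x => ‖f x‖ ^ 2) {D : ℕ} {N : ℕ → (B.X → ℝ) → ℝ}
    (hN : IsFunctional p Λ⁻¹ D N) {G : B.X → ℝ} (hG0 : ∀ x, 0 ≤ G x) (hGB : Bd G)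
    {n : ℕ} (hn : 0 < n) (hΛn : Λ ^ n ≤ 2) {ε C₄ : ℝ} (hε : 0 < ε) (hΛε : Λ - 1 ≤ ε / (12 * n))
    (hC₄ : 0 < C₄) (ht : 1 ≤ |t|)
    (hG : N 0 G ≤ C₄ * t ^ 2 * N 0 fun x => ‖f x‖ ^ 2) :
    N 0 (fun x => ε⁻¹ * accum p (defect p Λ f) n x + (6 * C₄ * t ^ 2)⁻¹ * ((opL p)^[n] G x + G x)) ≤
      N 0 fun x => ‖f x‖ ^ 2 := by
  have hΛ0 : 0 < Λ := by linarith
  have hn0 : (0 : ℝ) < n := by exact_mod_cast hn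
  have ht0 : t ≠ 0 := abs_pos.1 (by linarith)
  set φ : B.X → ℝ := fun x => ‖f x‖ ^ 2 with hφ
  have hφ0 : 0 ≤ N 0 φ := hN.nonneg 0 hfB fun _ => sq_nonneg _
  have hd0 := hp.defect_nonneg hΛ0 hf
  have hdB : Bd (defect p Λ f) := (hp.bd_opL hfB).of_le hd0 fun x => by
    unfold defect; linarith [mul_nonneg (pow_nonneg (inv_nonneg.2 hΛ0.le) 2) (sq_nonneg ‖f x‖)]
  have hr : 0 < Λ⁻¹ := inv_pos.2 hΛ0
  have hr1 : Λ⁻¹ ≤ 1 := inv_le_one_of_one_le₀ hΛ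
  have e1 : N 0 (defect p Λ f) ≤ 3 * (Λ - 1) * N 0 φ := by
    have a1 : N 0 (opL p φ) = N 0 (defect p Λ f) + Λ⁻¹ ^ 2 * N 0 φ := by
      rw [← hN.smul, ← hN.add _ _ _ hdB (hfB.smul _)]
      congr 1; funext x; simp only [defect, hφ]; ring
    have a2 := hN.shift φ hfB fun _ => sq_nonneg _
    rw [inv_inv] at a2
    have a3 : Λ - Λ⁻¹ ^ 2 ≤ 3 * (Λ - 1) := by
      have : Λ * Λ⁻¹ = 1 := mul_inv_cancel₀ hΛ0.ne'
      nlinarith [sq_nonneg (Λ⁻¹ - 1), mul_nonneg (sub_nonneg.2 hΛ) (sub_nonneg.2 hr1)]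
    nlinarith
  have e2 : N 0 (accum p (defect p Λ f) n) ≤ ε / 2 * N 0 φ := by
    have b1 := hN.accum_le hp hr hr1 hdB hd0 n
    rw [inv_inv] at b1
    refine b1.trans ?_
    have b2 : (n : ℝ) * Λ ^ n * N 0 (defect p Λ f) ≤ n * 2 * (3 * (ε / (12 * n)) * N 0 φ) := by
      refine mul_le_mul (by gcongr) (e1.trans (by gcongr)) (hN.nonneg 0 hdB hd0) (by positivity)
    refine b2.trans (le_of_eq ?_)
    field_simp; ring
  have e3 : N 0 ((opL p)^[n] G) ≤ 2 * (C₄ * t ^ 2 * N 0 φ) := by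
    have b1 := hN.iterate_le hp hr hGB hG0 n
    rw [inv_inv] at b1
    have b2 := hN.nonneg 0 hGB hG0
    nlinarith
  have hB1 : Bd (fun x => (opL p)^[n] G x + G x) := (hp.bd_iterate hGB n).add hGB
  rw [hN.add 0 _ _ ((hp.bd_accum hdB n).smul _) (hB1.smul _), hN.smul, hN.smul,
    hN.add 0 _ _ (hp.bd_iterate hGB n) hGB]
  have e4 : ε⁻¹ * N 0 (accum p (defect p Λ f) n) ≤ ε⁻¹ * (ε / 2 * N 0 φ) := by gcongr
  have e5 : (6 * C₄ * t ^ 2)⁻¹ * (N 0 ((opL p)^[n] G) + N 0 G) ≤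
      (6 * C₄ * t ^ 2)⁻¹ * (2 * (C₄ * t ^ 2 * N 0 φ) + C₄ * t ^ 2 * N 0 φ) := by gcongr
  refine (add_le_add e4 e5).trans (le_of_eq ?_)
  field_simp; ring

theorem IsWeight.functional_pos {p : B.A → B.X → ℝ} {c K : ℝ} (hp : IsWeight p c K)
    {Λ t : ℝ} {R : B.A → V ≃ₗᵢ[ℂ] V} {f : B.X → V} (hΛ : 0 < Λ) (hf : IsTwisted p Λ t R f)
    (hfB : Bd fun x => ‖f x‖ ^ 2) {D : ℕ} {N : ℕ → (B.X → ℝ) → ℝ} {x₀ : B.X}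
    (hN : ∀ φ, Bd φ → (∀ x, 0 ≤ φ x) → (opL p)^[D] φ x₀ ≤ N 0 φ) (hx : f x₀ ≠ 0) :
    0 < N 0 fun x => ‖f x‖ ^ 2 := by
  have h1 : ∀ k x, (Λ⁻¹ ^ 2) ^ k * ‖f x‖ ^ 2 ≤ (opL p)^[k] (fun y => ‖f y‖ ^ 2) x := by
    intro k
    induction k with
    | zero => intro x; simp
    | succ k ih =>
      intro x
      rw [Function.iterate_succ_apply']
      refine le_trans ?_ (opL_mono hp.nonneg ih x)
      rw [opL_smul, pow_succ, mul_assoc]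
      exact mul_le_mul_of_nonneg_left (hp.sq_le_opL hΛ hf x) (by positivity)
  refine lt_of_lt_of_le ?_ ((h1 D x₀).trans (hN _ hfB fun _ => sq_nonneg _))
  have := norm_pos_iff.2 hx
  positivity

set_option maxHeartbeats 1000000 in
/-- Eigenfunctions of twisted transfer operators with eigenvalue close to one vanish when the
frequency is large, by Dolgopyat's argument. -/
theorem eq_zero_of_isTwisted (B : BranchSystem) {cN c K K₉ : ℝ} (hcN : 0 < cN) (hc : 0 < c)
    (hK : 0 ≤ K) (hK₉ : 0 < K₉)
    (hNLI : ∀ a, ∀ n, 0 < n → ∃ w w' : List B.A, w.length = n ∧ w'.length = n ∧ B.Adm a w ∧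
      B.Adm a w' ∧ ∀ x y, B.lab x = a → B.lab y = a → cN * |B.pos x - B.pos y| ≤
        |(B.tau w x - B.tau w y) - (B.tau w' x - B.tau w' y)|) :
    ∃ T : ℝ, 0 < T ∧ ∃ Λ₀ : ℝ, 1 < Λ₀ ∧ ∀ (p : B.A → B.X → ℝ) (Λ : ℝ), 1 < Λ → Λ ≤ Λ₀ →
      IsWeight p c K → (∀ w x, B.Adm (B.lab x) w → Real.exp (B.tau w x) ^ 2 ≤
        K₉ * Λ ^ w.length * B.th ^ w.length * wt p w x) →
      ∀ (V : Type) [NormedAddCommGroup V] [InnerProductSpace ℂ V] (R : B.A → V ≃ₗᵢ[ℂ] V)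
        (t : ℝ) (f : B.X → V) (M : ℝ), T ≤ |t| → Bd (fun x => ‖f x‖ ^ 2) → 0 ≤ M →
        (∀ x y, B.lab x = B.lab y → ‖f x - f y‖ ≤ M * B.dst x y) → IsTwisted p Λ t R f →
        ∀ x, f x = 0 := by
  have hC := C_pos (B := B)
  have hth := B.th_pos
  have hth1 := B.th_lt
  have hKt := Ktau_pos (B := B)
  set q := 1 + (1 - B.th) / 6 with hq
  set θ₁ := (1 + B.th) / 2 with hθ₁
  set θ₂ := (3 + B.th) / 4 with hθ₂
  have hq1 : 1 < q := by linarith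
  have hqθ : q * q * B.th ≤ θ₁ := by
    have h1 : q * q ≤ 1 + (1 - B.th) / 2 := by nlinarith
    nlinarith
  have hqθ' : θ₁ * q ≤ θ₂ := by nlinarith
  set C₄ := 2 * (4 * (K * B.C + B.C ^ 2)) ^ 2 / ((1 - θ₁) * (1 - θ₂)) with hC₄
  have hC₄0 : 0 < C₄ := by
    have h1 : 0 < 1 - θ₁ := by linarith
    have h2 : 0 < 1 - θ₂ := by linarith
    positivity
  set C₅ := 6 * C₄ with hC₅
  have hwd : 0 < B.wdist c K := by unfold wdist; positivity
  set C₇ := 5 / (B.wdist c K ^ 2 * c ^ 2) with hC₇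
  have hC₇0 : 0 < C₇ := by positivity
  have hC₇4 : 4 < C₇ * (B.wdist c K ^ 2 * c ^ 2) := by
    rw [hC₇, div_mul_cancel₀ _ (by positivity)]; norm_num
  set C₆ := C₅ * C₇ with hC₆
  have hC₆0 : 0 < C₆ := by positivity
  set C₈ := B.C ^ 2 * Real.exp (B.Ktau * B.C ^ 2) * √(2 * K₉ * C₆) with hC₈
  have hC₈0 : 0 < C₈ := by positivity
  obtain ⟨κ, hκ0, hκ1, hκ2, hκ3⟩ : ∃ κ : ℝ, 0 < κ ∧ 8 * C₅ * κ ^ 2 ≤ 1 ∧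
      2 * B.Ktau * κ ≤ 1 ∧ K * B.C * κ ≤ Real.log q := by
    have hl := Real.log_pos hq1
    refine ⟨min 1 (min (1 / (8 * C₅)) (min (1 / (2 * B.Ktau)) (Real.log q / (K * B.C + 1)))),
      by positivity, ?_, ?_, ?_⟩
    · set κ := min 1 (min (1 / (8 * C₅)) (min (1 / (2 * B.Ktau)) (Real.log q / (K * B.C + 1))))
      have h0 : 0 < κ := by positivity
      have h1 : κ ≤ 1 := min_le_left _ _
      have h2 : κ ≤ 1 / (8 * C₅) := (min_le_right _ _).trans (min_le_left _ _)
      rw [le_div_iff₀ (by positivity)] at h2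
      have : 0 < C₅ := by positivity
      nlinarith [mul_pos this h0]
    · have h2 : min 1 (min (1 / (8 * C₅)) (min (1 / (2 * B.Ktau)) (Real.log q / (K * B.C + 1)))) ≤
        1 / (2 * B.Ktau) :=
        (min_le_right _ _).trans ((min_le_right _ _).trans (min_le_left _ _))
      rw [le_div_iff₀ (by positivity)] at h2
      linarith
    · set κ := min 1 (min (1 / (8 * C₅)) (min (1 / (2 * B.Ktau)) (Real.log q / (K * B.C + 1))))
      have h0 : 0 < κ := by positivity
      have h2 : κ ≤ Real.log q / (K * B.C + 1) :=
        (min_le_right _ _).trans ((min_le_right _ _).trans (min_le_right _ _))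
      rw [le_div_iff₀ (by positivity)] at h2
      linarith
  set c₂ := cN * B.tdist / B.C ^ 4 with hc₂
  have htd : 0 < B.tdist := Real.exp_pos _
  have hc₂0 : 0 < c₂ := by positivity
  obtain ⟨n, hn0, hn⟩ : ∃ n : ℕ, 0 < n ∧ 8 * C₈ * √(B.th ^ n) ≤ c₂ / 8 := by
    have h1 : Filter.Tendsto (fun n : ℕ => 8 * C₈ * √(B.th ^ n)) Filter.atTop
        (nhds (8 * C₈ * √0)) :=
      ((tendsto_pow_atTop_nhds_zero_of_lt_one hth.le hth1).sqrt).const_mul _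
    rw [Real.sqrt_zero, mul_zero] at h1
    obtain ⟨n, h2, h3⟩ := ((h1.eventually (ge_mem_nhds (show (0 : ℝ) < c₂ / 8 by positivity))).and
      (Filter.eventually_gt_atTop 0)).exists
    exact ⟨n, h3, h2⟩
  have hn0' : (0 : ℝ) < n := by exact_mod_cast hn0
  set η := c₂ * κ / 64 with hη
  have hη0 : 0 < η := by positivity
  set ε := c ^ n * (η / n) ^ 2 / C₇ with hε
  have hε0 : 0 < ε := by positivity
  obtain ⟨Λ₀, hΛ₀1, hΛ₀q, hΛ₀n, hΛ₀ε⟩ : ∃ Λ₀ : ℝ, 1 < Λ₀ ∧ Λ₀ ≤ q ∧ Λ₀ ^ n ≤ 2 ∧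
      Λ₀ - 1 ≤ ε / (12 * n) := by
    have h1 : Filter.Tendsto (fun x : ℝ => x ^ n) (nhdsWithin 1 (Set.Ioi 1)) (nhds (1 ^ n)) :=
      ((continuous_pow n).tendsto 1).mono_left nhdsWithin_le_nhds
    rw [one_pow] at h1
    have h2 : ∀ᶠ x : ℝ in nhdsWithin 1 (Set.Ioi 1), x ≤ min q (1 + ε / (12 * n)) :=
      nhdsWithin_le_nhds (ge_mem_nhds (lt_min hq1 (lt_add_of_pos_right _ (by positivity))))
    obtain ⟨x, hx1, hx2, hx3⟩ := ((h1.eventually (ge_mem_nhds one_lt_two)).and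
      (h2.and self_mem_nhdsWithin)).exists
    exact ⟨x, hx3, hx2.trans (min_le_left _ _), hx1, by
      linarith [hx2.trans (min_le_right q (1 + ε / (12 * n)))]⟩
  refine ⟨max 1 (κ / B.C ^ 2 + 1), by positivity, Λ₀, hΛ₀1, ?_⟩
  intro p Λ hΛ1 hΛΛ₀ hp hwt V _ _ R t f M ht hfB hM hfM hf x₀
  by_contra hx₀
  have ht1 : 1 ≤ |t| := (le_max_left _ _).trans ht
  have ht2 : κ / B.C ^ 2 < |t| := by linarith [(le_max_right 1 (κ / B.C ^ 2 + 1)).trans ht]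
  have ht0 : t ≠ 0 := abs_pos.1 (by linarith)
  have htp : 0 < |t| := abs_pos.2 ht0
  set ρ := κ / |t| with hρ
  have hρ0 : 0 < ρ := by positivity
  have hρt : ρ * |t| = κ := div_mul_cancel₀ _ htp.ne'
  have hρκ : ρ ≤ κ := div_le_self hκ0.le ht1
  set s := κ / (B.C ^ 2 * |t|) with hs
  have hs0 : 0 < s := by positivity
  have hs1 : s < 1 := by
    rw [hs, div_lt_one (by positivity)]
    rwa [div_lt_iff₀ (by positivity), mul_comm] at ht2
  have hsρ : B.C ^ 2 * s ≤ ρ := by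
    rw [hs, hρ]; apply le_of_eq; field_simp
  obtain ⟨D₀, hD₀⟩ : ∃ D₀ : ℕ, B.C ^ 2 * B.th ^ D₀ ≤ s := by
    obtain ⟨D₀, h⟩ := exists_pow_lt_of_lt_one (show 0 < s / B.C ^ 2 by positivity) hth1
    rw [lt_div_iff₀ (by positivity), mul_comm] at h
    exact ⟨D₀, h.le⟩
  have hΛ0 : 0 < Λ := by linarith
  have hΛn : Λ ^ n ≤ 2 := (pow_le_pow_left₀ hΛ0.le hΛΛ₀ n).trans hΛ₀n
  obtain ⟨N, hN, hNx⟩ := hp.exists_functional (inv_pos.2 hΛ0) (inv_lt_one_of_one_lt₀ hΛ1)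
    (D₀ + 2) x₀
  set G : B.X → ℝ := fun x => lipAt ρ f x ^ 2 with hG
  have hG0 : ∀ x, 0 ≤ G x := fun x => sq_nonneg _
  have hGB : Bd G := (Bd.const (M ^ 2)).of_le hG0 fun x =>
    pow_le_pow_left₀ (lipAt_nonneg _ _ _) (lipAt_le hM fun y hy _ => hfM x y hy) 2
  have hNG : N 0 G ≤ C₄ * t ^ 2 * N 0 fun x => ‖f x‖ ^ 2 := by
    refine hp.lipAt_functional_le hΛ1.le hf hM hfM hfB hρ0.le ?_ (hΛΛ₀.trans hΛ₀q) (by linarith)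
      ht1 hqθ hqθ' (by linarith) (by linarith) hN
    rw [← Real.exp_log (by linarith : 0 < q), Real.exp_le_exp]
    refine le_trans ?_ hκ3
    gcongr
  set ψ : B.X → ℝ := fun x => ε⁻¹ * accum p (defect p Λ f) n x +
    (6 * C₄ * t ^ 2)⁻¹ * ((opL p)^[n] G x + G x) with hψ
  have hd0 := hp.defect_nonneg hΛ0 hf
  have hdB : Bd (defect p Λ f) := (hp.bd_opL hfB).of_le hd0 fun x => by
    unfold defect; linarith [mul_nonneg (pow_nonneg (inv_nonneg.2 hΛ0.le) 2) (sq_nonneg ‖f x‖)]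
  have ha0 := hp.accum_nonneg hd0 n
  have hi0 := hp.iterate_nonneg hG0 n
  have hψ1 : ∀ x, accum p (defect p Λ f) n x ≤ ε * ψ x := by
    intro x
    have : ε * ψ x = accum p (defect p Λ f) n x +
        ε * ((6 * C₄ * t ^ 2)⁻¹ * ((opL p)^[n] G x + G x)) := by
      simp only [hψ]; rw [mul_add, mul_inv_cancel_left₀ hε0.ne']
    rw [this]
    have := hi0 x
    have := hG0 x
    exact le_add_of_nonneg_right (by positivity)
  have hψ2 : ∀ x, (opL p)^[n] G x + G x ≤ C₅ * t ^ 2 * ψ x := by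
    intro x
    have : C₅ * t ^ 2 * ψ x = (opL p)^[n] G x + G x +
        C₅ * t ^ 2 * (ε⁻¹ * accum p (defect p Λ f) n x) := by
      simp only [hψ, hC₅]; rw [mul_add, mul_inv_cancel_left₀ (by positivity)]; ring
    rw [this]
    have := ha0 x
    exact le_add_of_nonneg_right (by positivity)
  have hψ3 : ∀ x, lipAt ρ f x ^ 2 ≤ C₅ * t ^ 2 * ψ x := fun x =>
    le_trans (le_add_of_nonneg_left (hi0 x)) (hψ2 x)
  obtain ⟨x, y, a, ha, hl, hxy, hpos, hψx, hψy, hfx⟩ := hp.exists_pair hM hfM hfB hN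
    (((hp.bd_accum hdB n).smul _).add (((hp.bd_iterate hGB n).add hGB).smul _))
    (fun x => by have := ha0 x; have := hi0 x; have := hG0 x; positivity)
    (hp.functional_pos hΛ0 hf hfB hNx hx₀)
    (hp.functional_aux_le hΛ1.le hf hfB hN hG0 hGB hn0 hΛn hε0 (by linarith) hC₄0 ht1 hNG)
    hC₇4 (t := t) (C₅ := C₅) (by positivity) hψ3 (by rw [hρt]; exact hκ1)
    hs0 hs1 hsρ hD₀ x₀
  have hE : ∀ z, ψ z ≤ C₇ * a ^ 2 →
      n * √(c⁻¹ ^ n * accum p (defect p Λ f) n z) ≤ η * a := by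
    intro z hz
    have h1 : c⁻¹ ^ n * accum p (defect p Λ f) n z ≤ (η / n * a) ^ 2 := by
      calc _ ≤ c⁻¹ ^ n * (ε * (C₇ * a ^ 2)) := by
            have := (hψ1 z).trans (mul_le_mul_of_nonneg_left hz hε0.le)
            gcongr
        _ = _ := by rw [hε, inv_pow]; field_simp
    calc _ ≤ n * (η / n * a) := by
          refine mul_le_mul_of_nonneg_left ?_ hn0'.le
          exact Real.sqrt_le_iff.2 ⟨by positivity, h1⟩
      _ = _ := by field_simp
  obtain ⟨w, w', hw, hw', hwa, hwa', hNL⟩ := hNLI (B.lab x) n hn0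
  refine hp.no_pair hΛ1.le hf hM hfM hw hw' hΛn hK₉ hC₆0 hl hwa hwa' ha hwt hxy
    (hE x hψx) (hE y hψy) ?_ hfx (σ := c₂ * κ) ?_ (by rw [hρt]; exact hκ2) ?_
  · have h1 := hψ2 x
    have h2 := hG0 x
    have h3 : C₅ * t ^ 2 * ψ x ≤ C₅ * t ^ 2 * (C₇ * a ^ 2) :=
      mul_le_mul_of_nonneg_left hψx (by positivity)
    calc (opL p)^[n] G x ≤ C₅ * t ^ 2 * (C₇ * a ^ 2) := by linarith
      _ = _ := by rw [hC₆]; ring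
  · have h1 := hNL x y rfl hl.symm
    calc c₂ * κ = |t| * (cN * (B.C⁻¹ * B.tdist * s * B.C⁻¹)) := by
          rw [hc₂, hs]; field_simp
      _ ≤ |t| * (cN * |B.pos x - B.pos y|) := by gcongr
      _ ≤ _ := mul_le_mul_of_nonneg_left h1 htp.le
  · rw [hρt, ← hC₈]
    have h1 := mul_le_mul_of_nonneg_right hn hκ0.le
    have h2 : 0 < c₂ * κ := by positivity
    rw [hη]
    linarith

end BranchSystem

namespace BranchSystem

variable {B : BranchSystem}

/-- The normalised geometric weights. -/
noncomputable def nrm (B : BranchSystem) (Λ σ : ℝ) (h : B.X → ℝ) (j : B.A) (x : B.X) : ℝ :=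
  Λ⁻¹ * dpow B σ j x * h (B.step j x) / h x

theorem abs_pos_step {j : B.A} {x y : B.X} (hx : B.lab x ≠ B.bar j) (hy : B.lab y ≠ B.bar j) :
    |B.pos (B.step j x) - B.pos (B.step j y)| ≤ B.C * |B.pos x - B.pos y| := by
  rw [B.mob j x y hx hy]
  refine mul_le_mul_of_nonneg_right ?_ (abs_nonneg _)
  have h1 := mul_le_mul (Real.sqrt_le_sqrt (B.d_ub j x hx)) (Real.sqrt_le_sqrt (B.d_ub j y hy))
    (Real.sqrt_nonneg _) (Real.sqrt_nonneg _)
  rwa [Real.mul_self_sqrt (C_pos (B := B)).le] at h1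

section

variable {h : B.X → ℝ} {Ch Λ σ : ℝ}

theorem wt_nrm (hΛ : 0 < Λ) (h1 : ∀ x, 1 ≤ h x) (u : List B.A) : ∀ x : B.X,
    B.Adm (B.lab x) u → wt (nrm B Λ σ h) u x =
      Λ⁻¹ ^ u.length * Real.exp (σ * B.tau u x) * h (B.act u x) / h x := by
  induction u with
  | nil => intro x _; have := h1 x; simp [wt, tau, act]; field_simp
  | cons j u ih =>
    intro x hx
    have a1 := h1 x
    have a2 := h1 (B.step j x)
    simp only [wt, tau, act, List.length_cons]
    rw [ih _ hx.step, nrm, dpow, Real.rpow_def_of_pos (d_pos hx.1), mul_add, Real.exp_add,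
      mul_comm (Real.log _), pow_succ']
    have b1 : h x ≠ 0 := by linarith
    have b2 : h (B.step j x) ≠ 0 := by linarith
    generalize Λ⁻¹ ^ u.length = y
    field_simp

theorem isWeight_nrm {s : ℝ} (h1 : ∀ x, 1 ≤ h x)
    (hl : ∀ x y, B.lab x = B.lab y → h x ≤ Real.exp (Ch * |B.pos x - B.pos y|) * h y)
    (hCh0 : 1 ≤ Ch) (hCh : ∀ x y, h x ≤ Ch * h y) {Λ' : ℝ}
    (hsup : ∀ x, opL (dpow B s) h x ≤ Λ' * h x) (hσ1 : |σ| ≤ 1) (hσs : σ ≤ s)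
    (hΛ : B.C ^ (s - σ) * Λ' ≤ Λ) (hΛ0 : 0 < Λ) (hΛ2 : Λ ≤ 2) :
    IsWeight (nrm B Λ σ h) (2 * B.C * Ch)⁻¹ (B.C + Ch * B.C + Ch) where
  c_pos := by have := C_pos (B := B); positivity
  K_nonneg := by have := C_pos (B := B); positivity
  lb := by
    intro j x hx
    have hC := C_pos (B := B)
    have hh := h1 x
    have a1 : (2 : ℝ)⁻¹ ≤ Λ⁻¹ := inv_anti₀ hΛ0 hΛ2
    have a2 : B.C⁻¹ ≤ dpow B σ j x := by
      have hlog : |Real.log (B.d j x)| ≤ Real.log B.C := by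
        rw [abs_le]
        refine ⟨?_, Real.log_le_log (d_pos hx) (B.d_ub j x hx)⟩
        rw [← Real.log_inv]
        exact Real.log_le_log (by positivity) (B.d_lb j x hx)
      rw [dpow, Real.rpow_def_of_pos (d_pos hx), ← Real.exp_log (inv_pos.2 hC), Real.exp_le_exp,
        Real.log_inv]
      have a4 : |Real.log (B.d j x) * σ| ≤ Real.log B.C * 1 := by
        rw [abs_mul]; exact mul_le_mul hlog hσ1 (abs_nonneg _) ((abs_nonneg _).trans hlog)
      linarith [(abs_le.1 a4).1]
    have a3 : Ch⁻¹ ≤ h (B.step j x) / h x := by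
      rw [le_div_iff₀ (by linarith), inv_mul_le_iff₀ (by linarith)]
      exact hCh _ _
    have a4 := dpow_nonneg σ j x hx
    calc (2 * B.C * Ch)⁻¹ = 2⁻¹ * B.C⁻¹ * Ch⁻¹ := by rw [mul_inv, mul_inv]
      _ ≤ Λ⁻¹ * dpow B σ j x * (h (B.step j x) / h x) := by gcongr
      _ = _ := by rw [nrm]; ring
  sub := by
    intro x
    have hC := C_pos (B := B)
    have hh := h1 x
    have a1 : opL (nrm B Λ σ h) (fun _ => 1) x ≤
        Λ⁻¹ * B.C ^ (s - σ) / h x * opL (dpow B s) h x := by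
      unfold opL
      rw [Finset.mul_sum]
      refine Finset.sum_le_sum fun j _ => ?_
      unfold opA
      split_ifs with hj
      · have hd := d_pos hj
        have b1 : dpow B σ j x ≤ B.C ^ (s - σ) * dpow B s j x := by
          have : dpow B σ j x = (B.d j x)⁻¹ ^ (s - σ) * dpow B s j x := by
            rw [dpow, dpow, Real.inv_rpow hd.le, ← Real.rpow_neg hd.le, ← Real.rpow_add hd]
            congr 1; ring
          rw [this]
          refine mul_le_mul_of_nonneg_right ?_ (dpow_nonneg s j x hj)
          exact Real.rpow_le_rpow (by positivity) (inv_le_of_inv_le₀ hC (B.d_lb j x hj))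
            (by linarith)
        have b2 := h1 (B.step j x)
        calc nrm B Λ σ h j x * 1 ≤ Λ⁻¹ * (B.C ^ (s - σ) * dpow B s j x) *
              h (B.step j x) / h x := by
              rw [nrm, mul_one]; gcongr
          _ = _ := by ring
      · simp
    have a2 : Λ⁻¹ * B.C ^ (s - σ) / h x * opL (dpow B s) h x ≤
        Λ⁻¹ * B.C ^ (s - σ) / h x * (Λ' * h x) :=
      mul_le_mul_of_nonneg_left (hsup x) (by positivity)
    refine a1.trans (a2.trans ?_)
    have : Λ⁻¹ * B.C ^ (s - σ) / h x * (Λ' * h x) = (B.C ^ (s - σ) * Λ') / Λ := by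
      have : h x ≠ 0 := by linarith
      field_simp
    rw [this]
    exact (div_le_one hΛ0).2 hΛ
  lip := by
    intro j x y hxy hx
    have hy : B.lab y ≠ B.bar j := hxy ▸ hx
    have hC := C_pos (B := B)
    set Δ := |B.pos x - B.pos y| with hΔ
    have hΔ0 : 0 ≤ Δ := abs_nonneg _
    have a1 : dpow B σ j x ≤ Real.exp (B.C * Δ) * dpow B σ j y := by
      have b1 := B.dlip j x y hxy hx
      rw [dpow, dpow, Real.rpow_def_of_pos (d_pos hx), Real.rpow_def_of_pos (d_pos hy),
        ← Real.exp_add, Real.exp_le_exp]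
      have b2 : |(Real.log (B.d j x) - Real.log (B.d j y)) * σ| ≤ B.C * Δ * 1 := by
        rw [abs_mul]; exact mul_le_mul b1 hσ1 (abs_nonneg _) (by positivity)
      linarith [(abs_le.1 b2).2]
    have a2 : h (B.step j x) ≤ Real.exp (Ch * B.C * Δ) * h (B.step j y) := by
      refine (hl _ _ (lab_step_eq hx hy)).trans ?_
      have b2 := h1 (B.step j y)
      have b3 := abs_pos_step hx hy
      have : Ch * |B.pos (B.step j x) - B.pos (B.step j y)| ≤ Ch * B.C * Δ := by
        rw [mul_assoc]; exact mul_le_mul_of_nonneg_left b3 (by linarith)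
      gcongr
    have a3 : (h x)⁻¹ ≤ Real.exp (Ch * Δ) * (h y)⁻¹ := by
      have b1 := hl y x hxy.symm
      rw [abs_sub_comm] at b1
      have b2 := h1 x
      have b3 := h1 y
      rw [← div_eq_mul_inv, le_div_iff₀ (by linarith), inv_mul_le_iff₀ (by linarith), mul_comm]
      exact b1
    have e1 : Real.exp ((B.C + Ch * B.C + Ch) * Δ) =
        Real.exp (B.C * Δ) * Real.exp (Ch * B.C * Δ) * Real.exp (Ch * Δ) := by
      rw [← Real.exp_add, ← Real.exp_add]; ring_nf
    have c1 := h1 x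
    have c2 := h1 (B.step j x)
    have c3 := h1 y
    have c4 := h1 (B.step j y)
    have c5 := dpow_nonneg σ j y hy
    rw [e1]
    calc nrm B Λ σ h j x = Λ⁻¹ * (dpow B σ j x * h (B.step j x) * (h x)⁻¹) := by rw [nrm]; ring
      _ ≤ Λ⁻¹ * ((Real.exp (B.C * Δ) * dpow B σ j y) *
          (Real.exp (Ch * B.C * Δ) * h (B.step j y)) * (Real.exp (Ch * Δ) * (h y)⁻¹)) := by gcongr
      _ = _ := by rw [nrm]; ring

theorem exp_tau_sq_le (h1 : ∀ x, 1 ≤ h x) (hCh : ∀ x y, h x ≤ Ch * h y)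
    (hσ1 : |σ| ≤ 1) (hΛ0 : 0 < Λ) (u : List B.A) (x : B.X) (hx : B.Adm (B.lab x) u) :
    Real.exp (B.tau u x) ^ 2 ≤
      B.C ^ 6 * Ch * Λ ^ u.length * B.th ^ u.length * wt (nrm B Λ σ h) u x := by
  have hC := B.one_le_C
  have hth := B.th_pos
  have a1 := exp_tau_le hx
  have a2 := h1 x
  have a3 := h1 (B.act u x)
  rw [wt_nrm hΛ0 h1 u x hx]
  have e1 : Real.exp (B.tau u x) ^ 2 =
      Real.exp ((2 - σ) * B.tau u x) * Real.exp (σ * B.tau u x) := by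
    rw [← Real.exp_add, ← Real.exp_nat_mul]; congr 1; push_cast; ring
  have e2 : Real.exp ((2 - σ) * B.tau u x) ≤ B.C ^ 6 * B.th ^ u.length := by
    obtain ⟨s1, s2⟩ := abs_le.1 hσ1
    rcases le_total (B.tau u x) 0 with h0 | h0
    · calc _ ≤ Real.exp (B.tau u x) := Real.exp_le_exp.2 (by nlinarith)
        _ ≤ _ := a1
        _ ≤ _ := by
          gcongr
          norm_num
    · have b1 : B.th ^ u.length ≤ 1 := pow_le_one₀ hth.le B.th_lt.le
      have b2 : Real.exp (B.tau u x) ≤ B.C ^ 2 := a1.trans (by nlinarith [sq_nonneg B.C])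
      have b3 : Real.exp (3 * B.tau u x) = Real.exp (B.tau u x) * Real.exp (B.tau u x) ^ 2 := by
        rw [← Real.exp_nat_mul, ← Real.exp_add]; congr 1; push_cast; ring
      calc _ ≤ Real.exp (3 * B.tau u x) := Real.exp_le_exp.2 (by nlinarith)
        _ = Real.exp (B.tau u x) * Real.exp (B.tau u x) ^ 2 := b3
        _ ≤ (B.C ^ 2 * B.th ^ u.length) * (B.C ^ 2) ^ 2 := by gcongr
        _ = _ := by ring
  have e3 : 1 ≤ Ch * h (B.act u x) / h x := by
    rw [le_div_iff₀ (by linarith), one_mul]; exact hCh _ _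
  have e4 : Λ ^ u.length * Λ⁻¹ ^ u.length = 1 := by
    rw [← mul_pow, mul_inv_cancel₀ hΛ0.ne', one_pow]
  rw [e1]
  calc _ ≤ (B.C ^ 6 * B.th ^ u.length) * Real.exp (σ * B.tau u x) := by gcongr
    _ ≤ (B.C ^ 6 * B.th ^ u.length) * Real.exp (σ * B.tau u x) * (Ch * h (B.act u x) / h x) :=
      le_mul_of_one_le_right (by positivity) e3
    _ = (B.C ^ 6 * B.th ^ u.length) * Real.exp (σ * B.tau u x) * (Ch * h (B.act u x) / h x) *
        (Λ ^ u.length * Λ⁻¹ ^ u.length) := by rw [e4, mul_one]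
    _ = _ := by ring

end

/-- Non-existence of fixed vectors of the twisted transfer operators for large frequency. -/
theorem eq_zero_of_fixed (B : BranchSystem) {cN s : ℝ} (hcN : 0 < cN)
    (hNLI : ∀ a, ∀ n, 0 < n → ∃ w w' : List B.A, w.length = n ∧ w'.length = n ∧ B.Adm a w ∧
      B.Adm a w' ∧ ∀ x y, B.lab x = a → B.lab y = a → cN * |B.pos x - B.pos y| ≤
        |(B.tau w x - B.tau w y) - (B.tau w' x - B.tau w' y)|)
    (hs0 : 0 ≤ s) (hs1 : s ≤ 1)
    (hgrow : ∀ Λ : ℝ, 1 < Λ → ∀ x : B.X,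
      Summable fun k : ℕ => (opL (dpow B s))^[k] (fun _ => 1) x / Λ ^ k) :
    ∃ ε : ℝ, 0 < ε ∧ ∃ T : ℝ, 0 < T ∧
      ∀ (V : Type) [NormedAddCommGroup V] [InnerProductSpace ℂ V] (R : B.A → V ≃ₗᵢ[ℂ] V)
        (σ t : ℝ) (F : B.X → V) (M : ℝ), s - ε ≤ σ → σ ≤ s → T ≤ |t| → (∀ x, ‖F x‖ ≤ M) →
        (∀ x y, B.lab x = B.lab y → ‖F x - F y‖ ≤ M * |B.pos x - B.pos y|) →
        (∀ x, F x = ∑ j, if B.lab x ≠ B.bar j then ((dpow B σ j x : ℝ) : ℂ) • br t R F j x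
          else 0) → ∀ x, F x = 0 := by
  have hC1 := B.one_le_C
  have hC := C_pos (B := B)
  obtain ⟨Ch, hCh1, hCh⟩ := exists_superharmonic B hs0 hgrow
  obtain ⟨T, hT, Λ₀, hΛ₀, H⟩ := eq_zero_of_isTwisted B (c := (2 * B.C * Ch)⁻¹)
    (K := B.C + Ch * B.C + Ch) (K₉ := B.C ^ 6 * Ch) hcN (by positivity) (by positivity)
    (by positivity) hNLI
  set Λ := min Λ₀ 2 with hΛ
  have hΛ1 : 1 < Λ := lt_min hΛ₀ one_lt_two
  obtain ⟨Λ', hΛ'1, hΛ'⟩ := exists_between hΛ1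
  have hΛ'2 : Λ' ≤ 2 := hΛ'.le.trans (min_le_right _ _)
  obtain ⟨ε, hε0, hε1, hε⟩ : ∃ ε : ℝ, 0 < ε ∧ ε ≤ 1 ∧ B.C ^ ε * Λ' ≤ Λ := by
    have h1 : Filter.Tendsto (fun ε : ℝ => B.C ^ ε * Λ') (nhdsWithin 0 (Set.Ioi 0))
        (nhds (B.C ^ (0 : ℝ) * Λ')) :=
      (((Real.continuous_const_rpow hC.ne').tendsto 0).mul_const _).mono_left nhdsWithin_le_nhds
    rw [Real.rpow_zero, one_mul] at h1
    have h2 : ∀ᶠ ε : ℝ in nhdsWithin 0 (Set.Ioi 0), ε ≤ 1 :=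
      nhdsWithin_le_nhds (ge_mem_nhds one_pos)
    obtain ⟨ε, e1, e2, e3⟩ := ((h1.eventually (ge_mem_nhds hΛ')).and
      (h2.and self_mem_nhdsWithin)).exists
    exact ⟨ε, e3, e2, e1⟩
  obtain ⟨h, h1, hl, hh, hsup⟩ := hCh Λ' hΛ'1 hΛ'2
  refine ⟨ε, hε0, T, hT, ?_⟩
  intro V _ _ R σ t F M hσε hσs ht hM hF hfix x
  have hσ1 : |σ| ≤ 1 := abs_le.2 ⟨by linarith, by linarith⟩
  have hΛC : B.C ^ (s - σ) * Λ' ≤ Λ :=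
    le_trans (mul_le_mul_of_nonneg_right (Real.rpow_le_rpow_of_exponent_le hC1 (by linarith))
      (by linarith)) hε
  have hM0 : 0 ≤ M := (norm_nonneg _).trans (hM x)
  have hΛ0 : 0 < Λ := by linarith
  set f : B.X → V := fun x => (((h x)⁻¹ : ℝ) : ℂ) • F x with hf
  have hinv : ∀ x, 0 < (h x)⁻¹ ∧ (h x)⁻¹ ≤ 1 := fun x =>
    ⟨inv_pos.2 (by linarith [h1 x]), inv_le_one_of_one_le₀ (h1 x)⟩
  have hfn : ∀ x, ‖f x‖ = (h x)⁻¹ * ‖F x‖ := fun x => by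
    simp only [hf]; rw [norm_smul, Complex.norm_real, Real.norm_of_nonneg (hinv x).1.le]
  have hfM : ∀ x, ‖f x‖ ≤ M := fun x => by
    rw [hfn]; exact (mul_le_of_le_one_left (norm_nonneg _) (hinv x).2).trans (hM x)
  set L := Ch * Real.exp (Ch * B.C) with hL
  have hL0 : 0 ≤ L := by positivity
  have hinvL : ∀ x y, B.lab x = B.lab y → (h x)⁻¹ - (h y)⁻¹ ≤ L * |B.pos x - B.pos y| := by
    intro x y hxy
    set Δ := |B.pos x - B.pos y| with hΔ
    have hΔ0 : 0 ≤ Δ := abs_nonneg _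
    have hΔC : Δ ≤ B.C := B.pos_bdd x y
    have b1 := hl y x hxy.symm
    rw [abs_sub_comm, ← hΔ] at b1
    have b2 := h1 x
    have b3 := h1 y
    have a3 : (h x)⁻¹ ≤ Real.exp (Ch * Δ) * (h y)⁻¹ := by
      rw [← div_eq_mul_inv, le_div_iff₀ (by linarith), inv_mul_le_iff₀ (by linarith), mul_comm]
      exact b1
    have a4 : Real.exp (Ch * Δ) - 1 ≤ L * Δ := by
      have c1 := Real.add_one_le_exp (-(Ch * Δ))
      have c2 : Real.exp (-(Ch * Δ)) * Real.exp (Ch * Δ) = 1 := by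
        rw [← Real.exp_add]; simp
      have c3 : Real.exp (Ch * Δ) ≤ Real.exp (Ch * B.C) := by gcongr
      have c4 : 0 ≤ Ch * Δ := by positivity
      have c5 : Real.exp (Ch * Δ) - 1 ≤ Ch * Δ * Real.exp (Ch * Δ) := by
        nlinarith [Real.exp_pos (Ch * Δ)]
      have c6 : Ch * Δ * Real.exp (Ch * Δ) ≤ Ch * Δ * Real.exp (Ch * B.C) :=
        mul_le_mul_of_nonneg_left c3 c4
      rw [hL]; linarith
    have a5 := hinv y
    have a6 : (0 : ℝ) ≤ Real.exp (Ch * Δ) - 1 := by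
      linarith [Real.add_one_le_exp (Ch * Δ), show 0 ≤ Ch * Δ by positivity]
    nlinarith
  have hfL : ∀ x y, B.lab x = B.lab y → ‖f x - f y‖ ≤ (M * (1 + L) * B.C) * B.dst x y := by
    intro x y hxy
    have a1 : f x - f y = (((h x)⁻¹ : ℝ) : ℂ) • (F x - F y) +
        (((h x)⁻¹ - (h y)⁻¹ : ℝ) : ℂ) • F y := by
      simp only [hf]; push_cast; rw [sub_smul, smul_sub]; abel
    have a2 : |(h x)⁻¹ - (h y)⁻¹| ≤ L * |B.pos x - B.pos y| := by
      rw [abs_le]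
      refine ⟨?_, hinvL x y hxy⟩
      have := hinvL y x hxy.symm
      rw [abs_sub_comm] at this
      linarith
    have a3 : ‖f x - f y‖ ≤ M * (1 + L) * |B.pos x - B.pos y| := by
      rw [a1]
      refine (norm_add_le _ _).trans ?_
      rw [norm_smul, norm_smul, Complex.norm_real, Complex.norm_real,
        Real.norm_of_nonneg (hinv x).1.le, Real.norm_eq_abs]
      have b1 := (mul_le_of_le_one_left (norm_nonneg (F x - F y)) (hinv x).2).trans (hF x y hxy)
      have b2 := mul_le_mul a2 (hM y) (norm_nonneg _) (by positivity)
      linarith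
    refine a3.trans ?_
    rw [mul_assoc _ B.C]
    exact mul_le_mul_of_nonneg_left (abs_le_dst x y) (by positivity)
  have htw : IsTwisted (nrm B Λ σ h) Λ t R f := by
    intro x
    have e : F x = _ := hfix x
    simp only [hf]
    rw [e, Finset.smul_sum, Finset.smul_sum]
    refine Finset.sum_congr rfl fun j _ => ?_
    split_ifs with hj
    · unfold br
      rw [map_smul]
      simp only [smul_smul]
      congr 1
      have : (h (B.step j x) : ℂ) ≠ 0 := by
        have := h1 (B.step j x)
        exact_mod_cast (by linarith : h (B.step j x) ≠ 0)
      rw [nrm]; push_cast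
      field_simp
    · simp
  have := H (nrm B Λ σ h) Λ hΛ1 (min_le_left _ _)
    (isWeight_nrm h1 hl hCh1 hh hsup hσ1 hσs hΛC hΛ0 (min_le_right _ _))
    (exp_tau_sq_le h1 hh hσ1 hΛ0) V R t f (M * (1 + L) * B.C) ht
    ((Bd.const (M ^ 2)).of_le (fun x => sq_nonneg _)
      fun x => pow_le_pow_left₀ (norm_nonneg _) (hfM x) 2) (by positivity) hfL htw x
  rw [hf] at this
  exact (smul_eq_zero.1 this).resolve_left (by exact_mod_cast (hinv x).1.ne')

end BranchSystem

open MeasureTheory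

section IteratedFunctionSystem

open scoped ENNReal NNReal

variable {E Y : Type} [MetricSpace Y]

/-- Finite-stage approximations of the coding map of an iterated function system. -/
def ifsApprox (f : E → Y → Y) (y : Y) : ℕ → (ℕ → E) → Y
  | 0, _ => y
  | n + 1, w => f (w 0) (ifsApprox f y n fun i => w (i + 1))

theorem dist_ifsApprox_succ_le {f : E → Y → Y} (y : Y) {R : ℝ} (hR : ∀ a b : Y, dist a b ≤ R)
    (hf : ∀ e a b, dist (f e a) (f e b) ≤ dist a b / 2) (n : ℕ) :
    ∀ w : ℕ → E, dist (ifsApprox f y n w) (ifsApprox f y (n + 1) w) ≤ R / 2 ^ n := by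
  induction n with
  | zero => intro w; simpa using hR _ _
  | succ n ih =>
    intro w
    have h := ih fun i => w (i + 1)
    calc _ ≤ dist (ifsApprox f y n fun i => w (i + 1))
          (ifsApprox f y (n + 1) fun i => w (i + 1)) / 2 := hf (w 0) _ _
      _ ≤ R / 2 ^ n / 2 := by linarith
      _ = _ := by rw [pow_succ]; field_simp

theorem exists_ifs_coding [CompleteSpace Y] [Nonempty Y] [Countable E] [MeasurableSpace E]
    [MeasurableSingletonClass E] [MeasurableSpace Y] [BorelSpace Y] {f : E → Y → Y} {R : ℝ}
    (hR : ∀ a b : Y, dist a b ≤ R) (hf : ∀ e a b, dist (f e a) (f e b) ≤ dist a b / 2) :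
    ∃ p : (ℕ → E) → Y, Measurable p ∧ ∀ w, p w = f (w 0) (p fun i => w (i + 1)) := by
  obtain ⟨y⟩ := ‹Nonempty Y›
  have hcont : ∀ e, Continuous (f e) := fun e =>
    (LipschitzWith.of_dist_le_mul (K := 1) fun a b => by
      have := hf e a b
      have := dist_nonneg (x := a) (y := b)
      simp only [NNReal.coe_one, one_mul]; linarith).continuous
  have hcau : ∀ w : ℕ → E, CauchySeq fun n => ifsApprox f y n w := fun w =>
    cauchySeq_of_le_geometric_two (C := 2 * R) fun n => by
      simpa using dist_ifsApprox_succ_le y hR hf n w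
  choose p hp using fun w => cauchySeq_tendsto_of_complete (hcau w)
  refine ⟨p, ?_, fun w => ?_⟩
  · refine measurable_of_tendsto_metrizable (f := fun n => ifsApprox f y n) (fun n => ?_)
      (tendsto_pi_nhds.2 hp)
    induction n with
    | zero => exact measurable_const
    | succ n ih =>
      have h1 : Measurable fun q : E × Y => f q.1 q.2 :=
        measurable_from_prod_countable_right fun e => (hcont e).measurable
      have h2 : Measurable fun (w : ℕ → E) (i : ℕ) => w (i + 1) :=
        measurable_pi_lambda _ fun i => measurable_pi_apply _
      exact h1.comp ((measurable_pi_apply 0).prodMk (ih.comp h2))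
  · have h1 := (hp w).comp (Filter.tendsto_add_atTop_nat 1)
    have h2 := ((hcont (w 0)).tendsto _).comp (hp fun i => w (i + 1))
    exact tendsto_nhds_unique h1 h2

/-- Prepend an entry to a sequence. -/
def seqCons (q : E × (ℕ → E)) : ℕ → E
  | 0 => q.1
  | n + 1 => q.2 n

theorem measurable_seqCons [MeasurableSpace E] : Measurable (seqCons (E := E)) := by
  refine measurable_pi_lambda _ fun n => ?_
  cases n with
  | zero => exact measurable_fst
  | succ n => exact (measurable_pi_apply n).comp measurable_snd

theorem map_seqCons_infinitePi [MeasurableSpace E] (P : Measure E) [IsProbabilityMeasure P] :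
    (P.prod (Measure.infinitePi fun _ : ℕ => P)).map seqCons =
      Measure.infinitePi fun _ : ℕ => P := by
  refine Measure.eq_infinitePi _ fun s t ht => ?_
  classical
  rw [Measure.map_apply measurable_seqCons (MeasurableSet.pi s.countable_toSet fun i _ => ht i)]
  set u : Finset ℕ := (s.erase 0).image fun n => n - 1 with hu
  have hmem : ∀ n, n ∈ u ↔ n + 1 ∈ s := by
    intro n
    simp only [hu, Finset.mem_image, Finset.mem_erase]
    constructor
    · rintro ⟨m, ⟨hm, hms⟩, rfl⟩
      rwa [Nat.sub_add_cancel (Nat.pos_of_ne_zero hm)]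
    · intro h; exact ⟨n + 1, ⟨by omega, h⟩, by omega⟩
  have hset : seqCons ⁻¹' (Set.pi s t) =
      (if 0 ∈ s then t 0 else Set.univ) ×ˢ Set.pi u fun n => t (n + 1) := by
    ext ⟨e, w⟩
    simp only [Set.mem_preimage, Set.mem_pi, Finset.mem_coe, Set.mem_prod, hmem]
    constructor
    · intro h
      refine ⟨?_, fun n hn => h (n + 1) hn⟩
      split_ifs with h0
      · exact h 0 h0
      · trivial
    · rintro ⟨h0, h1⟩ n hn
      cases n with
      | zero => rw [if_pos hn] at h0; exact h0
      | succ n => exact h1 n hn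
  rw [hset, Measure.prod_prod, Measure.infinitePi_pi _ fun i _ => ht _]
  have hprod : ∏ i ∈ s.erase 0, P (t i) = ∏ i ∈ u, P (t (i + 1)) := by
    rw [hu, Finset.prod_image]
    · refine Finset.prod_congr rfl fun i hi => ?_
      rw [Nat.sub_add_cancel (Nat.pos_of_ne_zero (Finset.ne_of_mem_erase hi))]
    · intro a ha b hb hab
      have := Finset.ne_of_mem_erase ha
      have := Finset.ne_of_mem_erase hb
      simp only at hab
      omega
  rw [← hprod]
  split_ifs with h0
  · exact Finset.mul_prod_erase s (fun i => P (t i)) h0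
  · rw [Finset.erase_eq_of_notMem h0]; simp

theorem measure_ifs_coding_le [Countable E] [MeasurableSpace E] [MeasurableSingletonClass E]
    [MeasurableSpace Y] [BorelSpace Y] {f : E → Y → Y} {p : (ℕ → E) → Y} (hp : Measurable p)
    (hpf : ∀ w, p w = f (w 0) (p fun i => w (i + 1))) (P : Measure E) [IsProbabilityMeasure P]
    {q : ℝ≥0∞} (hq : ∀ e, P {e} ≤ q) {K : E → ℝ≥0} (hK : ∀ e, AntilipschitzWith (K e) (f e))
    {s : ℝ} (hs : 0 < s) (hPK : ∀ e, P {e} * (K e : ℝ≥0∞) ^ s ≤ 1) (hfc : ∀ e, Continuous (f e))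
    {g : ℝ≥0∞} (hg0 : g ≠ 0) (hgt : g ≠ ∞) (hgap : ∀ e e' a b, e ≠ e' → g ≤ edist (f e a) (f e' b))
    (n : ℕ) : ∀ S : Set Y, MeasurableSet S →
      (Measure.infinitePi fun _ : ℕ => P).map p S ≤ (Metric.ediam S / g) ^ s + q ^ n := by
  set μ := Measure.infinitePi fun _ : ℕ => P with hμ
  have hprob : IsProbabilityMeasure (μ.map p) := Measure.isProbabilityMeasure_map hp.aemeasurable
  induction n with
  | zero => intro S _; exact prob_le_one.trans (by simp)
  | succ n ih =>
    intro S hS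
    by_cases hd : g ≤ Metric.ediam S
    · refine prob_le_one.trans (le_add_right ?_)
      refine ENNReal.one_le_rpow ?_ hs
      rwa [ENNReal.le_div_iff_mul_le (Or.inl hg0) (Or.inl hgt), one_mul]
    rw [Measure.map_apply hp hS]
    rcases (p ⁻¹' S).eq_empty_or_nonempty with hem | ⟨w, hw⟩
    · rw [hem]; simp
    have hsub : seqCons ⁻¹' (p ⁻¹' S) ⊆ {w 0} ×ˢ (p ⁻¹' (f (w 0) ⁻¹' S)) := by
      rintro ⟨e, v⟩ hv
      have hv' : p (seqCons (e, v)) ∈ S := hv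
      rw [hpf (seqCons (e, v))] at hv'
      have hv2 : f e (p v) ∈ S := hv'
      have he : e = w 0 := by
        by_contra hne
        refine hd ((hgap e (w 0) (p v) (p fun i => w (i + 1)) hne).trans ?_)
        refine Metric.edist_le_ediam_of_mem hv2 ?_
        rw [← hpf]; exact hw
      subst he
      exact ⟨rfl, hv2⟩
    have h1 : μ (p ⁻¹' S) ≤ P {w 0} * μ.map p (f (w 0) ⁻¹' S) := by
      calc μ (p ⁻¹' S) = (P.prod μ).map seqCons (p ⁻¹' S) := by rw [hμ, map_seqCons_infinitePi]
        _ = (P.prod μ) (seqCons ⁻¹' (p ⁻¹' S)) := Measure.map_apply measurable_seqCons (hp hS)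
        _ ≤ _ := measure_mono hsub
        _ = _ := by
          rw [Measure.prod_prod, Measure.map_apply hp ((hfc _).measurable hS)]
    refine h1.trans ?_
    have h2 := ih _ ((hfc (w 0)).measurable hS)
    have h3 : Metric.ediam (f (w 0) ⁻¹' S) ≤ K (w 0) * Metric.ediam S := (hK _).ediam_preimage_le S
    calc P {w 0} * μ.map p (f (w 0) ⁻¹' S)
        ≤ P {w 0} * ((K (w 0) * Metric.ediam S / g) ^ s + q ^ n) := by
          gcongr
          exact h2.trans (by gcongr)
      _ = (P {w 0} * (K (w 0) : ℝ≥0∞) ^ s) * (Metric.ediam S / g) ^ s + P {w 0} * q ^ n := by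
          rw [mul_add, mul_div_assoc, ENNReal.mul_rpow_of_nonneg _ _ hs.le, mul_assoc]
      _ ≤ 1 * (Metric.ediam S / g) ^ s + q * q ^ n := by
          gcongr
          · exact hPK _
          · exact hq _
      _ = _ := by rw [one_mul, pow_succ']

theorem exists_set_le_dimH_of_ifs [CompleteSpace Y] [Nonempty Y] [Fintype E] {f : E → Y → Y}
    {R : ℝ} (hR : ∀ a b : Y, dist a b ≤ R) (hf : ∀ e a b, dist (f e a) (f e b) ≤ dist a b / 2)
    {c : E → ℝ} (hc0 : ∀ e, 0 < c e) (hc : ∀ e, c e ≤ 1 / 2)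
    (hfc : ∀ e a b, c e * dist a b ≤ dist (f e a) (f e b)) {g : ℝ} (hg : 0 < g)
    (hgap : ∀ e e' a b, e ≠ e' → g ≤ dist (f e a) (f e' b)) {s : ℝ≥0} (hs : 0 < s)
    (hsum : 1 ≤ ∑ e, c e ^ (s : ℝ)) :
    ∃ K : Set Y, (s : ℝ≥0∞) ≤ dimH K ∧ ∀ y ∈ K, ∃ e, ∃ z ∈ K, y = f e z := by
  let _ : MeasurableSpace E := ⊤
  let _ : MeasurableSpace Y := borel Y
  have : BorelSpace Y := ⟨rfl⟩
  obtain ⟨p, hp, hpf⟩ := exists_ifs_coding hR hf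
  have hs' : (0 : ℝ) < s := hs
  refine ⟨Set.range p, ?_, ?_⟩
  swap
  · rintro _ ⟨w, rfl⟩
    exact ⟨w 0, _, ⟨fun i => w (i + 1), rfl⟩, hpf w⟩
  set Z := ∑ e, c e ^ (s : ℝ) with hZ
  have hZ0 : 0 < Z := one_pos.trans_le hsum
  set P : PMF E := PMF.ofFintype (fun e => ENNReal.ofReal (c e ^ (s : ℝ) / Z)) (by
    rw [← ENNReal.ofReal_sum_of_nonneg fun e _ => by have := hc0 e; positivity, ← Finset.sum_div,
      div_self hZ0.ne', ENNReal.ofReal_one]) with hP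
  have hPe : ∀ e, P.toMeasure {e} ≤ ENNReal.ofReal (c e ^ (s : ℝ)) := by
    intro e
    rw [PMF.toMeasure_apply_singleton _ _ (MeasurableSet.singleton e), hP, PMF.ofFintype_apply]
    refine ENNReal.ofReal_le_ofReal (div_le_self ?_ hsum)
    have := hc0 e; positivity
  set q : ℝ≥0∞ := ENNReal.ofReal ((1 / 2) ^ (s : ℝ)) with hq
  have hq1 : q < 1 := by
    rw [hq, ← ENNReal.ofReal_one]
    exact (ENNReal.ofReal_lt_ofReal_iff one_pos).2
      (Real.rpow_lt_one (by norm_num) (by norm_num) hs')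
  have hPq : ∀ e, P.toMeasure {e} ≤ q := fun e => (hPe e).trans
    (ENNReal.ofReal_le_ofReal (Real.rpow_le_rpow (hc0 e).le (hc e) hs'.le))
  have hcont : ∀ e, Continuous (f e) := fun e =>
    (LipschitzWith.of_dist_le_mul (K := 1) fun a b => by
      have := hf e a b
      have := dist_nonneg (x := a) (y := b)
      simp only [NNReal.coe_one, one_mul]; linarith).continuous
  have hK : ∀ e, AntilipschitzWith (Real.toNNReal (c e)⁻¹) (f e) := fun e =>
    AntilipschitzWith.of_le_mul_dist fun a b => by
      rw [Real.coe_toNNReal _ (inv_nonneg.2 (hc0 e).le), inv_mul_eq_div, le_div_iff₀ (hc0 e),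
        mul_comm]
      exact hfc e a b
  have hPK : ∀ e, P.toMeasure {e} * ((Real.toNNReal (c e)⁻¹ : ℝ≥0) : ℝ≥0∞) ^ (s : ℝ) ≤ 1 := by
    intro e
    have h : ((Real.toNNReal (c e)⁻¹ : ℝ≥0) : ℝ≥0∞) = ENNReal.ofReal (c e)⁻¹ := rfl
    rw [h, ENNReal.ofReal_rpow_of_nonneg (inv_nonneg.2 (hc0 e).le) hs'.le]
    refine (mul_le_mul_left (hPe e) _).trans ?_
    rw [← ENNReal.ofReal_mul (by have := hc0 e; positivity), ← Real.mul_rpow (hc0 e).le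
      (inv_nonneg.2 (hc0 e).le), mul_inv_cancel₀ (hc0 e).ne', Real.one_rpow, ENNReal.ofReal_one]
  have hg0 : ENNReal.ofReal g ≠ 0 := by simpa using hg
  have hgap' : ∀ e e' a b, e ≠ e' → ENNReal.ofReal g ≤ edist (f e a) (f e' b) := by
    intro e e' a b h
    rw [edist_dist]
    exact ENNReal.ofReal_le_ofReal (hgap e e' a b h)
  set ν := (Measure.infinitePi fun _ : ℕ => P.toMeasure).map p with hν
  have hprob : IsProbabilityMeasure ν := Measure.isProbabilityMeasure_map hp.aemeasurable
  have key : ∀ S : Set Y, ν S ≤ (Metric.ediam S / ENNReal.ofReal g) ^ (s : ℝ) := by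
    intro S
    have h1 : ν S ≤ ν (closure S) := measure_mono subset_closure
    have h2 : ∀ n, ν (closure S) ≤ (Metric.ediam S / ENNReal.ofReal g) ^ (s : ℝ) + q ^ n := by
      intro n
      have := measure_ifs_coding_le hp hpf P.toMeasure hPq hK hs' hPK hcont hg0
        ENNReal.ofReal_ne_top hgap' n (closure S) isClosed_closure.measurableSet
      rwa [Metric.ediam_closure] at this
    have h3 := ((ENNReal.tendsto_pow_atTop_nhds_zero_of_lt_one hq1).const_add
      ((Metric.ediam S / ENNReal.ofReal g) ^ (s : ℝ)))
    rw [add_zero] at h3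
    exact h1.trans (ge_of_tendsto' h3 h2)
  have hle : ENNReal.ofReal g ^ (s : ℝ) • ν ≤ μH[(s : ℝ)] := by
    refine Measure.le_hausdorffMeasure _ _ 1 one_pos fun S _ => ?_
    rw [Measure.smul_apply, smul_eq_mul]
    refine (mul_le_mul_right (key S) _).trans ?_
    rw [← ENNReal.mul_rpow_of_nonneg _ _ hs'.le, ENNReal.mul_div_cancel hg0 ENNReal.ofReal_ne_top]
  refine le_dimH_of_hausdorffMeasure_ne_zero fun h0 => ?_
  have h1 := hle (Set.range p)
  rw [h0, Measure.smul_apply, smul_eq_mul, nonpos_iff_eq_zero, mul_eq_zero] at h1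
  rcases h1 with h1 | h1
  · rw [ENNReal.rpow_eq_zero_iff] at h1
    rcases h1 with h1 | h1
    · exact hg0 h1.1
    · exact ENNReal.ofReal_ne_top h1.1
  · have h2 : 1 ≤ ν (Set.range p) := by
      calc 1 = (Measure.infinitePi fun _ : ℕ => P.toMeasure) (p ⁻¹' Set.range p) := by simp
        _ ≤ _ := Measure.le_map_apply hp.aemeasurable _
    rw [h1] at h2
    simp at h2

end IteratedFunctionSystem

namespace BranchSystem

open scoped ENNReal NNReal

variable {B : BranchSystem}

theorem Adm.of_append {u v : List B.A} : ∀ {x : B.X}, B.Adm (B.lab x) (u ++ v) →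
    B.Adm (B.lab x) u ∧ B.Adm (B.lab (B.act u x)) v := by
  induction u with
  | nil => intro x h; exact ⟨trivial, h⟩
  | cons j u ih =>
    intro x h
    obtain ⟨h1, h2⟩ := ih (Adm.step h)
    refine ⟨⟨h.1, ?_⟩, h2⟩
    rwa [B.lab_step j x h.1] at h1

theorem exists_finset_words (k : ℕ) : ∀ x : B.X, ∃ W : Finset (List B.A),
    (∀ w ∈ W, w.length = k ∧ B.Adm (B.lab x) w) ∧
      ∀ s : ℝ, (opL (dpow B s))^[k] (fun _ => 1) x = ∑ w ∈ W, Real.exp (s * B.tau w x) := by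
  induction k with
  | zero =>
    intro x
    exact ⟨{[]}, by simp [Adm], by simp [tau]⟩
  | succ k ih =>
    intro x
    choose W hW hS using ih
    let T : B.A → Finset (List B.A) := fun j =>
      (W (B.step j x)).map ⟨fun u => j :: u, List.cons_injective⟩
    refine ⟨(Finset.univ.filter fun j => B.lab x ≠ B.bar j).biUnion T, ?_, ?_⟩
    · intro w hw
      simp only [Finset.mem_biUnion, Finset.mem_filter, Finset.mem_univ, true_and, T,
        Finset.mem_map, Function.Embedding.coeFn_mk] at hw
      obtain ⟨j, hj, u, hu, rfl⟩ := hw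
      obtain ⟨h1, h2⟩ := hW _ u hu
      rw [B.lab_step j x hj] at h2
      exact ⟨by simp [h1], hj, h2⟩
    · intro s
      rw [Function.iterate_succ_apply', Finset.sum_biUnion, Finset.sum_filter]
      · refine Finset.sum_congr rfl fun j _ => ?_
        by_cases hj : B.lab x ≠ B.bar j
        · rw [if_pos hj, opA_of hj, hS, Finset.mul_sum, Finset.sum_map]
          refine Finset.sum_congr rfl fun u _ => ?_
          simp only [Function.Embedding.coeFn_mk, tau, dpow]
          rw [Real.rpow_def_of_pos (d_pos hj), ← Real.exp_add]
          ring_nf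
        · rw [if_neg hj]
          exact if_neg hj
      · intro i _ j _ hij
        rw [Function.onFun, Finset.disjoint_left]
        intro w h1 h2
        simp only [T, Finset.mem_map, Function.Embedding.coeFn_mk] at h1 h2
        obtain ⟨u, _, rfl⟩ := h1
        obtain ⟨v, _, h⟩ := h2
        exact hij (List.cons.inj h).1.symm

theorem pos_act_sep (u : List B.A) : ∀ v : List B.A, u.length = v.length → u ≠ v → ∀ x y : B.X,
    B.Adm (B.lab x) u → B.Adm (B.lab y) v →
      B.C⁻¹ ^ (u.length + 1) ≤ |B.pos (B.act u x) - B.pos (B.act v y)| := by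
  have hC := B.one_le_C
  have hC0 : 0 ≤ B.C⁻¹ := inv_nonneg.2 C_pos.le
  have hC1 : B.C⁻¹ ≤ 1 := inv_le_one_of_one_le₀ hC
  induction u using List.reverseRecOn with
  | nil =>
    intro v hl hne
    exact absurd (List.length_eq_zero_iff.1 hl.symm).symm hne
  | append_singleton u i ih =>
    intro v hl hne x y hx hy
    obtain rfl | ⟨v, j, rfl⟩ := v.eq_nil_or_concat'
    · simp at hl
    have hl' : u.length = v.length := by simpa using hl
    obtain ⟨hx1, hx2⟩ := hx.of_append
    obtain ⟨hy1, hy2⟩ := hy.of_append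
    rw [act_append, act_append]
    simp only [act]
    by_cases hij : i = j
    · subst hij
      have hne' : u ≠ v := fun h => hne (by rw [h])
      rw [B.mob i _ _ hx2.1 hy2.1, List.length_append, List.length_singleton, pow_succ' _ (u.length + 1)]
      exact mul_le_mul (le_sqrt_mul_sqrt hC0 (B.d_lb _ _ hx2.1) (B.d_lb _ _ hy2.1))
        (ih v hl' hne' x y hx1 hy1) (by positivity) (by positivity)
    · refine (pow_le_of_le_one hC0 hC1 (Nat.succ_ne_zero _)).trans (B.sep _ _ ?_)
      rwa [B.lab_step i _ hx2.1, B.lab_step j _ hy2.1]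

theorem exists_set_of_words (hcl : ∀ a, IsClosed (B.pos '' {x | B.lab x = a})) {s : ℝ≥0}
    (hs : 0 < s) {x₀ : B.X} {k : ℕ} (hk : B.C ^ 2 * B.th ^ k ≤ 1 / 2)
    (hsum : 1 ≤ (B.tdist * B.C⁻¹ ^ 2) ^ (s : ℝ) * (opL (dpow B s))^[k] (fun _ => 1) x₀) :
    ∃ K : Set ℝ, (s : ℝ≥0∞) ≤ dimH K ∧ ∀ z ∈ K, ∀ n : ℕ, ∃ (w : List B.A) (y : B.X),
      n ≤ w.length ∧ B.Adm (B.lab y) w ∧ B.pos (B.act w y) = z := by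
  obtain ⟨W, hW, hS⟩ := exists_finset_words (B := B) k x₀
  have hC := C_pos (B := B)
  have hD0 : 0 < B.tdist := Real.exp_pos _
  have hD1 : B.tdist ≤ 1 := by
    unfold tdist
    rw [Real.exp_le_one_iff]
    have := Real.log_nonneg B.one_le_C
    have := mul_nonneg (Ktau_pos (B := B)).le (sq_nonneg B.C)
    linarith
  have hC1 : B.C⁻¹ ^ 2 ≤ 1 := pow_le_one₀ (inv_nonneg.2 hC.le) (inv_le_one_of_one_le₀ B.one_le_C)
  set a := B.lab x₀ with ha
  let Y : Type := {x : B.X // B.lab x = a}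
  let _ : MetricSpace Y := MetricSpace.induced (fun y : Y => B.pos y.1)
    (fun x y h => Subtype.ext (B.inj _ _ (x.2.trans y.2.symm) h)) inferInstance
  have hiso : Isometry (fun y : Y => B.pos y.1) := Isometry.of_dist_eq fun _ _ => rfl
  have hdist : ∀ x y : Y, dist x y = |B.pos x.1 - B.pos y.1| := fun _ _ => rfl
  have hcomp : CompleteSpace Y := by
    rw [completeSpace_iff_isComplete_range hiso.isUniformInducing]
    have h := hcl a
    rw [Set.image_eq_range] at h
    exact h.isComplete
  have hne : Nonempty Y := ⟨⟨x₀, rfl⟩⟩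
  choose l hl1 hl2 using fun b => B.mix b a
  let e : List B.A → List B.A := fun w => w ++ [l (B.lab (B.act w x₀)), a]
  have he : ∀ w ∈ W, B.Adm a (e w) ∧ ∀ x, B.lab x = a → B.lab (B.act (e w) x) = a := by
    intro w hw
    have h1 := (hW w hw).2
    have h2 : ∀ x, B.lab x = a → B.lab (B.act w x) = B.lab (B.act w x₀) := fun x hx =>
      lab_act_eq w x x₀ hx (by rwa [hx])
    refine ⟨adm_append (x := x₀) h1 ⟨hl1 _, hl2 _, trivial⟩, fun x hx => ?_⟩
    rw [act_append]
    simp only [act]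
    rw [B.lab_step]
    rw [B.lab_step]
    · exact hl2 _
    · rw [h2 x hx]; exact hl1 _
  have hlen : ∀ w ∈ W, (e w).length = k + 2 := fun w hw => by simp [e, (hW w hw).1]
  have hadm : ∀ (w : W) (y : Y), B.Adm (B.lab y.1) (e w.1) := fun w y => by
    rw [y.2]; exact (he _ w.2).1
  let f : W → Y → Y := fun w y => ⟨B.act (e w.1) y.1, (he _ w.2).2 _ y.2⟩
  have hexp : ∀ w ∈ W, B.tdist * B.C⁻¹ ^ 2 * Real.exp (B.tau w x₀) ≤
      B.tdist * Real.exp (B.tau (e w) x₀) := by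
    intro w hw
    have h1 := (hW w hw).2
    have h2 : B.Adm (B.lab (B.act w x₀)) [l (B.lab (B.act w x₀)), a] := ⟨hl1 _, hl2 _, trivial⟩
    have h3 := pow_le_exp_tau _ _ h2
    rw [tau_append, Real.exp_add, mul_assoc, mul_comm (Real.exp _)]
    exact mul_le_mul_of_nonneg_left (mul_le_mul_of_nonneg_right h3 (Real.exp_pos _).le) hD0.le
  have hexp' : ∀ (w : W) (y : Y), B.tdist * B.C⁻¹ ^ 2 * Real.exp (B.tau w.1 x₀) ≤
      Real.exp (B.tau (e w.1) y.1) := fun w y =>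
    (hexp _ w.2).trans (exp_tau_le_of_label _ (hadm w y) (he _ w.2).1)
  have hup : ∀ (w : W) (y : Y), Real.exp (B.tau (e w.1) y.1) ≤ 1 / 2 := by
    intro w y
    refine (exp_tau_le (hadm w y)).trans (le_trans ?_ hk)
    rw [hlen _ w.2]
    exact mul_le_mul_of_nonneg_left (pow_le_pow_of_le_one B.th_pos.le B.th_lt.le (by omega))
      (sq_nonneg _)
  have hW0 : ∀ w ∈ W, Real.exp (B.tau w x₀) ≤ 1 / 2 := by
    intro w hw
    refine (exp_tau_le (hW w hw).2).trans ?_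
    rwa [(hW w hw).1]
  have hdf : ∀ (w : W) (x y : Y), dist (f w x) (f w y) =
      √(Real.exp (B.tau (e w.1) x.1)) * √(Real.exp (B.tau (e w.1) y.1)) * dist x y := fun w x y =>
    abs_act _ _ _ (hadm w x) (hadm w y)
  obtain ⟨K, hK, hKf⟩ : ∃ K : Set Y, (s : ℝ≥0∞) ≤ dimH K ∧ ∀ y ∈ K, ∃ w, ∃ z ∈ K, y = f w z := by
    refine exists_set_le_dimH_of_ifs (f := f) (R := B.C)
      (c := fun w => B.tdist * B.C⁻¹ ^ 2 * Real.exp (B.tau w.1 x₀)) (g := B.C⁻¹ ^ (k + 2 + 1))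
      (s := s) (fun x y => B.pos_bdd _ _) ?_ (fun w => by positivity) ?_ ?_ (by positivity) ?_ hs ?_
    · intro w x y
      rw [hdf]
      have h1 : √(Real.exp (B.tau (e w.1) x.1)) * √(Real.exp (B.tau (e w.1) y.1)) ≤ 1 / 2 := by
        have h := mul_le_mul (Real.sqrt_le_sqrt (hup w x)) (Real.sqrt_le_sqrt (hup w y))
          (Real.sqrt_nonneg _) (Real.sqrt_nonneg _)
        rwa [Real.mul_self_sqrt (by norm_num)] at h
      have := mul_le_mul_of_nonneg_right h1 (dist_nonneg (x := x) (y := y))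
      linarith
    · intro w
      have h1 := hW0 _ w.2
      have h2 : B.tdist * B.C⁻¹ ^ 2 ≤ 1 := mul_le_one₀ hD1 (by positivity) hC1
      calc _ ≤ 1 * Real.exp (B.tau w.1 x₀) := mul_le_mul_of_nonneg_right h2 (Real.exp_pos _).le
        _ ≤ _ := by rwa [one_mul]
    · intro w x y
      rw [hdf]
      exact mul_le_mul_of_nonneg_right
        (le_sqrt_mul_sqrt (by positivity) (hexp' w x) (hexp' w y)) dist_nonneg
    · intro w w' x y hww
      have h1 := pos_act_sep (e w.1) (e w'.1) (by rw [hlen _ w.2, hlen _ w'.2]) ?_ x.1 y.1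
        (hadm w x) (hadm w' y)
      · rwa [hlen _ w.2] at h1
      · intro h
        exact hww (Subtype.ext (List.append_inj h (by rw [(hW _ w.2).1, (hW _ w'.2).1])).1)
    · have h1 : ∀ w : W, (B.tdist * B.C⁻¹ ^ 2 * Real.exp (B.tau w.1 x₀)) ^ (s : ℝ) =
          (B.tdist * B.C⁻¹ ^ 2) ^ (s : ℝ) * Real.exp (s * B.tau w.1 x₀) := by
        intro w
        rw [Real.mul_rpow (by positivity) (Real.exp_pos _).le, ← Real.exp_mul, mul_comm (s : ℝ)]
      simp only [h1]
      rw [← Finset.mul_sum, Finset.sum_coe_sort W fun w => Real.exp (s * B.tau w x₀), ← hS]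
      exact hsum
  have hit : ∀ n : ℕ, ∀ y ∈ K, ∃ (w : List B.A) (z : Y), n ≤ w.length ∧ B.Adm (B.lab z.1) w ∧
      B.act w z.1 = y.1 := by
    intro n
    induction n with
    | zero => intro y _; exact ⟨[], y, le_rfl, trivial, rfl⟩
    | succ n ih =>
      intro y hy
      obtain ⟨w, z, hz, rfl⟩ := hKf y hy
      obtain ⟨v, z', h1, h2, h3⟩ := ih z hz
      refine ⟨v ++ e w.1, z', ?_, adm_append h2 ?_, ?_⟩
      · rw [List.length_append, hlen _ w.2]; omega
      · rw [h3]; exact hadm w z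
      · rw [act_append, h3]
  refine ⟨(fun y : Y => B.pos y.1) '' K, ?_, ?_⟩
  · rw [hiso.dimH_image]; exact hK
  · rintro _ ⟨y, hy, rfl⟩ n
    obtain ⟨w, z, h1, h2, h3⟩ := hit n y hy
    exact ⟨w, z.1, h1, h2, by rw [h3]⟩

theorem exists_set_of_not_summable (hcl : ∀ a, IsClosed (B.pos '' {x | B.lab x = a})) {δ Λ : ℝ}
    (hδ : 0 ≤ δ) (hΛ : 1 < Λ) {x₀ : B.X}
    (hns : ¬ Summable fun k : ℕ => (opL (dpow B δ))^[k] (fun _ => 1) x₀ / Λ ^ k) :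
    ∃ s : ℝ≥0, δ < s ∧ ∃ K : Set ℝ, (s : ℝ≥0∞) ≤ dimH K ∧ ∀ z ∈ K, ∀ n : ℕ,
      ∃ (w : List B.A) (y : B.X), n ≤ w.length ∧ B.Adm (B.lab y) w ∧ B.pos (B.act w y) = z := by
  have hC := C_pos (B := B)
  have hlC := Real.log_nonneg B.one_le_C
  set m := Real.log Λ / 2 with hm
  have hm0 : 0 < m := half_pos (Real.log_pos hΛ)
  have hΛm : Λ = Real.exp m * Real.exp m := by
    rw [← Real.exp_add, hm, add_halves, Real.exp_log (by linarith)]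
  have hfreq : ∃ᶠ k : ℕ in Filter.atTop,
      Real.exp m ^ k < (opL (dpow B δ))^[k] (fun _ => 1) x₀ := by
    by_contra hcon
    rw [Filter.not_frequently] at hcon
    refine hns ?_
    have hgeo : Summable fun k : ℕ => (Real.exp (-m)) ^ k :=
      summable_geometric_of_lt_one (Real.exp_pos _).le (by rw [Real.exp_lt_one_iff]; linarith)
    refine summable_of_isBigO_nat hgeo (Asymptotics.IsBigO.of_bound 1 ?_)
    filter_upwards [hcon] with k hk
    obtain ⟨W, _, hS⟩ := exists_finset_words (B := B) k x₀
    have h0 : 0 ≤ (opL (dpow B δ))^[k] (fun _ => 1) x₀ := by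
      rw [hS]; exact Finset.sum_nonneg fun _ _ => (Real.exp_pos _).le
    have hΛ0 : 0 < Λ ^ k := pow_pos (by linarith) k
    rw [Real.norm_of_nonneg (div_nonneg h0 hΛ0.le), Real.norm_of_nonneg (by positivity), one_mul,
      div_le_iff₀ hΛ0, hΛm, mul_pow, Real.exp_neg, inv_pow, ← mul_assoc,
      inv_mul_cancel₀ (pow_pos (Real.exp_pos m) k).ne', one_mul]
    exact not_lt.1 hk
  set η := m / (2 * (Real.log B.C + 1)) with hη
  have hη0 : 0 < η := div_pos hm0 (by linarith)
  have hηC : η * Real.log B.C ≤ m / 2 := by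
    have : η * (Real.log B.C + 1) = m / 2 := by
      rw [hη]; field_simp
    nlinarith
  set s : ℝ≥0 := ⟨δ + η, by linarith⟩ with hs
  have hs' : (s : ℝ) = δ + η := rfl
  have hs0 : 0 < s := by
    rw [← NNReal.coe_pos, hs']; linarith
  refine ⟨s, by rw [hs']; linarith, ?_⟩
  have hlow : ∀ k : ℕ, (opL (dpow B δ))^[k] (fun _ => 1) x₀ * Real.exp (-(m / 2)) ^ k ≤
      (opL (dpow B s))^[k] (fun _ => 1) x₀ := by
    intro k
    obtain ⟨W, hW, hS⟩ := exists_finset_words (B := B) k x₀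
    rw [hS, hS, Finset.sum_mul]
    refine Finset.sum_le_sum fun w hw => ?_
    rw [← Real.exp_nat_mul, ← Real.exp_add, Real.exp_le_exp, hs']
    have h1 := pow_le_exp_tau w x₀ (hW w hw).2
    rw [(hW w hw).1, ← Real.exp_log (inv_pos.2 hC), ← Real.exp_nat_mul, Real.exp_le_exp,
      Real.log_inv] at h1
    have h2 := mul_le_mul_of_nonneg_left h1 hη0.le
    have h3 := mul_le_mul_of_nonneg_left hηC k.cast_nonneg
    nlinarith
  have ht1 : Filter.Tendsto (fun k : ℕ => B.C ^ 2 * B.th ^ k) Filter.atTop (nhds 0) := by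
    simpa using (tendsto_pow_atTop_nhds_zero_of_lt_one B.th_pos.le B.th_lt).const_mul (B.C ^ 2)
  have hκ : 0 < (B.tdist * B.C⁻¹ ^ 2) ^ (s : ℝ) := by
    have : 0 < B.tdist := Real.exp_pos _
    positivity
  have ht2 : Filter.Tendsto (fun k : ℕ => (B.tdist * B.C⁻¹ ^ 2) ^ (s : ℝ) * Real.exp (m / 2) ^ k)
      Filter.atTop Filter.atTop :=
    (tendsto_pow_atTop_atTop_of_one_lt (Real.one_lt_exp_iff.2 (half_pos hm0))).const_mul_atTop hκ
  obtain ⟨k, hk, hk1, hk2⟩ := (hfreq.and_eventually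
    ((ht1.eventually_le_const (by norm_num : (0 : ℝ) < 1 / 2)).and
      (ht2.eventually_ge_atTop 1))).exists
  refine exists_set_of_words hcl hs0 (x₀ := x₀) hk1 (hk2.trans ?_)
  refine mul_le_mul_of_nonneg_left (le_trans ?_ (hlow k)) hκ.le
  calc Real.exp (m / 2) ^ k = Real.exp m ^ k * Real.exp (-(m / 2)) ^ k := by
        rw [← mul_pow, ← Real.exp_add]; ring_nf
    _ ≤ _ := mul_le_mul_of_nonneg_right hk.le (by positivity)

end BranchSystem

/-- The denominator of a Möbius transformation on `ℂ`. -/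
noncomputable def denomC (g : SL2) (z : ℂ) : ℂ := (g.1 1 0 : ℂ) * z + (g.1 1 1 : ℂ)

/-- The denominator of a Möbius transformation on `ℝ`. -/
noncomputable def denomR (g : SL2) (x : ℝ) : ℝ := g.1 1 0 * x + g.1 1 1

theorem denomC_ofReal (g : SL2) (x : ℝ) : denomC g x = (denomR g x : ℂ) := by
  simp [denomC, denomR]

theorem mobiusC_ofReal (g : SL2) (x : ℝ) : mobiusC g x = (mobiusR g x : ℂ) := by
  simp [mobiusC, mobiusR]

theorem SL2.det_eq (g : SL2) : g.1 0 0 * g.1 1 1 - g.1 0 1 * g.1 1 0 = 1 := by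
  rw [← Matrix.det_fin_two]; exact g.2

theorem SL2.det_eqC (g : SL2) :
    (g.1 0 0 : ℂ) * (g.1 1 1 : ℂ) - (g.1 0 1 : ℂ) * (g.1 1 0 : ℂ) = 1 := by
  exact_mod_cast g.det_eq

theorem SL2.inv_apply (g : SL2) : (g⁻¹).1 0 0 = g.1 1 1 ∧ (g⁻¹).1 0 1 = -g.1 0 1 ∧
    (g⁻¹).1 1 0 = -g.1 1 0 ∧ (g⁻¹).1 1 1 = g.1 0 0 := by
  have h : (g⁻¹).1 = g.1.adjugate := Matrix.SpecialLinearGroup.coe_inv g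
  rw [h, Matrix.adjugate_fin_two]
  simp

theorem mobiusC_sub {g : SL2} {z w : ℂ} (hz : denomC g z ≠ 0) (hw : denomC g w ≠ 0) :
    mobiusC g z - mobiusC g w = (z - w) / (denomC g z * denomC g w) := by
  have h := g.det_eqC
  unfold mobiusC
  unfold denomC at *
  rw [div_sub_div _ _ hz hw]
  congr 1
  linear_combination (z - w) * h

theorem mobiusR_sub {g : SL2} {x y : ℝ} (hx : denomR g x ≠ 0) (hy : denomR g y ≠ 0) :
    mobiusR g x - mobiusR g y = (x - y) / (denomR g x * denomR g y) := by
  have h := g.det_eq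
  unfold mobiusR
  unfold denomR at *
  rw [div_sub_div _ _ hx hy]
  congr 1
  linear_combination (x - y) * h

theorem denomC_inv_mobiusC {g : SL2} {z : ℂ} (hz : denomC g z ≠ 0) :
    denomC g⁻¹ (mobiusC g z) = (denomC g z)⁻¹ := by
  have h := g.det_eqC
  obtain ⟨-, -, h3, h4⟩ := g.inv_apply
  unfold mobiusC
  unfold denomC at *
  rw [h3, h4, ← mul_left_inj' hz, inv_mul_cancel₀ hz, add_mul, mul_assoc, div_mul_cancel₀ _ hz]
  push_cast
  linear_combination h

theorem mobiusC_inv_mobiusC {g : SL2} {z : ℂ} (hz : denomC g z ≠ 0) :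
    mobiusC g⁻¹ (mobiusC g z) = z := by
  have h := g.det_eqC
  have h0 := denomC_inv_mobiusC hz
  obtain ⟨h1, h2, -, -⟩ := g.inv_apply
  have e : mobiusC g⁻¹ (mobiusC g z) =
      (((g⁻¹).1 0 0 : ℂ) * mobiusC g z + ((g⁻¹).1 0 1 : ℂ)) / denomC g⁻¹ (mobiusC g z) := rfl
  rw [e, h0, h1, h2, div_inv_eq_mul]
  unfold mobiusC
  unfold denomC at *
  rw [add_mul, mul_assoc, div_mul_cancel₀ _ hz]
  push_cast
  linear_combination z * h

theorem mobiusS_coe_of_ne {g : SL2} {z : ℂ} (hz : denomC g z ≠ 0) :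
    mobiusS g (z : OnePoint ℂ) = (mobiusC g z : ℂ) := if_neg hz

theorem mobiusS_coe_of_eq {g : SL2} {z : ℂ} (hz : denomC g z = 0) :
    mobiusS g (z : OnePoint ℂ) = OnePoint.infty := if_pos hz

theorem mobiusS_infty_of_ne {g : SL2} (h : g.1 1 0 ≠ 0) :
    mobiusS g OnePoint.infty = (((g.1 0 0 / g.1 1 0 : ℝ) : ℂ) : OnePoint ℂ) := if_neg h

theorem mobiusS_infty_of_eq {g : SL2} (h : g.1 1 0 = 0) :
    mobiusS g OnePoint.infty = OnePoint.infty := if_pos h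

theorem mobiusS_inv_mobiusS (g : SL2) (z : OnePoint ℂ) : mobiusS g⁻¹ (mobiusS g z) = z := by
  obtain ⟨h1, h2, h3, h4⟩ := g.inv_apply
  have hd := g.det_eqC
  induction z using OnePoint.rec with
  | infty =>
    by_cases h : g.1 1 0 = 0
    · rw [mobiusS_infty_of_eq h, mobiusS_infty_of_eq (by rw [h3, h, neg_zero])]
    · rw [mobiusS_infty_of_ne h, mobiusS_coe_of_eq]
      have h' : (g.1 1 0 : ℂ) ≠ 0 := by exact_mod_cast h
      rw [denomC, h3, h4]
      push_cast
      field_simp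
      ring
  | coe z =>
    by_cases h : denomC g z = 0
    · have h0 : g.1 1 0 ≠ 0 := by
        intro h0
        have h' : (g.1 1 0 : ℂ) = 0 := by exact_mod_cast h0
        rw [denomC, h', zero_mul, zero_add] at h
        rw [h', h] at hd
        simp at hd
      have h' : (g.1 1 0 : ℂ) ≠ 0 := by exact_mod_cast h0
      rw [mobiusS_coe_of_eq h, mobiusS_infty_of_ne (by rw [h3]; exact neg_ne_zero.2 h0), h1, h3]
      rw [denomC] at h
      congr 1
      push_cast
      rw [div_neg, neg_eq_iff_eq_neg, div_eq_iff h']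
      linear_combination h
    · rw [mobiusS_coe_of_ne h, mobiusS_coe_of_ne, mobiusC_inv_mobiusC h]
      rw [denomC_inv_mobiusC h]
      exact inv_ne_zero h

theorem wordBar_wordBar {r : ℕ} (a : Fin (2 * r)) : wordBar (wordBar a) = a := by
  have ha := a.isLt
  apply Fin.ext
  simp only [wordBar]
  rcases lt_or_ge (a.1 + r) (2 * r) with h | h
  · rw [Nat.mod_eq_of_lt h, Nat.add_assoc, ← two_mul, Nat.add_mod_right, Nat.mod_eq_of_lt ha]
  · have e : (a.1 + r) % (2 * r) = a.1 + r - 2 * r := by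
      rw [Nat.mod_eq_sub_mod h, Nat.mod_eq_of_lt (by omega)]
    rw [e, Nat.mod_eq_of_lt (by omega)]
    omega

namespace Schottky

variable (S : Schottky)

/-- The closed disc with the same centre and radius as `D_a`. -/
def cD (a : Fin (2 * S.r)) : Set ℂ := Metric.closedBall (S.center a : ℂ) (S.radius a)

variable {S}

theorem closure_ball (a : Fin (2 * S.r)) :
    closure (Metric.ball (S.center a : ℂ) (S.radius a)) = S.cD a :=
  _root_.closure_ball _ (S.radius_pos a).ne'

theorem D_subset_cD (a : Fin (2 * S.r)) : S.D a ⊆ S.cD a := Metric.ball_subset_closedBall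

theorem disjoint_cD {a b : Fin (2 * S.r)} (h : a ≠ b) : Disjoint (S.cD a) (S.cD b) := by
  have := S.disjoint a b h
  rwa [closure_ball, closure_ball] at this

theorem notMem_cD {a b : Fin (2 * S.r)} (h : a ≠ b) {z : ℂ} (hz : z ∈ S.cD a) : z ∉ S.cD b :=
  Set.disjoint_left.1 (disjoint_cD h) hz

theorem mobiusS_mem_cD_iff {a : Fin (2 * S.r)} {z : OnePoint ℂ} :
    mobiusS (S.g a) z ∈ (fun w : ℂ => (w : OnePoint ℂ)) '' S.cD a ↔
      z ∉ (fun w : ℂ => (w : OnePoint ℂ)) '' S.D (wordBar a) := by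
  have h := S.maps a
  rw [closure_ball] at h
  rw [← h]
  constructor
  · rintro ⟨y, hy, hyz⟩
    have : y = z := by
      rw [← mobiusS_inv_mobiusS (S.g a) y, hyz, mobiusS_inv_mobiusS]
    rwa [← this]
  · intro hz; exact ⟨z, hz, rfl⟩

theorem mobiusS_bar {a : Fin (2 * S.r)} (z : OnePoint ℂ) :
    mobiusS (S.g (wordBar a)) (mobiusS (S.g a) z) = z := by
  rw [S.g_bar, mobiusS_inv_mobiusS]

theorem mobiusS_mem_D_iff {a : Fin (2 * S.r)} {z : OnePoint ℂ} :
    mobiusS (S.g a) z ∈ (fun w : ℂ => (w : OnePoint ℂ)) '' S.D a ↔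
      z ∉ (fun w : ℂ => (w : OnePoint ℂ)) '' S.cD (wordBar a) := by
  have h := mobiusS_mem_cD_iff (a := wordBar a) (z := mobiusS (S.g a) z)
  rw [mobiusS_bar, wordBar_wordBar] at h
  rw [h, not_not]

theorem denomC_ne {a : Fin (2 * S.r)} {z : ℂ} (hz : z ∉ S.D (wordBar a)) :
    denomC (S.g a) z ≠ 0 := by
  intro h0
  have h := (mobiusS_mem_cD_iff (a := a) (z := z)).2 (by
    rintro ⟨w, hw, hwz⟩
    rw [OnePoint.coe_eq_coe] at hwz
    exact hz (hwz ▸ hw))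
  rw [mobiusS_coe_of_eq h0] at h
  obtain ⟨w, -, hw⟩ := h
  exact OnePoint.coe_ne_infty w hw

theorem mobiusC_mem_D {a : Fin (2 * S.r)} {z : ℂ} (hz : z ∉ S.cD (wordBar a)) :
    mobiusC (S.g a) z ∈ S.D a := by
  have h0 := denomC_ne (a := a) (z := z) fun h => hz (D_subset_cD _ h)
  have h := (mobiusS_mem_D_iff (a := a) (z := z)).2 (by
    rintro ⟨w, hw, hwz⟩
    rw [OnePoint.coe_eq_coe] at hwz
    exact hz (hwz ▸ hw))
  rw [mobiusS_coe_of_ne h0] at h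
  obtain ⟨w, hw, hwz⟩ := h
  rw [OnePoint.coe_eq_coe] at hwz
  exact hwz ▸ hw

/-- Two points swapped by a generator and its inverse. -/
theorem exists_eq_mobiusC {a : Fin (2 * S.r)} {z : ℂ} (hz : z ∉ S.D a) :
    denomC (S.g a) (mobiusC (S.g (wordBar a)) z) ≠ 0 ∧
      mobiusC (S.g a) (mobiusC (S.g (wordBar a)) z) = z := by
  have h0 := denomC_ne (a := wordBar a) (z := z) (by rwa [wordBar_wordBar])
  have h1 := denomC_inv_mobiusC h0
  have h2 := mobiusC_inv_mobiusC h0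
  rw [← S.g_bar, wordBar_wordBar] at h1 h2
  exact ⟨by rw [h1]; exact inv_ne_zero h0, h2⟩

end Schottky

namespace Schottky

open Filter Topology

variable (S : Schottky)

/-- Left endpoint of the interval `I_a`. -/
noncomputable def lo (a : Fin (2 * S.r)) : ℝ := S.center a - S.radius a

/-- Right endpoint of the interval `I_a`. -/
noncomputable def hi (a : Fin (2 * S.r)) : ℝ := S.center a + S.radius a

variable {S}

theorem mem_cD_ofReal {a : Fin (2 * S.r)} {x : ℝ} :
    (x : ℂ) ∈ S.cD a ↔ x ∈ Set.Icc (S.lo a) (S.hi a) := by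
  rw [cD, Metric.mem_closedBall, Complex.dist_eq, ← Complex.ofReal_sub, Complex.norm_real,
    Real.norm_eq_abs, abs_le, lo, hi, Set.mem_Icc]
  constructor <;> rintro ⟨h1, h2⟩ <;> constructor <;> linarith

theorem mem_D_ofReal {a : Fin (2 * S.r)} {x : ℝ} :
    (x : ℂ) ∈ S.D a ↔ x ∈ Set.Ioo (S.lo a) (S.hi a) := by
  rw [D, Metric.mem_ball, Complex.dist_eq, ← Complex.ofReal_sub, Complex.norm_real,
    Real.norm_eq_abs, abs_lt, lo, hi, Set.mem_Ioo]
  constructor <;> rintro ⟨h1, h2⟩ <;> constructor <;> linarith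

theorem lo_lt_hi (a : Fin (2 * S.r)) : S.lo a < S.hi a := by
  have := S.radius_pos a
  unfold lo hi; linarith

theorem notMem_cD_of_mem_Icc {i j : Fin (2 * S.r)} (h : i ≠ wordBar j) {x : ℝ}
    (hx : x ∈ Set.Icc (S.lo i) (S.hi i)) : (x : ℂ) ∉ S.cD (wordBar j) :=
  notMem_cD h (mem_cD_ofReal.2 hx)

theorem denomR_ne {i j : Fin (2 * S.r)} (h : i ≠ wordBar j) {x : ℝ}
    (hx : x ∈ Set.Icc (S.lo i) (S.hi i)) : denomR (S.g j) x ≠ 0 := by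
  have := denomC_ne fun h' => notMem_cD_of_mem_Icc h hx (D_subset_cD _ h')
  rw [denomC_ofReal] at this
  exact_mod_cast this

theorem mobiusR_mem_Ioo {i j : Fin (2 * S.r)} (h : i ≠ wordBar j) {x : ℝ}
    (hx : x ∈ Set.Icc (S.lo i) (S.hi i)) :
    mobiusR (S.g j) x ∈ Set.Ioo (S.lo j) (S.hi j) := by
  have := mobiusC_mem_D (notMem_cD_of_mem_Icc h hx)
  rwa [mobiusC_ofReal, mem_D_ofReal] at this

theorem denomR_mul_pos {i j : Fin (2 * S.r)} (h : i ≠ wordBar j) {x y : ℝ}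
    (hx : x ∈ Set.Icc (S.lo i) (S.hi i)) (hy : y ∈ Set.Icc (S.lo i) (S.hi i)) :
    0 < denomR (S.g j) x * denomR (S.g j) y := by
  by_contra! hn
  have hc : Continuous (denomR (S.g j)) := by unfold denomR; fun_prop
  have h0 : (0 : ℝ) ∈ Set.uIcc (denomR (S.g j) x) (denomR (S.g j) y) := by
    rw [Set.mem_uIcc]
    rcases mul_nonpos_iff.1 hn with h | h
    · exact Or.inr ⟨h.2, h.1⟩
    · exact Or.inl h
  obtain ⟨z, hz, hz0⟩ := intermediate_value_uIcc hc.continuousOn h0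
  exact denomR_ne h ((Set.ordConnected_Icc.uIcc_subset hx hy) hz) hz0

variable (S) in
theorem exists_eta : ∃ η : ℝ, 0 < η ∧ (∀ i, η < S.radius i) ∧ ∀ i j, i ≠ wordBar j →
    S.lo j + η < mobiusR (S.g j) (S.lo i) ∧ mobiusR (S.g j) (S.hi i) < S.hi j - η := by
  have key : ∀ a : ℝ, 0 < a → ∀ᶠ η in 𝓝[>] (0 : ℝ), η < a := fun a ha =>
    nhdsWithin_le_nhds (Iio_mem_nhds ha)
  have h : ∀ᶠ η in 𝓝[>] (0 : ℝ), 0 < η ∧ (∀ i, η < S.radius i) ∧ ∀ i j, i ≠ wordBar j →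
      S.lo j + η < mobiusR (S.g j) (S.lo i) ∧ mobiusR (S.g j) (S.hi i) < S.hi j - η := by
    refine eventually_mem_nhdsWithin.and ((eventually_all.2 fun i => key _ (S.radius_pos i)).and
      (eventually_all.2 fun i => eventually_all.2 fun j => ?_))
    by_cases hij : i ≠ wordBar j
    · have h1 := (mobiusR_mem_Ioo hij (Set.left_mem_Icc.2 (lo_lt_hi i).le)).1
      have h2 := (mobiusR_mem_Ioo hij (Set.right_mem_Icc.2 (lo_lt_hi i).le)).2
      filter_upwards [key _ (sub_pos.2 h1), key _ (sub_pos.2 h2)] with η h3 h4 _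
      constructor <;> linarith
    · exact Eventually.of_forall fun _ h => absurd h hij
  exact h.exists

variable (S) in
/-- A margin by which the images of the intervals stay away from the endpoints. -/
noncomputable def eta : ℝ := S.exists_eta.choose

theorem eta_pos : 0 < S.eta := S.exists_eta.choose_spec.1

theorem eta_lt (i : Fin (2 * S.r)) : S.eta < S.radius i := S.exists_eta.choose_spec.2.1 i

theorem eta_left {i j : Fin (2 * S.r)} (h : i ≠ wordBar j) :
    S.lo j + S.eta < mobiusR (S.g j) (S.lo i) := (S.exists_eta.choose_spec.2.2 i j h).1

theorem eta_right {i j : Fin (2 * S.r)} (h : i ≠ wordBar j) :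
    mobiusR (S.g j) (S.hi i) < S.hi j - S.eta := (S.exists_eta.choose_spec.2.2 i j h).2

variable (S) in
/-- The interval `I_a` shrunk by the margin. -/
def J (a : Fin (2 * S.r)) : Set ℝ := Set.Icc (S.lo a + S.eta) (S.hi a - S.eta)

theorem J_subset (a : Fin (2 * S.r)) : S.J a ⊆ Set.Icc (S.lo a) (S.hi a) := fun x hx =>
  ⟨by linarith [hx.1, S.eta_pos], by linarith [hx.2, S.eta_pos]⟩

theorem J_subset_Ioo (a : Fin (2 * S.r)) : S.J a ⊆ Set.Ioo (S.lo a) (S.hi a) := fun x hx =>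
  ⟨by linarith [hx.1, S.eta_pos], by linarith [hx.2, S.eta_pos]⟩

theorem center_mem_J (a : Fin (2 * S.r)) : S.center a ∈ S.J a := by
  have := S.eta_lt a
  constructor <;> simp only [lo, hi] <;> linarith

theorem mobiusR_mono {i j : Fin (2 * S.r)} (h : i ≠ wordBar j) {x y : ℝ}
    (hx : x ∈ Set.Icc (S.lo i) (S.hi i)) (hy : y ∈ Set.Icc (S.lo i) (S.hi i)) (hxy : x ≤ y) :
    mobiusR (S.g j) x ≤ mobiusR (S.g j) y := by
  rw [← sub_nonneg, mobiusR_sub (denomR_ne h hy) (denomR_ne h hx)]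
  exact div_nonneg (sub_nonneg.2 hxy) (denomR_mul_pos h hy hx).le

theorem mobiusR_mem_J {i j : Fin (2 * S.r)} (h : i ≠ wordBar j) {x : ℝ}
    (hx : x ∈ Set.Icc (S.lo i) (S.hi i)) : mobiusR (S.g j) x ∈ S.J j :=
  ⟨(eta_left h).le.trans (mobiusR_mono h (Set.left_mem_Icc.2 (lo_lt_hi i).le) hx hx.1),
    (mobiusR_mono h hx (Set.right_mem_Icc.2 (lo_lt_hi i).le) hx.2).trans (eta_right h).le⟩

theorem radius_add_lt {i j : Fin (2 * S.r)} (h : i ≠ j) :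
    S.radius i + S.radius j < |S.center i - S.center j| := by
  have h1 := disjoint_cD h
  rw [cD, cD, disjoint_closedBall_closedBall_iff (S.radius_pos i).le (S.radius_pos j).le,
    Complex.dist_eq, ← Complex.ofReal_sub, Complex.norm_real, Real.norm_eq_abs] at h1
  exact h1

theorem abs_sub_center_le {i : Fin (2 * S.r)} {x : ℝ} (hx : x ∈ Set.Icc (S.lo i) (S.hi i)) :
    |x - S.center i| ≤ S.radius i := by
  unfold lo hi at hx
  rw [abs_le]; constructor <;> linarith [hx.1, hx.2]

variable (S) in
theorem exists_bound : ∃ K : ℝ, 1 ≤ K ∧ S.eta⁻¹ ≤ K ∧ (∀ j, |(S.g j).1 1 0| ≤ K) ∧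
    ∀ i j, (∀ x ∈ Set.Icc (S.lo i) (S.hi i), i ≠ wordBar j →
        |denomR (S.g j) x| ≤ K ∧ |denomR (S.g j) x|⁻¹ ≤ K) ∧
      ∀ x ∈ Set.Icc (S.lo i) (S.hi i), ∀ y ∈ Set.Icc (S.lo j) (S.hi j),
        |x - y| ≤ K ∧ (i ≠ j → K⁻¹ ≤ |x - y|) := by
  have h : ∀ᶠ K : ℝ in atTop, 1 ≤ K ∧ S.eta⁻¹ ≤ K ∧ (∀ j, |(S.g j).1 1 0| ≤ K) ∧
    ∀ i j, (∀ x ∈ Set.Icc (S.lo i) (S.hi i), i ≠ wordBar j →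
        |denomR (S.g j) x| ≤ K ∧ |denomR (S.g j) x|⁻¹ ≤ K) ∧
      ∀ x ∈ Set.Icc (S.lo i) (S.hi i), ∀ y ∈ Set.Icc (S.lo j) (S.hi j),
        |x - y| ≤ K ∧ (i ≠ j → K⁻¹ ≤ |x - y|) := by
    refine (eventually_ge_atTop _).and ((eventually_ge_atTop _).and
      ((eventually_all.2 fun j => eventually_ge_atTop _).and
      (eventually_all.2 fun i => eventually_all.2 fun j => Eventually.and ?_ ?_)))
    · by_cases hij : i ≠ wordBar j
      · have hc : Continuous (denomR (S.g j)) := by unfold denomR; fun_prop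
        obtain ⟨C1, h1⟩ := (isCompact_Icc (a := S.lo i) (b := S.hi i)).exists_bound_of_continuousOn
          hc.continuousOn
        obtain ⟨C2, h2⟩ := (isCompact_Icc (a := S.lo i) (b := S.hi i)).exists_bound_of_continuousOn
          (hc.continuousOn.inv₀ fun x hx => denomR_ne hij hx)
        filter_upwards [eventually_ge_atTop C1, eventually_ge_atTop C2] with K h3 h4 x hx _
        refine ⟨(h1 x hx).trans h3, ?_⟩
        rw [← abs_inv]
        exact (h2 x hx).trans h4
      · exact Eventually.of_forall fun _ _ _ h => absurd h hij
    · by_cases hij : i ≠ j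
      · have hg := radius_add_lt hij
        filter_upwards [eventually_ge_atTop (|S.center i - S.center j| + S.radius i + S.radius j),
          eventually_ge_atTop (|S.center i - S.center j| - S.radius i - S.radius j)⁻¹] with
          K h1 h2 x hx y hy
        have hx' := abs_sub_center_le hx
        have hy' := abs_sub_center_le hy
        rw [abs_le] at hx' hy'
        constructor
        · have := abs_sub_comm x y
          have h3 := neg_abs_le (S.center i - S.center j)
          have h4 := le_abs_self (S.center i - S.center j)
          rw [abs_le]; constructor <;> linarith
        · intro _
          refine (inv_le_of_inv_le₀ (by linarith) h2).trans ?_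
          rcases abs_cases (S.center i - S.center j) with h | h <;>
            rcases abs_cases (x - y) with h' | h' <;> linarith
      · obtain rfl : i = j := not_not.1 hij
        filter_upwards [eventually_ge_atTop (2 * S.radius i)] with K h1 x hx y hy
        have hx' := abs_sub_center_le hx
        have hy' := abs_sub_center_le hy
        rw [abs_le] at hx' hy'
        refine ⟨?_, fun h => absurd rfl h⟩
        rw [abs_le]; constructor <;> linarith
  exact h.exists

variable (S) in
/-- A bound for the geometry of the Schottky data. -/
noncomputable def bound : ℝ := S.exists_bound.choose

theorem one_le_bound : 1 ≤ S.bound := S.exists_bound.choose_spec.1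

theorem eta_inv_le : S.eta⁻¹ ≤ S.bound := S.exists_bound.choose_spec.2.1

theorem abs_coeff_le (j : Fin (2 * S.r)) : |(S.g j).1 1 0| ≤ S.bound :=
  S.exists_bound.choose_spec.2.2.1 j

theorem denomR_bound {i j : Fin (2 * S.r)} (h : i ≠ wordBar j) {x : ℝ}
    (hx : x ∈ Set.Icc (S.lo i) (S.hi i)) :
    |denomR (S.g j) x| ≤ S.bound ∧ |denomR (S.g j) x|⁻¹ ≤ S.bound :=
  (S.exists_bound.choose_spec.2.2.2 i j).1 x hx h

theorem abs_sub_bound {i j : Fin (2 * S.r)} {x y : ℝ}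
    (hx : x ∈ Set.Icc (S.lo i) (S.hi i)) (hy : y ∈ Set.Icc (S.lo j) (S.hi j)) :
    |x - y| ≤ S.bound ∧ (i ≠ j → S.bound⁻¹ ≤ |x - y|) :=
  (S.exists_bound.choose_spec.2.2.2 i j).2 x hx y hy

theorem mobiusDerivR_eq (g : SL2) (x : ℝ) : mobiusDerivR g x = (denomR g x)⁻¹ ^ 2 := rfl

theorem sqrt_mobiusDerivR (g : SL2) (x : ℝ) : √(mobiusDerivR g x) = |denomR g x|⁻¹ := by
  rw [mobiusDerivR_eq, Real.sqrt_sq_eq_abs, abs_inv]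

variable (S) in
/-- The density whose inverse measures the harmonic distance to the endpoints. -/
noncomputable def omega (i : Fin (2 * S.r)) (x : ℝ) : ℝ := (x - S.lo i)⁻¹ + (S.hi i - x)⁻¹

theorem mobiusDerivR_mul_omega_le {i j : Fin (2 * S.r)} (h : i ≠ wordBar j) {x : ℝ}
    (hx : x ∈ Set.Ioo (S.lo i) (S.hi i)) :
    mobiusDerivR (S.g j) x * S.omega j (mobiusR (S.g j) x) ≤
      (1 - S.eta / S.bound) * S.omega i x := by
  have hK := lt_of_lt_of_le one_pos (S.one_le_bound)
  have hη := S.eta_pos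
  have hlo := Set.left_mem_Icc.2 (lo_lt_hi i).le
  have hhi := Set.right_mem_Icc.2 (lo_lt_hi i).le
  have hx' : x ∈ Set.Icc (S.lo i) (S.hi i) := ⟨hx.1.le, hx.2.le⟩
  have h1 := mobiusR_sub (denomR_ne h hx') (denomR_ne h hlo)
  have h2 := mobiusR_sub (denomR_ne h hhi) (denomR_ne h hx')
  have p1 := denomR_mul_pos h hx' hlo
  have p2 := denomR_mul_pos h hhi hx'
  have q0 := denomR_ne h hx'
  have qa := denomR_ne h hlo
  have qb := denomR_ne h hhi
  have e1 : denomR (S.g j) (S.lo i) =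
      denomR (S.g j) x - (S.g j).1 1 0 * (x - S.lo i) := by unfold denomR; ring
  have e2 : denomR (S.g j) (S.hi i) =
      denomR (S.g j) x + (S.g j).1 1 0 * (S.hi i - x) := by unfold denomR; ring
  have ha := sub_pos.2 hx.1
  have hb := sub_pos.2 hx.2
  have hya : 0 < mobiusR (S.g j) x - mobiusR (S.g j) (S.lo i) := h1 ▸ div_pos ha p1
  have hyb : 0 < mobiusR (S.g j) (S.hi i) - mobiusR (S.g j) x := h2 ▸ div_pos hb p2
  have m := mobiusR_mem_Ioo h hx'
  have ml := S.eta_left h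
  have mr := S.eta_right h
  have hlen := (le_abs_self _).trans (abs_sub_bound (Set.right_mem_Icc.2 (lo_lt_hi j).le)
    (Set.left_mem_Icc.2 (lo_lt_hi j).le)).1
  have hth : 0 < 1 - S.eta / S.bound := by
    rw [sub_pos, div_lt_one hK]; linarith [m.1, m.2]
  have aux : ∀ t s : ℝ, 0 < s → s ≤ t - S.eta → t ≤ S.bound →
      t⁻¹ ≤ (1 - S.eta / S.bound) * s⁻¹ := by
    intro t s hs hst ht
    have ht0 : 0 < t := by linarith
    rw [← div_eq_mul_inv, inv_eq_one_div, div_le_div_iff₀ ht0 hs]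
    have : S.eta / S.bound * t ≤ S.eta := by
      rw [div_mul_eq_mul_div, div_le_iff₀ hK]; exact mul_le_mul_of_nonneg_left ht hη.le
    linarith
  have b1 := aux (mobiusR (S.g j) x - S.lo j) _ hya (by linarith) (by linarith [m.2])
  have b2 := aux (S.hi j - mobiusR (S.g j) x) _ hyb (by linarith) (by linarith [m.1])
  have hd : 0 ≤ mobiusDerivR (S.g j) x := by rw [mobiusDerivR_eq]; positivity
  have key : mobiusDerivR (S.g j) x * ((mobiusR (S.g j) x - mobiusR (S.g j) (S.lo i))⁻¹ +
      (mobiusR (S.g j) (S.hi i) - mobiusR (S.g j) x)⁻¹) = S.omega i x := by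
    rw [h1, h2, mobiusDerivR_eq, omega, inv_div, inv_div, e1, e2]
    field_simp
    ring
  calc _ ≤ mobiusDerivR (S.g j) x * ((1 - S.eta / S.bound) *
        (mobiusR (S.g j) x - mobiusR (S.g j) (S.lo i))⁻¹ + (1 - S.eta / S.bound) *
        (mobiusR (S.g j) (S.hi i) - mobiusR (S.g j) x)⁻¹) :=
        mul_le_mul_of_nonneg_left (add_le_add b1 b2) hd
    _ = (1 - S.eta / S.bound) * (mobiusDerivR (S.g j) x *
        ((mobiusR (S.g j) x - mobiusR (S.g j) (S.lo i))⁻¹ +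
        (mobiusR (S.g j) (S.hi i) - mobiusR (S.g j) x)⁻¹)) := by ring
    _ = _ := by rw [key]

theorem exists_ne (x y z : Fin (2 * S.r)) : ∃ l, l ≠ x ∧ l ≠ y ∧ l ≠ z := by
  by_contra! h
  have hsub : (Finset.univ : Finset (Fin (2 * S.r))) ⊆ {x, y, z} := by
    intro l _
    simp only [Finset.mem_insert, Finset.mem_singleton]
    by_contra! h'
    exact h'.2.2 (h l h'.1 h'.2.1)
  have h1 := (Finset.card_le_card hsub).trans Finset.card_le_three
  rw [Finset.card_univ, Fintype.card_fin] at h1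
  have := S.two_le_r
  omega

theorem eq_wordBar_comm {a b : Fin (2 * S.r)} : a = wordBar b ↔ b = wordBar a := by
  constructor <;> rintro rfl <;> rw [wordBar_wordBar]

theorem eta_lt_bound : S.eta < S.bound := by
  have hr := S.two_le_r
  let j : Fin (2 * S.r) := ⟨0, by omega⟩
  have := (abs_sub_bound (S := S) (Set.right_mem_Icc.2 (lo_lt_hi j).le)
    (Set.left_mem_Icc.2 (lo_lt_hi j).le)).1
  have h2 := (le_abs_self _).trans this
  have h3 := S.eta_lt j
  have h4 := S.radius_pos j
  unfold lo hi at h2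
  linarith

variable (S) in
/-- The points of the shrunk intervals, with their labels. -/
abbrev Pt : Type := {p : Fin (2 * S.r) × ℝ // p.2 ∈ S.J p.1}

variable (S) in
open Classical in
/-- The inverse branches of the Bowen–Series map, with junk value the centre. -/
noncomputable def stepPt (j : Fin (2 * S.r)) (x : S.Pt) : S.Pt :=
  if h : x.1.1 ≠ wordBar j then ⟨(j, mobiusR (S.g j) x.1.2), mobiusR_mem_J h (J_subset _ x.2)⟩
  else ⟨(j, S.center j), center_mem_J j⟩

theorem stepPt_eq {j : Fin (2 * S.r)} {x : S.Pt} (h : x.1.1 ≠ wordBar j) :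
    (S.stepPt j x).1 = (j, mobiusR (S.g j) x.1.2) := by
  rw [stepPt, dif_pos h]

variable (S) in
/-- The branch system of the Schottky data. -/
noncomputable def branch : BranchSystem where
  A := Fin (2 * S.r)
  X := S.Pt
  bar := wordBar
  lab x := x.1.1
  pos x := x.1.2
  step := S.stepPt
  d j x := mobiusDerivR (S.g j) x.1.2
  om x := S.omega x.1.1 x.1.2
  C := 2 * S.bound ^ 2
  th := 1 - S.eta / S.bound
  one_le_C := by nlinarith [S.one_le_bound]
  th_pos := by
    rw [sub_pos, div_lt_one (lt_of_lt_of_le one_pos S.one_le_bound)]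
    exact S.eta_lt_bound
  th_lt := by
    have := div_pos S.eta_pos (lt_of_lt_of_le one_pos S.one_le_bound)
    linarith
  inj x y h1 h2 := Subtype.ext (Prod.ext h1 h2)
  lab_step j x h := by rw [stepPt_eq h]
  d_lb j x h := by
    have hK := S.one_le_bound
    have h0 := denomR_ne h (J_subset _ x.2)
    obtain ⟨h1, h2⟩ := denomR_bound h (J_subset _ x.2)
    rw [mobiusDerivR_eq, inv_pow, ← sq_abs (denomR _ _)]
    have h3 := pow_le_pow_left₀ (abs_nonneg _) h1 2
    exact inv_anti₀ (pow_pos (abs_pos.2 h0) 2) (by nlinarith)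
  d_ub j x h := by
    have hK := S.one_le_bound
    obtain ⟨h1, h2⟩ := denomR_bound h (J_subset _ x.2)
    rw [mobiusDerivR_eq, ← sq_abs, abs_inv]
    have h3 := pow_le_pow_left₀ (by positivity) h2 2
    nlinarith
  om_lb x := by
    have hK := S.one_le_bound
    obtain ⟨h1, h2⟩ := J_subset_Ioo _ x.2
    have h3 := (le_abs_self _).trans (abs_sub_bound (J_subset _ x.2)
      (Set.left_mem_Icc.2 (lo_lt_hi x.1.1).le)).1
    have h4 : 0 < (S.hi x.1.1 - x.1.2)⁻¹ := inv_pos.2 (sub_pos.2 h2)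
    have h5 : (2 * S.bound ^ 2)⁻¹ ≤ (x.1.2 - S.lo x.1.1)⁻¹ :=
      inv_anti₀ (sub_pos.2 h1) (by nlinarith)
    unfold omega
    linarith
  om_ub x := by
    have hK := S.one_le_bound
    have hη := S.eta_pos
    obtain ⟨h1, h2⟩ := x.2
    have h3 := S.eta_inv_le
    have h4 : (x.1.2 - S.lo x.1.1)⁻¹ ≤ S.eta⁻¹ := inv_anti₀ hη (by linarith)
    have h5 : (S.hi x.1.1 - x.1.2)⁻¹ ≤ S.eta⁻¹ := inv_anti₀ hη (by linarith)
    unfold omega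
    nlinarith
  mob j x y hx hy := by
    rw [stepPt_eq hx, stepPt_eq hy]
    dsimp only
    rw [mobiusR_sub (denomR_ne hx (J_subset _ x.2)) (denomR_ne hy (J_subset _ y.2)),
      sqrt_mobiusDerivR, sqrt_mobiusDerivR, abs_div, abs_mul, ← mul_inv, div_eq_inv_mul]
  contr j x h := by
    rw [stepPt_eq h]
    exact mobiusDerivR_mul_omega_le h (J_subset_Ioo _ x.2)
  dlip j x y hl h := by
    have hK := S.one_le_bound
    have hy : y.1.1 ≠ wordBar j := hl ▸ h
    have h0 := abs_pos.2 (denomR_ne h (J_subset _ x.2))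
    have h0' := abs_pos.2 (denomR_ne hy (J_subset _ y.2))
    obtain ⟨-, h2⟩ := denomR_bound h (J_subset _ x.2)
    obtain ⟨-, h2'⟩ := denomR_bound hy (J_subset _ y.2)
    have hu := S.abs_coeff_le j
    have hle : ∀ a b : ℝ, 0 < |a| → 0 < |b| → |b|⁻¹ ≤ S.bound →
        Real.log |a| - Real.log |b| ≤ S.bound * |a - b| := by
      intro a b ha hb hbK
      rw [← Real.log_div ha.ne' hb.ne']
      refine (Real.log_le_sub_one_of_pos (div_pos ha hb)).trans ?_
      have h1 := abs_sub_abs_le_abs_sub a b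
      have h2 : |a| / |b| - 1 = |b|⁻¹ * (|a| - |b|) := by field_simp
      rw [h2]
      exact (mul_le_mul_of_nonneg_left h1 (inv_pos.2 hb).le).trans
        (mul_le_mul_of_nonneg_right hbK (abs_nonneg _))
    have e : ∀ z : ℝ, Real.log (mobiusDerivR (S.g j) z) =
        -2 * Real.log |denomR (S.g j) z| := by
      intro z
      rw [mobiusDerivR_eq, Real.log_pow, Real.log_inv, Real.log_abs]
      push_cast; ring
    have e2 : |denomR (S.g j) x.1.2 - denomR (S.g j) y.1.2| ≤
        S.bound * |x.1.2 - y.1.2| := by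
      have : denomR (S.g j) x.1.2 - denomR (S.g j) y.1.2 =
        (S.g j).1 1 0 * (x.1.2 - y.1.2) := by unfold denomR; ring
      rw [this, abs_mul]
      exact mul_le_mul_of_nonneg_right hu (abs_nonneg _)
    have h3 := hle _ _ h0 h0' h2'
    have h4 := hle _ _ h0' h0 h2
    rw [abs_sub_comm] at h4
    have h5 := mul_le_mul_of_nonneg_left e2 (zero_le_one.trans hK)
    rw [e, e, abs_le]
    constructor <;> nlinarith
  pos_bdd x y := by
    have hK := S.one_le_bound
    have := (abs_sub_bound (J_subset _ x.2) (J_subset _ y.2)).1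
    nlinarith
  sep x y h := by
    have hK := S.one_le_bound
    exact (inv_anti₀ (by linarith) (by nlinarith)).trans
      ((abs_sub_bound (J_subset _ x.2) (J_subset _ y.2)).2 h)
  mix a b := by
    obtain ⟨l, h1, h2, -⟩ := S.exists_ne (wordBar a) (wordBar b) a
    exact ⟨l, fun h => h1 (eq_wordBar_comm.1 h), h2⟩
  two j := by
    obtain ⟨a, h1, -⟩ := S.exists_ne (wordBar j) j j
    obtain ⟨b, h2, h3, -⟩ := S.exists_ne a (wordBar j) j
    exact ⟨a, b, h2.symm, h1, h3⟩
  surj a := ⟨⟨(a, S.center a), center_mem_J a⟩, rfl⟩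

end Schottky

namespace Schottky

variable {S : Schottky}

variable (S) in
/-- Apply the generators of a word one after the other on `ℂ`, starting from the head. -/
noncomputable def actC : List (Fin (2 * S.r)) → ℂ → ℂ
  | [], z => z
  | j :: u, z => actC u (mobiusC (S.g j) z)

theorem coeff_ne_zero (j : Fin (2 * S.r)) : (S.g j).1 1 0 ≠ 0 := by
  intro h0
  have h := (mobiusS_mem_cD_iff (a := j) (z := OnePoint.infty)).2 (by
    rintro ⟨w, -, hw⟩
    exact OnePoint.coe_ne_infty w hw)
  rw [mobiusS_infty_of_eq h0] at h
  obtain ⟨w, -, hw⟩ := h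
  exact OnePoint.coe_ne_infty w hw

theorem mobiusC_mem_D_of_mem_cD {i j : Fin (2 * S.r)} (h : i ≠ wordBar j) {z : ℂ}
    (hz : z ∈ S.cD i) : mobiusC (S.g j) z ∈ S.D j :=
  mobiusC_mem_D (notMem_cD h hz)

theorem denomC_ne_of_mem_cD {i j : Fin (2 * S.r)} (h : i ≠ wordBar j) {z : ℂ}
    (hz : z ∈ S.cD i) : denomC (S.g j) z ≠ 0 :=
  denomC_ne fun h' => notMem_cD h hz (D_subset_cD _ h')

theorem exp_log_mobiusDerivR {i j : Fin (2 * S.r)} (h : i ≠ wordBar j) {x : ℝ}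
    (hx : x ∈ Set.Icc (S.lo i) (S.hi i)) :
    Real.exp (Real.log (mobiusDerivR (S.g j) x)) = (denomR (S.g j) x ^ 2)⁻¹ := by
  have h0 := denomR_ne h hx
  rw [mobiusDerivR_eq, Real.exp_log (by positivity), inv_pow]

theorem norm_mobiusC_sub_ofReal {j : Fin (2 * S.r)} {z : ℂ} {x : ℝ}
    (hz : denomC (S.g j) z ≠ 0) (hx : denomR (S.g j) x ≠ 0) :
    ‖mobiusC (S.g j) z - (mobiusR (S.g j) x : ℂ)‖ =
      ‖z - x‖ / (‖denomC (S.g j) z‖ * |denomR (S.g j) x|) := by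
  have hx' : denomC (S.g j) x ≠ 0 := by rw [denomC_ofReal]; exact_mod_cast hx
  rw [← mobiusC_ofReal, mobiusC_sub hz hx', norm_div, norm_mul, denomC_ofReal,
    Complex.norm_real, Real.norm_eq_abs]

/-- The derivative of a nonempty word is `k / (x - p) ^ 2` with a pole `p` in the disc opposite to
the head of the word. -/
theorem exists_pole (u : List (Fin (2 * S.r))) : ∀ a j : Fin (2 * S.r),
    S.branch.Adm a (j :: u) → ∃ p k : ℝ, 0 < k ∧ p ∈ Set.Ioo (S.lo (wordBar j)) (S.hi (wordBar j)) ∧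
      ∀ x : S.Pt, x.1.1 = a →
        Real.exp (S.branch.tau (j :: u) x) = k / (x.1.2 - p) ^ 2 ∧
        ∀ z ∈ S.cD a, ‖S.actC (j :: u) z - ((S.branch.act (j :: u) x).1.2 : ℂ)‖ *
          (‖z - p‖ * |x.1.2 - p|) = k * ‖z - x.1.2‖ := by
  induction u with
  | nil =>
    intro a j hadm
    have haj : a ≠ wordBar j := hadm.1
    have hu := coeff_ne_zero j
    have hu' : (((S.g j).1 1 0 : ℝ) : ℂ) ≠ 0 := by exact_mod_cast hu
    obtain ⟨p, hp⟩ : ∃ p, p = -((S.g j).1 1 1 / (S.g j).1 1 0) := ⟨_, rfl⟩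
    have e : ∀ x : ℝ, denomR (S.g j) x = (S.g j).1 1 0 * (x - p) := by
      intro x; rw [hp]; unfold denomR; field_simp; ring
    have eC : ∀ z : ℂ, denomC (S.g j) z = (S.g j).1 1 0 * (z - p) := by
      intro x; rw [hp]; unfold denomC; push_cast; field_simp; ring
    refine ⟨p, ((S.g j).1 1 0 ^ 2)⁻¹, by positivity, ?_, ?_⟩
    · rw [← mem_D_ofReal]
      by_contra hp
      have := denomC_ne hp
      rw [eC] at this
      simp at this
    · rintro x rfl
      have hx := J_subset _ x.2
      have h0 := denomR_ne haj hx
      refine ⟨?_, fun z hz => ?_⟩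
      · change Real.exp (Real.log (mobiusDerivR (S.g j) x.1.2) + 0) = _
        rw [add_zero, exp_log_mobiusDerivR haj hx, e, mul_pow, mul_inv, ← div_eq_mul_inv]
      · have hz0 := denomC_ne_of_mem_cD haj hz
        change ‖mobiusC (S.g j) z - ((S.stepPt j x).1.2 : ℂ)‖ * _ = _
        rw [stepPt_eq haj, norm_mobiusC_sub_ofReal hz0 h0]
        rw [eC] at hz0 ⊢
        rw [e] at h0 ⊢
        rw [norm_mul, abs_mul, Complex.norm_real, Real.norm_eq_abs]
        have h1 := norm_ne_zero_iff.2 (right_ne_zero_of_mul hz0)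
        have h2 := abs_ne_zero.2 (right_ne_zero_of_mul h0)
        have h3 := abs_ne_zero.2 hu
        rw [← sq_abs ((S.g j).1 1 0)]
        field_simp
  | cons l u ih =>
    intro a j hadm
    have haj : a ≠ wordBar j := hadm.1
    obtain ⟨p', k', hk', hp', H⟩ := ih j l hadm.2
    have hjl : j ≠ wordBar l := hadm.2.1
    have hpD : (p' : ℂ) ∉ S.cD j :=
      notMem_cD hjl.symm (D_subset_cD _ (mem_D_ofReal.2 hp'))
    have hpm : mobiusC (S.g (wordBar j)) p' ∈ S.D (wordBar j) :=
      mobiusC_mem_D (by rwa [wordBar_wordBar])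
    obtain ⟨hq, hγ⟩ := exists_eq_mobiusC (a := j) (z := p') fun h => hpD (D_subset_cD _ h)
    rw [mobiusC_ofReal] at hpm hq hγ
    set p := mobiusR (S.g (wordBar j)) p' with hp
    have hq' : denomR (S.g j) p ≠ 0 := by
      rw [denomC_ofReal] at hq; exact_mod_cast hq
    have hγ' : mobiusR (S.g j) p = p' := by
      rw [mobiusC_ofReal] at hγ; exact_mod_cast hγ
    refine ⟨p, k' * denomR (S.g j) p ^ 2, by positivity, mem_D_ofReal.1 hpm, ?_⟩
    rintro x rfl
    have hx := J_subset _ x.2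
    have h0 := denomR_ne haj hx
    have hst := stepPt_eq haj
    obtain ⟨H1, H2⟩ := H (S.stepPt j x) (by rw [hst])
    have hyp : mobiusR (S.g j) x.1.2 - p' =
        (x.1.2 - p) / (denomR (S.g j) x.1.2 * denomR (S.g j) p) := by
      rw [← mobiusR_sub h0 hq', hγ']
    have hxp : x.1.2 - p ≠ 0 := by
      intro h
      refine notMem_cD haj (mem_cD_ofReal.2 hx) (D_subset_cD _ ?_)
      rw [sub_eq_zero.1 h]; exact hpm
    rw [hst] at H1 H2
    dsimp only at H1 H2
    refine ⟨?_, fun z hz => ?_⟩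
    · change Real.exp (Real.log (mobiusDerivR (S.g j) x.1.2) +
        S.branch.tau (l :: u) (S.stepPt j x)) = _
      rw [Real.exp_add, H1, exp_log_mobiusDerivR haj hx, hyp]
      field_simp
    · have hz0 := denomC_ne_of_mem_cD haj hz
      have h4 := H2 _ (D_subset_cD _ (mobiusC_mem_D_of_mem_cD haj hz))
      change ‖S.actC (l :: u) (mobiusC (S.g j) z) -
        ((S.branch.act (l :: u) (S.stepPt j x)).1.2 : ℂ)‖ * _ = _
      have h5 : ‖mobiusC (S.g j) z - (p' : ℂ)‖ = _ := hγ' ▸ norm_mobiusC_sub_ofReal hz0 hq'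
      rw [h5, norm_mobiusC_sub_ofReal hz0 h0, hyp, abs_div, abs_mul] at h4
      have h1 := norm_ne_zero_iff.2 hz0
      have h2 := abs_ne_zero.2 h0
      have h3 := abs_ne_zero.2 hq'
      rw [← sq_abs (denomR (S.g j) p)]
      field_simp at h4
      linear_combination h4

theorem exists_adm (n : ℕ) : ∀ a : Fin (2 * S.r), ∃ u : List (Fin (2 * S.r)), u.length = n ∧
    S.branch.Adm a u := by
  induction n with
  | zero => exact fun a => ⟨[], rfl, trivial⟩
  | succ n ih =>
    intro a
    obtain ⟨l, hl, -⟩ := S.branch.mix a a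
    obtain ⟨u, hu, hadm⟩ := ih l
    exact ⟨l :: u, congrArg Nat.succ hu, hl, hadm⟩

theorem abs_sub_le_mul_abs_log_sub {a b M : ℝ} (ha : 0 < a) (hb : 0 < b) (haM : a ≤ M)
    (hbM : b ≤ M) : |a - b| ≤ M * |Real.log a - Real.log b| := by
  have key : ∀ x y : ℝ, 0 < x → 0 < y → x ≤ y → y ≤ M →
      |x - y| ≤ M * |Real.log x - Real.log y| := by
    intro x y hx hy hxy hyM
    have h1 := Real.log_le_sub_one_of_pos (div_pos hx hy)
    rw [Real.log_div hx.ne' hy.ne'] at h1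
    have h2 : y * (x / y - 1) = x - y := by field_simp
    rw [abs_of_nonpos (sub_nonpos.2 hxy), abs_of_nonpos (sub_nonpos.2 (Real.log_le_log hx hxy))]
    have h3 := mul_le_mul_of_nonneg_left h1 hy.le
    have h4 := mul_le_mul_of_nonneg_right hyM
      (neg_nonneg.2 (sub_nonpos.2 (Real.log_le_log hx hxy)))
    linarith
  rcases le_total a b with h | h
  · exact key a b ha hb h hbM
  · rw [abs_sub_comm, abs_sub_comm (Real.log a)]
    exact key b a hb ha h haM

theorem sub_mul_sub_pos {i j : Fin (2 * S.r)} (h : i ≠ j) {x y p : ℝ}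
    (hx : x ∈ Set.Icc (S.lo i) (S.hi i)) (hy : y ∈ Set.Icc (S.lo i) (S.hi i))
    (hp : p ∈ Set.Ioo (S.lo j) (S.hi j)) : 0 < (x - p) * (y - p) := by
  have hpi : p ∉ Set.Icc (S.lo i) (S.hi i) := fun h' =>
    notMem_cD h (mem_cD_ofReal.2 h') (D_subset_cD _ (mem_D_ofReal.2 hp))
  rw [Set.mem_Icc, not_and_or, not_le, not_le] at hpi
  rcases hpi with h' | h'
  · exact mul_pos (by linarith [hx.1]) (by linarith [hy.1])
  · exact mul_pos_of_neg_of_neg (by linarith [hx.2]) (by linarith [hy.2])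

theorem tau_eq_of_exp {k q τ : ℝ} (hk : 0 < k) (hq : q ≠ 0) (h : Real.exp τ = k / q ^ 2) :
    τ = Real.log k - 2 * Real.log |q| := by
  rw [← Real.log_exp τ, h, Real.log_div hk.ne' (pow_ne_zero 2 hq), Real.log_pow, Real.log_abs]
  push_cast
  ring

variable (S) in
/-- The phases of words with different heads are not linearly related. -/
theorem nonlocal_integrability (a : S.branch.A) (n : ℕ) (hn : 0 < n) :
    ∃ w w' : List S.branch.A, w.length = n ∧ w'.length = n ∧ S.branch.Adm a w ∧
      S.branch.Adm a w' ∧ ∀ x y, S.branch.lab x = a → S.branch.lab y = a →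
        (S.bound ^ 3)⁻¹ * |S.branch.pos x - S.branch.pos y| ≤
          |(S.branch.tau w x - S.branch.tau w y) -
            (S.branch.tau w' x - S.branch.tau w' y)| := by
  obtain ⟨m, rfl⟩ := Nat.exists_eq_succ_of_ne_zero hn.ne'
  obtain ⟨b, b', hbb, hb, hb'⟩ := S.branch.two a
  change b ≠ wordBar a at hb
  change b' ≠ wordBar a at hb'
  have hab : a ≠ wordBar b := fun h => hb (eq_wordBar_comm.1 h)
  have hab' : a ≠ wordBar b' := fun h => hb' (eq_wordBar_comm.1 h)
  obtain ⟨u, hu, hadm⟩ := S.exists_adm m b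
  obtain ⟨u', hu', hadm'⟩ := S.exists_adm m b'
  have h1 : S.branch.Adm a (b :: u) := ⟨hab, hadm⟩
  have h2 : S.branch.Adm a (b' :: u') := ⟨hab', hadm'⟩
  obtain ⟨p, k, hk, hp, H⟩ := exists_pole u a b h1
  obtain ⟨p', k', hk', hp', H'⟩ := exists_pole u' a b' h2
  refine ⟨b :: u, b' :: u', congrArg Nat.succ hu, congrArg Nat.succ hu', h1, h2,
    ?_⟩
  intro x y hx hy
  change x.1.1 = a at hx
  change y.1.1 = a at hy
  have hxJ : x.1.2 ∈ Set.Icc (S.lo a) (S.hi a) := hx ▸ J_subset _ x.2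
  have hyJ : y.1.2 ∈ Set.Icc (S.lo a) (S.hi a) := hy ▸ J_subset _ y.2
  have s1 := sub_mul_sub_pos hab hxJ hyJ hp
  have s2 := sub_mul_sub_pos hab' hxJ hyJ hp'
  have n1 := left_ne_zero_of_mul s1.ne'
  have n2 := right_ne_zero_of_mul s1.ne'
  have n3 := left_ne_zero_of_mul s2.ne'
  have n4 := right_ne_zero_of_mul s2.ne'
  rw [tau_eq_of_exp hk n1 (H x hx).1, tau_eq_of_exp hk n2 (H y hy).1,
    tau_eq_of_exp hk' n3 (H' x hx).1, tau_eq_of_exp hk' n4 (H' y hy).1]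
  have hK := S.one_le_bound
  have hK0 : 0 < S.bound := by linarith
  have pI := Set.Ioo_subset_Icc_self hp
  have pI' := Set.Ioo_subset_Icc_self hp'
  have hpp := (abs_sub_bound pI pI').2 fun h => hbb (by
    rw [← wordBar_wordBar b, ← wordBar_wordBar b']; exact congrArg wordBar h)
  change (S.bound ^ 3)⁻¹ * |x.1.2 - y.1.2| ≤ _
  set x' := x.1.2
  set y' := y.1.2
  have m1 : |y' - p| * |x' - p'| ≤ S.bound ^ 2 := by
    rw [sq]
    exact mul_le_mul (abs_sub_bound hyJ pI).1 (abs_sub_bound hxJ pI').1 (abs_nonneg _) hK0.le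
  have m2 : |x' - p| * |y' - p'| ≤ S.bound ^ 2 := by
    rw [sq]
    exact mul_le_mul (abs_sub_bound hxJ pI).1 (abs_sub_bound hyJ pI').1 (abs_nonneg _) hK0.le
  have a1 := abs_pos.2 n1
  have a2 := abs_pos.2 n2
  have a3 := abs_pos.2 n3
  have a4 := abs_pos.2 n4
  have hl := abs_sub_le_mul_abs_log_sub (mul_pos a2 a3) (mul_pos a1 a4) m1 m2
  have e1 : |(|y' - p| * |x' - p'| - |x' - p| * |y' - p'|)| = |x' - y'| * |p - p'| := by
    have hs : 0 < ((y' - p) * (x' - p')) * ((x' - p) * (y' - p')) := by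
      calc 0 < ((x' - p) * (y' - p)) * ((x' - p') * (y' - p')) := mul_pos s1 s2
        _ = _ := by ring
    rw [← abs_mul, ← abs_mul, ← abs_mul]
    have e2 : (x' - y') * (p - p') = (x' - p) * (y' - p') - (y' - p) * (x' - p') := by ring
    rw [e2, abs_sub_comm]
    rcases pos_and_pos_or_neg_and_neg_of_mul_pos hs with ⟨h, h'⟩ | ⟨h, h'⟩
    · rw [abs_of_pos h, abs_of_pos h']
    · rw [abs_of_neg h, abs_of_neg h', abs_sub_comm]
      congr 1; ring
  rw [e1, Real.log_mul a2.ne' a3.ne', Real.log_mul a1.ne' a4.ne'] at hl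
  set L := Real.log |y' - p| + Real.log |x' - p'| - (Real.log |x' - p| + Real.log |y' - p'|)
    with hL
  have e3 : Real.log k - 2 * Real.log |x' - p| - (Real.log k - 2 * Real.log |y' - p|) -
      (Real.log k' - 2 * Real.log |x' - p'| - (Real.log k' - 2 * Real.log |y' - p'|)) =
      2 * L := by rw [hL]; ring
  rw [e3, abs_mul, abs_two]
  have h5 := mul_le_mul_of_nonneg_left hpp (abs_nonneg (x' - y'))
  have h6 : |x' - y'| * S.bound⁻¹ ≤ S.bound ^ 2 * |L| := h5.trans hl
  rw [mul_inv_le_iff₀ hK0] at h6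
  rw [inv_mul_le_iff₀ (pow_pos hK0 3)]
  have h7 : 0 ≤ S.bound ^ 3 * |L| := by positivity
  linarith

end Schottky

namespace Schottky

open Filter Topology
open scoped NNReal ENNReal

variable {S : Schottky}

theorem TS_of_mem {a : Fin (2 * S.r)} {z : ℂ} (hz : z ∈ S.D a) :
    S.TS (z : OnePoint ℂ) = mobiusS (S.g a)⁻¹ z := by
  have h : ∃ a : Fin (2 * S.r), ∃ w : ℂ, (z : OnePoint ℂ) = (w : OnePoint ℂ) ∧ w ∈ S.D a :=
    ⟨a, z, rfl, hz⟩
  rw [TS, dif_pos h]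
  obtain ⟨w, hw, hwD⟩ := h.choose_spec
  rw [OnePoint.coe_eq_coe] at hw
  have : h.choose = a := by
    by_contra hne
    exact notMem_cD hne (D_subset_cD _ hwD) (hw ▸ D_subset_cD _ hz)
  rw [this]

theorem pt_mem_D (x : S.Pt) : (x.1.2 : ℂ) ∈ S.D x.1.1 := mem_D_ofReal.2 (J_subset_Ioo _ x.2)

theorem TS_stepPt {j : Fin (2 * S.r)} {x : S.Pt} (h : x.1.1 ≠ wordBar j) :
    S.TS (((S.stepPt j x).1.2 : ℂ) : OnePoint ℂ) = ((x.1.2 : ℂ) : OnePoint ℂ) := by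
  have h1 := pt_mem_D (S.stepPt j x)
  have h0 : denomC (S.g j) (x.1.2 : ℂ) ≠ 0 :=
    denomC_ne_of_mem_cD h (D_subset_cD _ (pt_mem_D x))
  rw [stepPt_eq h] at h1 ⊢
  rw [TS_of_mem h1]
  dsimp only
  rw [← mobiusC_ofReal, ← mobiusS_coe_of_ne h0, mobiusS_inv_mobiusS]

theorem iterate_TS_act (w : List (Fin (2 * S.r))) : ∀ x : S.Pt, S.branch.Adm x.1.1 w →
    S.TS^[w.length] (((S.branch.act w x).1.2 : ℂ) : OnePoint ℂ) =
      ((x.1.2 : ℂ) : OnePoint ℂ) := by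
  induction w with
  | nil => exact fun x _ => rfl
  | cons j u ih =>
    intro x h
    have hj : x.1.1 ≠ wordBar j := h.1
    rw [List.length_cons, Function.iterate_succ_apply']
    have h2 := ih (S.stepPt j x) (by rw [stepPt_eq hj]; exact h.2)
    change S.TS (S.TS^[u.length] (((S.branch.act u (S.stepPt j x)).1.2 : ℂ) : OnePoint ℂ)) = _
    rw [h2, TS_stepPt hj]

theorem mem_limitSet_of_forall_act {z : ℝ} (h : ∀ n : ℕ, ∃ (w : List S.branch.A) (y : S.branch.X),
    n ≤ w.length ∧ S.branch.Adm (S.branch.lab y) w ∧ S.branch.pos (S.branch.act w y) = z) :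
    (z : ℂ) ∈ S.limitSet := by
  intro n
  obtain ⟨w, y, hn, hadm, rfl⟩ := h n
  rw [← List.take_append_drop (w.length - n) w] at hadm ⊢
  rw [BranchSystem.act_append]
  have h2 := hadm.of_append.2
  have hl : (w.drop (w.length - n)).length = n := by rw [List.length_drop]; omega
  have h3 := iterate_TS_act _ _ h2
  exact ⟨_, (congrArg (fun m => S.TS^[m] _) hl.symm).trans h3, Set.mem_iUnion.2 ⟨_, pt_mem_D _⟩⟩

theorem exists_actC_of_mem_limitSet {z : ℂ} (hz : z ∈ S.limitSet) (n : ℕ) :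
    ∃ (w : List (Fin (2 * S.r))) (a : Fin (2 * S.r)) (ζ : ℂ), w.length = n ∧
      S.branch.Adm a w ∧ ζ ∈ S.D a ∧ S.TS^[n] (z : OnePoint ℂ) = (ζ : OnePoint ℂ) ∧
      S.actC w ζ = z := by
  induction n with
  | zero =>
    obtain ⟨w, hw, hwD⟩ := hz 0
    obtain ⟨a, ha⟩ := Set.mem_iUnion.1 hwD
    have : z = w := OnePoint.coe_eq_coe.1 hw
    exact ⟨[], a, z, rfl, trivial, this ▸ ha, rfl, rfl⟩
  | succ n ih =>
    obtain ⟨w, a, ζ, hl, hadm, hζ, hT, hact⟩ := ih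
    obtain ⟨ζ', hζ', hD⟩ := hz (n + 1)
    obtain ⟨b, hb⟩ := Set.mem_iUnion.1 hD
    have h1 := hζ'
    rw [Function.iterate_succ_apply', hT, TS_of_mem hζ] at h1
    have h2 := mobiusS_inv_mobiusS (S.g a)⁻¹ (ζ : OnePoint ℂ)
    rw [h1, inv_inv] at h2
    have h3 : denomC (S.g a) ζ' ≠ 0 := by
      intro h0
      rw [mobiusS_coe_of_eq h0] at h2
      exact OnePoint.coe_ne_infty _ h2.symm
    have h4 := h2
    rw [mobiusS_coe_of_ne h3, OnePoint.coe_eq_coe] at h4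
    have hba : b ≠ wordBar a := by
      rintro rfl
      have h5 := (mobiusS_mem_D_iff (a := a) (z := (ζ' : OnePoint ℂ))).1
        (h2 ▸ Set.mem_image_of_mem _ hζ)
      exact h5 (Set.mem_image_of_mem _ (D_subset_cD _ hb))
    refine ⟨a :: w, b, ζ', by rw [List.length_cons, hl], ⟨hba, hadm⟩, hb, hζ', ?_⟩
    rw [actC, h4, hact]

theorem bound_inv_le_norm_sub {a b : Fin (2 * S.r)} (h : a ≠ b) {z w : ℂ} (hz : z ∈ S.cD a)
    (hw : w ∈ S.cD b) : S.bound⁻¹ ≤ ‖z - w‖ := by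
  have hg := radius_add_lt h
  have hgap : S.bound⁻¹ ≤ |S.center a - S.center b| - S.radius a - S.radius b := by
    rcases le_total (S.center a) (S.center b) with hc | hc
    · have h1 := (abs_sub_bound (Set.right_mem_Icc.2 (lo_lt_hi a).le)
        (Set.left_mem_Icc.2 (lo_lt_hi b).le)).2 h
      rw [abs_of_nonpos (sub_nonpos.2 hc)] at hg ⊢
      unfold lo hi at h1
      rw [abs_of_nonpos (by linarith)] at h1
      linarith
    · have h1 := (abs_sub_bound (Set.left_mem_Icc.2 (lo_lt_hi a).le)
        (Set.right_mem_Icc.2 (lo_lt_hi b).le)).2 h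
      rw [abs_of_nonneg (sub_nonneg.2 hc)] at hg ⊢
      unfold lo hi at h1
      rw [abs_of_nonneg (by linarith)] at h1
      linarith
  rw [cD, Metric.mem_closedBall] at hz hw
  have h2 := dist_triangle4 (S.center a : ℂ) z w (S.center b : ℂ)
  rw [dist_comm _ z, dist_eq_norm (S.center a : ℂ), ← Complex.ofReal_sub, Complex.norm_real,
    Real.norm_eq_abs, dist_eq_norm z w] at h2
  linarith

theorem im_eq_zero_of_mem_limitSet {z : ℂ} (hz : z ∈ S.limitSet) : z.im = 0 := by
  have hK := S.one_le_bound
  have hK0 : 0 < S.bound := by linarith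
  have key : ∀ n : ℕ, |z.im| ≤ S.bound ^ 3 * S.branch.C ^ 2 * S.branch.th ^ (n + 1) := by
    intro n
    obtain ⟨w, a, ζ, hl, hadm, hζ, -, hact⟩ := exists_actC_of_mem_limitSet hz (n + 1)
    obtain ⟨j, u, rfl⟩ := List.exists_cons_of_ne_nil (List.ne_nil_of_length_eq_add_one hl)
    obtain ⟨p, k, hk, hp, H⟩ := exists_pole u a j hadm
    have haj : a ≠ wordBar j := hadm.1
    let x : S.Pt := ⟨(a, S.center a), center_mem_J a⟩
    obtain ⟨H1, H2⟩ := H x rfl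
    have H3 := H2 ζ (D_subset_cD _ hζ)
    rw [hact] at H3
    have hτ : Real.exp (S.branch.tau (j :: u) x) ≤ S.branch.C ^ 2 * S.branch.th ^ (n + 1) := by
      rw [← hl]; exact BranchSystem.exp_tau_le (B := S.branch) (u := j :: u) (x := x) hadm
    have hxI := J_subset _ x.2
    have hpI := Set.Ioo_subset_Icc_self hp
    have hxp := (abs_sub_bound hxI hpI).1
    have hxp' := (abs_sub_bound hxI hpI).2 haj
    have hxp0 : 0 < |x.1.2 - p| := (inv_pos.2 hK0).trans_le hxp'
    have hζp := bound_inv_le_norm_sub haj (D_subset_cD _ hζ) (mem_cD_ofReal.2 hpI)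
    have hζx : ‖ζ - x.1.2‖ ≤ S.bound := by
      have h1 : ‖ζ - x.1.2‖ < S.radius a := by rw [← dist_eq_norm]; exact hζ
      have h2 := (abs_sub_bound (Set.right_mem_Icc.2 (lo_lt_hi a).le) hxI).1
      have h3 : S.hi a - x.1.2 = S.radius a := by simp [hi, x]
      rw [h3] at h2
      exact h1.le.trans ((le_abs_self _).trans h2)
    set E := Real.exp (S.branch.tau (j :: u) x) with hE
    set N := ‖z - ((S.branch.act (j :: u) x).1.2 : ℂ)‖ with hN
    have hk' : k = E * |x.1.2 - p| ^ 2 := by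
      rw [H1, sq_abs, div_mul_cancel₀]
      rw [← sq_abs]; exact (pow_pos hxp0 2).ne'
    have h4 : N * ‖ζ - p‖ = E * |x.1.2 - p| * ‖ζ - x.1.2‖ := by
      rw [hk'] at H3
      exact mul_right_cancel₀ hxp0.ne' (by linear_combination H3)
    have h5 : |z.im| ≤ N := by
      have := Complex.abs_im_le_norm (z - ((S.branch.act (j :: u) x).1.2 : ℂ))
      rwa [Complex.sub_im, Complex.ofReal_im, sub_zero] at this
    have h6 : N * S.bound⁻¹ ≤ E * S.bound * S.bound := by
      calc N * S.bound⁻¹ ≤ N * ‖ζ - p‖ := mul_le_mul_of_nonneg_left hζp (norm_nonneg _)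
        _ = E * |x.1.2 - p| * ‖ζ - x.1.2‖ := h4
        _ ≤ _ := by
          have := Real.exp_pos (S.branch.tau (j :: u) x)
          gcongr
    rw [mul_inv_le_iff₀ hK0] at h6
    calc |z.im| ≤ S.bound ^ 3 * E := by linarith
      _ ≤ S.bound ^ 3 * (S.branch.C ^ 2 * S.branch.th ^ (n + 1)) := by gcongr
      _ = _ := by ring
  have hlim : Tendsto (fun n : ℕ => S.bound ^ 3 * S.branch.C ^ 2 * S.branch.th ^ (n + 1)) atTop
      (𝓝 (S.bound ^ 3 * S.branch.C ^ 2 * 0)) :=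
    ((tendsto_pow_atTop_nhds_zero_of_lt_one S.branch.th_pos.le S.branch.th_lt).comp
      (tendsto_add_atTop_nat 1)).const_mul _
  rw [mul_zero] at hlim
  exact abs_nonpos_iff.1 (ge_of_tendsto' hlim key)

theorem limitSet_subset : S.limitSet ⊆ Complex.ofReal '' Set.univ := fun z hz =>
  ⟨z.re, trivial, Complex.ext rfl (im_eq_zero_of_mem_limitSet hz).symm⟩

variable (S)

theorem dimH_limitSet_le : dimH S.limitSet ≤ 1 :=
  (dimH_mono limitSet_subset).trans_eq (by
    rw [Complex.isometry_ofReal.dimH_image, Real.dimH_univ])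

theorem delta_nonneg : 0 ≤ S.delta := ENNReal.toReal_nonneg

theorem delta_le_one : S.delta ≤ 1 :=
  ENNReal.toReal_le_of_le_ofReal zero_le_one (by rw [ENNReal.ofReal_one]; exact S.dimH_limitSet_le)

theorem isClosed_pos_image (a : S.branch.A) :
    IsClosed (S.branch.pos '' {x | S.branch.lab x = a}) := by
  have : S.branch.pos '' {x | S.branch.lab x = a} = S.J a := by
    ext x
    constructor
    · rintro ⟨y, rfl, rfl⟩; exact y.2
    · exact fun hx => ⟨⟨(a, x), hx⟩, rfl, rfl⟩
  rw [this]
  exact isClosed_Icc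

theorem summable_opL (Λ : ℝ) (hΛ : 1 < Λ) (x : S.branch.X) :
    Summable fun k : ℕ => (BranchSystem.opL (S.branch.dpow S.delta))^[k] (fun _ => 1) x / Λ ^ k := by
  by_contra hns
  obtain ⟨s, hs, K, hK, hmem⟩ := BranchSystem.exists_set_of_not_summable S.isClosed_pos_image
    S.delta_nonneg hΛ hns
  have h1 : Complex.ofReal '' K ⊆ S.limitSet := by
    rintro _ ⟨z, hz, rfl⟩
    exact mem_limitSet_of_forall_act (hmem z hz)
  have h2 := dimH_mono h1
  rw [Complex.isometry_ofReal.dimH_image] at h2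
  have h3 := ENNReal.toReal_mono (ne_top_of_le_ne_top ENNReal.one_ne_top S.dimH_limitSet_le)
    (hK.trans h2)
  rw [ENNReal.coe_toReal] at h3
  exact absurd h3 (not_le.2 hs)

end Schottky

namespace Schottky

open Filter

variable (S : Schottky)

theorem Icc_subset_closure (a : Fin (2 * S.r)) :
    Set.Icc (S.lo a) (S.hi a) ⊆ closure S.Iall := by
  rw [← closure_Ioo (lo_lt_hi a).ne]
  refine closure_mono fun x hx => Set.mem_iUnion.2 ⟨a, mem_D_ofReal.2 hx⟩

theorem exists_bound_lipschitz {V : Type} [NormedAddCommGroup V] [NormedSpace ℝ V] {F : ℝ → V}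
    (hF : ContDiffOn ℝ 1 F (closure S.Iall)) : ∃ M : ℝ, ∀ a,
      (∀ x ∈ Set.Icc (S.lo a) (S.hi a), ‖F x‖ ≤ M) ∧
      ∀ x ∈ Set.Icc (S.lo a) (S.hi a), ∀ y ∈ Set.Icc (S.lo a) (S.hi a),
        ‖F x - F y‖ ≤ M * |x - y| := by
  have h : ∀ᶠ M : ℝ in atTop, ∀ a, (∀ x ∈ Set.Icc (S.lo a) (S.hi a), ‖F x‖ ≤ M) ∧
      ∀ x ∈ Set.Icc (S.lo a) (S.hi a), ∀ y ∈ Set.Icc (S.lo a) (S.hi a),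
        ‖F x - F y‖ ≤ M * |x - y| := by
    refine eventually_all.2 fun a => ?_
    have hFa := hF.mono (S.Icc_subset_closure a)
    obtain ⟨C, hC⟩ := isCompact_Icc.exists_bound_of_continuousOn hFa.continuousOn
    obtain ⟨K, hK⟩ := hFa.exists_lipschitzOnWith one_ne_zero (convex_Icc _ _) isCompact_Icc
    filter_upwards [eventually_ge_atTop C, eventually_ge_atTop (K : ℝ)] with M h1 h2
    refine ⟨fun x hx => (hC x hx).trans h1, fun x hx y hy => ?_⟩
    have h3 := hK.dist_le_mul x hx y hy
    rw [dist_eq_norm, Real.dist_eq] at h3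
    exact h3.trans (mul_le_mul_of_nonneg_right h2 (abs_nonneg _))
  exact h.exists

theorem ofReal_cpow_eq {d : ℝ} (hd : 0 < d) (σ t : ℝ) :
    (d : ℂ) ^ ((σ : ℂ) + t * Complex.I) =
      ((d ^ σ : ℝ) : ℂ) * BranchSystem.cis (t * Real.log d) := by
  have hd' : (d : ℂ) ≠ 0 := by exact_mod_cast hd.ne'
  rw [Complex.cpow_add _ _ hd', Complex.ofReal_cpow hd.le, BranchSystem.cis,
    Complex.cpow_def_of_ne_zero hd' (t * Complex.I), ← Complex.ofReal_log hd.le]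
  congr 2
  push_cast
  ring

end Schottky

/-- there are `ε > 0` and `T₀ > 0` such that for every unitary
representation `(ρ, V)` of `Γ` and every `s = σ + it` with `δ − ε ≤ σ ≤ δ` and `|t| ≥ T₀`,
the only `C¹` function `F : I → V` fixed by the twisted transfer operator `ℒ_{s,ρ}` is
`F ≡ 0`. -/
theorem stmt_16 (S : Schottky) :
    ∃ ε T₀ : ℝ, 0 < ε ∧ 0 < T₀ ∧
      ∀ (V : Type) [NormedAddCommGroup V] [InnerProductSpace ℂ V] [CompleteSpace V],
      ∀ (ρ : S.SGroup →* (V ≃ₗᵢ[ℂ] V)) (σ t : ℝ),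
        S.delta - ε ≤ σ → σ ≤ S.delta → T₀ ≤ |t| →
        ∀ F : ℝ → V, ContDiffOn ℝ 1 F (closure S.Iall) →
        (∀ i : Fin (2 * S.r), ∀ x ∈ S.Ireal i,
          F x = ∑ j ∈ Finset.univ.filter (fun j : Fin (2 * S.r) => i ≠ wordBar j),
            (((mobiusDerivR (S.g j) x : ℂ)) ^ ((σ : ℂ) + t * Complex.I)) •
              ((ρ (S.genG j)⁻¹) (F (mobiusR (S.g j) x)))) →
        ∀ x ∈ S.Iall, F x = 0 := by
  obtain ⟨ε, hε, T, hT, H⟩ := BranchSystem.eq_zero_of_fixed S.branch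
    (inv_pos.2 (pow_pos (lt_of_lt_of_le one_pos S.one_le_bound) 3)) S.nonlocal_integrability
    S.delta_nonneg S.delta_le_one S.summable_opL
  refine ⟨ε, T, hε, hT, ?_⟩
  intro V _ _ _ ρ σ t h1 h2 h3 F hF heq
  obtain ⟨M, hM⟩ := S.exists_bound_lipschitz hF
  have hzero := H V (fun j : Fin (2 * S.r) => ρ (S.genG j)⁻¹) σ t (fun x : S.Pt => F x.1.2) M
    h1 h2 h3 (fun x => (hM x.1.1).1 _ (S.J_subset _ x.2)) (by
      intro x y hxy
      change x.1.1 = y.1.1 at hxy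
      exact (hM x.1.1).2 _ (S.J_subset _ x.2) _ (hxy ▸ S.J_subset _ y.2)) (by
      intro x
      refine (heq x.1.1 x.1.2 (S.pt_mem_D x)).trans ?_
      rw [Finset.sum_filter]
      refine Finset.sum_congr rfl fun j _ => ?_
      by_cases hj : x.1.1 ≠ wordBar j
      · have hd : 0 < mobiusDerivR (S.g j) x.1.2 := BranchSystem.d_pos (B := S.branch) hj
        rw [if_pos hj]
        refine Eq.trans ?_ (if_pos hj).symm
        rw [Schottky.ofReal_cpow_eq hd, mul_smul]
        change _ = ((mobiusDerivR (S.g j) x.1.2 ^ σ : ℝ) : ℂ) •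
          BranchSystem.cis (t * Real.log (mobiusDerivR (S.g j) x.1.2)) •
          (ρ (S.genG j)⁻¹) (F (S.stepPt j x).1.2)
        rw [S.stepPt_eq hj]
      · rw [if_neg hj]
        exact (if_neg hj).symm)
  intro x hx
  obtain ⟨i, hi⟩ := Set.mem_iUnion.1 hx
  rw [heq i x hi]
  refine Finset.sum_eq_zero fun j hj => ?_
  have hj' := (Finset.mem_filter.1 hj).2
  have h4 := S.mobiusR_mem_J hj' (Set.Ioo_subset_Icc_self (S.mem_D_ofReal.1 hi))
  have h5 : F (mobiusR (S.g j) x) = 0 := hzero ⟨(j, mobiusR (S.g j) x), h4⟩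
  rw [h5, map_zero, smul_zero]
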